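/- Every 4-blocked point set in the plane has at most 12 points, and there exists a 4-blocked point set with exactly 12 points (namely a {3,3,3,3}-blocked point set). -/

import Mathlib

/-- `x` blocks `v` and `w` if `x` lies strictly between `v` and `w`. -/
def Blocks {E : Type*} [AddCommGroup E] [Module ℝ E] (x v w : E) : Prop :=
  x ∈ openSegment ℝ v w

/-- `v` and `w` are visible with respect to `P` if no point of `P` blocks them. -/
def Visible {E : Type*} [AddCommGroup E] [Module ℝ E] (P : Set E) (v w : E) : Prop :=
  ∀ x ∈ P, ¬ Blocks x v w

/-- `c` is a blocked colouring of `P`: distinct points of `P` are visible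
iff they get different colours. -/
def BlockedColouring {E : Type*} [AddCommGroup E] [Module ℝ E] {k : ℕ}
    (P : Set E) (c : E → Fin k) : Prop :=
  ∀ v ∈ P, ∀ w ∈ P, v ≠ w → (Visible P v w ↔ c v ≠ c w)

/-- `P` is `k`-blocked. -/
def KBlocked {E : Type*} [AddCommGroup E] [Module ℝ E] (k : ℕ) (P : Set E) : Prop :=
  P.Finite ∧ ∃ c : E → Fin k, BlockedColouring P c

/-- `P` is `{n₁,…,n_k}`-blocked where `N` is the multiset of colour class sizes. -/
def IsNBlocked {E : Type*} [AddCommGroup E] [Module ℝ E] (N : Multiset ℕ) (P : Set E) : Prop :=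
  P.Finite ∧ ∃ (k : ℕ) (c : E → Fin k), BlockedColouring P c ∧
    N = Finset.univ.val.map (fun i : Fin k => (P ∩ c ⁻¹' {i}).ncard)

/-- A multiset of positive integers is representable if some planar point set is
`N`-blocked. -/
def Representable (N : Multiset ℕ) : Prop :=
  ∃ P : Set (ℝ × ℝ), IsNBlocked N P

/-- A set is in convex position if no point lies in the convex hull of the others. -/
def ConvexPosition {E : Type*} [AddCommGroup E] [Module ℝ E] (K : Set E) : Prop :=
  ∀ x ∈ K, x ∉ convexHull ℝ (K \ {x})

/-- `P` is `N`-midpoint-blocked: `N`-blocked, and midpoints of monochromatic pairs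
belong to `P`. -/
def IsNMidpointBlocked {E : Type*} [AddCommGroup E] [Module ℝ E]
    (N : Multiset ℕ) (P : Set E) : Prop :=
  P.Finite ∧ ∃ (k : ℕ) (c : E → Fin k), BlockedColouring P c ∧
    (∀ v ∈ P, ∀ w ∈ P, v ≠ w → c v = c w → midpoint ℝ v w ∈ P) ∧
    N = Finset.univ.val.map (fun i : Fin k => (P ∩ c ⁻¹' {i}).ncard)

/-- Twice the signed area of the triangle `p q r`. -/
def cross (p q r : ℝ × ℝ) : ℝ :=
  (q.1 - p.1) * (r.2 - p.2) - (q.2 - p.2) * (r.1 - p.1)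

theorem blocks_iff_exists {z u v : ℝ × ℝ} :
    Blocks z u v ↔ ∃ t : ℝ, 0 < t ∧ t < 1 ∧
      z.1 = (1 - t) * u.1 + t * v.1 ∧ z.2 = (1 - t) * u.2 + t * v.2 := by
  constructor
  · rintro ⟨s, t, hs, ht, hst, rfl⟩
    obtain rfl : s = 1 - t := by linarith
    exact ⟨t, ht, by linarith, by simp, by simp⟩
  · rintro ⟨t, h0, h1, hx, hy⟩
    exact ⟨1 - t, t, by linarith, h0, by ring, Prod.ext (by simp [hx]) (by simp [hy])⟩

theorem blocks_comm {z u v : ℝ × ℝ} : Blocks z u v ↔ Blocks z v u := by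
  unfold Blocks
  rw [openSegment_symm]

theorem Blocks.symm {z u v : ℝ × ℝ} (h : Blocks z u v) : Blocks z v u :=
  blocks_comm.1 h

theorem blocks_iff_cross_dot {z u v : ℝ × ℝ} (huv : u ≠ v) :
    Blocks z u v ↔ cross u v z = 0 ∧
      0 < (z.1 - u.1) * (v.1 - z.1) + (z.2 - u.2) * (v.2 - z.2) := by
  have hpos : 0 < (v.1 - u.1) ^ 2 + (v.2 - u.2) ^ 2 := by
    by_contra! h
    apply huv
    ext <;> nlinarith [sq_nonneg (v.1 - u.1), sq_nonneg (v.2 - u.2)]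
  rw [blocks_iff_exists]
  constructor
  · rintro ⟨t, h0, h1, hx, hy⟩
    refine ⟨by unfold cross; rw [hx, hy]; ring, ?_⟩
    have : (z.1 - u.1) * (v.1 - z.1) + (z.2 - u.2) * (v.2 - z.2)
        = t * (1 - t) * ((v.1 - u.1) ^ 2 + (v.2 - u.2) ^ 2) := by rw [hx, hy]; ring
    rw [this]
    have : 0 < 1 - t := by linarith
    positivity
  · rintro ⟨hc, hd⟩
    unfold cross at hc
    set N := (v.1 - u.1) ^ 2 + (v.2 - u.2) ^ 2 with hN
    set s := (z.1 - u.1) * (v.1 - u.1) + (z.2 - u.2) * (v.2 - u.2) with hs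
    have hx : (z.1 - u.1) * N = s * (v.1 - u.1) := by
      rw [hN, hs]; linear_combination (-(v.2 - u.2)) * hc
    have hy : (z.2 - u.2) * N = s * (v.2 - u.2) := by
      rw [hN, hs]; linear_combination (v.1 - u.1) * hc
    have hdot : ((z.1 - u.1) * (v.1 - z.1) + (z.2 - u.2) * (v.2 - z.2)) * N = s * (N - s) := by
      linear_combination (v.1 - z.1) * hx + (v.2 - z.2) * hy - s * hs + s * hN
    have hprod : 0 < s * (N - s) := hdot ▸ mul_pos hd hpos
    have hs0 : 0 < s := by
      by_contra! h
      nlinarith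
    have hs1 : s < N := by nlinarith
    refine ⟨s / N, by positivity, (div_lt_one hpos).2 hs1, ?_, ?_⟩
    · field_simp
      linear_combination hx
    · field_simp
      linear_combination hy

/-- The embedding of the integer lattice into the plane. -/
def latticePoint (z : ℤ × ℤ) : ℝ × ℝ := (z.1, z.2)

theorem latticePoint_injective : Function.Injective latticePoint := by
  intro z w h
  simpa [latticePoint, Prod.ext_iff] using h

theorem blocks_latticePoint_iff {z u v : ℤ × ℤ} (huv : u ≠ v) :
    Blocks (latticePoint z) (latticePoint u) (latticePoint v) ↔
      (v.1 - u.1) * (z.2 - u.2) - (v.2 - u.2) * (z.1 - u.1) = 0 ∧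
        0 < (z.1 - u.1) * (v.1 - z.1) + (z.2 - u.2) * (v.2 - z.2) := by
  rw [blocks_iff_cross_dot (latticePoint_injective.ne huv)]
  simp only [cross, latticePoint]
  norm_cast

/-- Twelve lattice points; the `i`-th one gets colour `i / 3`. -/
def twelvePoints : Fin 12 → ℤ × ℤ :=
  ![(0, 1), (2, 3), (4, 3), (1, 2), (3, 2), (5, 4), (2, 2), (2, 4), (4, 0),
    (3, 3), (3, 1), (1, 5)]

def twelveColour (i : Fin 12) : Fin 4 := ![0, 0, 0, 1, 1, 1, 2, 2, 2, 3, 3, 3] i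

theorem twelvePoints_injective : Function.Injective twelvePoints := by decide

theorem twelvePoints_visible_iff (i j : Fin 12) (hij : i ≠ j) :
    (∀ k, ¬ (((twelvePoints j).1 - (twelvePoints i).1) * ((twelvePoints k).2 - (twelvePoints i).2)
        - ((twelvePoints j).2 - (twelvePoints i).2) * ((twelvePoints k).1 - (twelvePoints i).1) = 0 ∧
      0 < ((twelvePoints k).1 - (twelvePoints i).1) * ((twelvePoints j).1 - (twelvePoints k).1)
        + ((twelvePoints k).2 - (twelvePoints i).2) * ((twelvePoints j).2 - (twelvePoints k).2))) ↔
      twelveColour i ≠ twelveColour j := by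
  revert i j
  decide +kernel

theorem exists_threefold_blocked :
    ∃ P : Set (ℝ × ℝ), IsNBlocked ({3, 3, 3, 3} : Multiset ℕ) P ∧ P.ncard = 12 := by
  set f : Fin 12 → ℝ × ℝ := latticePoint ∘ twelvePoints with hf
  have hinj : Function.Injective f := latticePoint_injective.comp twelvePoints_injective
  have hc : ∀ i, Function.extend f twelveColour 0 (f i) = twelveColour i :=
    fun i => hinj.extend_apply _ _ i
  refine ⟨Set.range f, ⟨Set.finite_range f, 4, Function.extend f twelveColour 0, ?_, ?_⟩, ?_⟩
  · rintro _ ⟨i, rfl⟩ _ ⟨j, rfl⟩ hne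
    have hij : i ≠ j := fun h => hne (h ▸ rfl)
    rw [hc, hc, ← twelvePoints_visible_iff i j hij]
    simp only [Visible, Set.forall_mem_range]
    refine forall_congr' fun k => not_congr ?_
    exact blocks_latticePoint_iff (twelvePoints_injective.ne hij)
  · have key : ∀ a : Fin 4, (Set.range f ∩ Function.extend f twelveColour 0 ⁻¹' {a}).ncard = 3 := by
      intro a
      have : Set.range f ∩ Function.extend f twelveColour 0 ⁻¹' {a}
          = f '' {i | twelveColour i = a} := by
        ext p
        constructor
        · rintro ⟨⟨i, rfl⟩, h⟩
          exact ⟨i, by simpa [hc] using h, rfl⟩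
        · rintro ⟨i, h, rfl⟩
          exact ⟨⟨i, rfl⟩, by simpa [hc] using h⟩
      rw [this, Set.ncard_image_of_injective _ hinj, Set.ncard_eq_toFinset_card']
      clear this
      revert a
      decide
    simp only [key]
    rfl
  · rw [← Set.image_univ, Set.ncard_image_of_injective _ hinj]
    simp

/-- A finite planar set together with a blocked colouring by four colours. -/
structure FourBlocked (P : Set (ℝ × ℝ)) (c : ℝ × ℝ → Fin 4) : Prop where
  finite : P.Finite
  colouring : BlockedColouring P c

theorem Blocks.ne_left {z u v : ℝ × ℝ} (h : Blocks z u v) (huv : u ≠ v) : z ≠ u := by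
  rintro rfl
  exact huv ((left_mem_openSegment_iff (𝕜 := ℝ)).1 h)

theorem Blocks.ne_right {z u v : ℝ × ℝ} (h : Blocks z u v) (huv : u ≠ v) : z ≠ v :=
  h.symm.ne_left huv.symm

theorem Blocks.cross_eq {z u v : ℝ × ℝ} (h : Blocks z u v) :
    ∃ t : ℝ, 0 < t ∧ t < 1 ∧ ∀ p q, cross p q z = (1 - t) * cross p q u + t * cross p q v := by
  obtain ⟨t, h0, h1, hx, hy⟩ := blocks_iff_exists.1 h
  refine ⟨t, h0, h1, fun p q => ?_⟩
  unfold cross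
  rw [hx, hy]
  ring

theorem cross_rotate (p q r : ℝ × ℝ) : cross p q r = cross q r p := by
  unfold cross; ring

theorem cross_swap (p q r : ℝ × ℝ) : cross q p r = -cross p q r := by
  unfold cross; ring

theorem cross_swap_right (p q r : ℝ × ℝ) : cross p r q = -cross p q r := by
  unfold cross; ring

theorem cross_self_left (p q : ℝ × ℝ) : cross p p q = 0 := by
  unfold cross; ring

theorem cross_self_right (p q : ℝ × ℝ) : cross p q q = 0 := by
  unfold cross; ring

theorem cross_self_mid (p q : ℝ × ℝ) : cross p q p = 0 := by
  unfold cross; ring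

theorem Blocks.cross_zero {z u v : ℝ × ℝ} (h : Blocks z u v) : cross u v z = 0 := by
  obtain ⟨t, -, -, ht⟩ := h.cross_eq
  rw [ht, cross_self_mid, cross_self_right]
  ring

/-- A point of the line through two distinct points is determined by an affine parameter. -/
theorem exists_param_of_cross_eq_zero {p q r : ℝ × ℝ} (hpq : p ≠ q) (h : cross p q r = 0) :
    ∃ t : ℝ, r = AffineMap.lineMap p q t := by
  have hpos : 0 < (q.1 - p.1) ^ 2 + (q.2 - p.2) ^ 2 := by
    by_contra! hn
    apply hpq
    ext <;> nlinarith [sq_nonneg (q.1 - p.1), sq_nonneg (q.2 - p.2)]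
  refine ⟨((r.1 - p.1) * (q.1 - p.1) + (r.2 - p.2) * (q.2 - p.2)) /
    ((q.1 - p.1) ^ 2 + (q.2 - p.2) ^ 2), ?_⟩
  unfold cross at h
  ext
  · simp only [AffineMap.lineMap_apply, vsub_eq_sub, vadd_eq_add, Prod.fst_add, Prod.smul_fst,
      Prod.fst_sub, smul_eq_mul]
    field_simp
    linear_combination (-(q.2 - p.2)) * h
  · simp only [AffineMap.lineMap_apply, vsub_eq_sub, vadd_eq_add, Prod.snd_add, Prod.smul_snd,
      Prod.snd_sub, smul_eq_mul]
    field_simp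
    linear_combination (q.1 - p.1) * h

theorem blocks_lineMap {p q : ℝ × ℝ} {a b d : ℝ} (hab : a < b) (hbd : b < d) :
    Blocks (AffineMap.lineMap p q b : ℝ × ℝ) (AffineMap.lineMap p q a) (AffineMap.lineMap p q d) := by
  rw [blocks_iff_exists]
  have : 0 < d - a := by linarith
  refine ⟨(b - a) / (d - a), div_pos (by linarith) this, (div_lt_one this).2 (by linarith), ?_, ?_⟩
  all_goals
    simp [AffineMap.lineMap_apply]
    field_simp
    ring

/-- If `x` lies between `v` and `w`, a point between `v` and `x` lies between `v` and `w`. -/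
theorem Blocks.trans_left {v w x z : ℝ × ℝ} (hx : Blocks x v w) (hz : Blocks z v x) :
    Blocks z v w := by
  obtain ⟨t, h0, h1, hx1, hx2⟩ := blocks_iff_exists.1 hx
  obtain ⟨s, k0, k1, hz1, hz2⟩ := blocks_iff_exists.1 hz
  refine blocks_iff_exists.2 ⟨s * t, by positivity, by nlinarith, ?_, ?_⟩
  · rw [hz1, hx1]; ring
  · rw [hz2, hx2]; ring

theorem Blocks.trans_right {v w x z : ℝ × ℝ} (hx : Blocks x v w) (hz : Blocks z v x) :
    Blocks x z w := by
  obtain ⟨t, h0, h1, hx1, hx2⟩ := blocks_iff_exists.1 hx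
  obtain ⟨s, k0, k1, hz1, hz2⟩ := blocks_iff_exists.1 hz
  have hst : 0 < 1 - s * t := by nlinarith
  have hne : 1 - s * t ≠ 0 := hst.ne'
  refine blocks_iff_exists.2 ⟨t * (1 - s) / (1 - s * t), ?_, ?_, ?_, ?_⟩
  · have : 0 < 1 - s := by linarith
    positivity
  · rw [div_lt_one hst]; nlinarith
  all_goals
    have he := div_mul_cancel₀ (t * (1 - s)) hne
    apply mul_left_cancel₀ hne
  · rw [hz1, hx1]; linear_combination ((1 - s * t) * (v.1 - w.1)) * he
  · rw [hz2, hx2]; linear_combination ((1 - s * t) * (v.2 - w.2)) * he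

namespace FourBlocked

variable {P Q : Set (ℝ × ℝ)} {c : ℝ × ℝ → Fin 4}

theorem colour_eq (h : FourBlocked P c) {z u v : ℝ × ℝ} (hz : z ∈ P) (hu : u ∈ P) (hv : v ∈ P)
    (hb : Blocks z u v) : c u = c v := by
  by_cases huv : u = v
  · rw [huv]
  by_contra hne
  exact (h.colouring u hu v hv huv).2 hne z hz hb

theorem exists_blocker (h : FourBlocked P c) {u v : ℝ × ℝ} (hu : u ∈ P) (hv : v ∈ P)
    (huv : u ≠ v) (hc : c u = c v) : ∃ z ∈ P, Blocks z u v := by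
  by_contra! hn
  exact (h.colouring u hu v hv huv).1 hn hc

theorem colour_ne (h : FourBlocked P c) {z u v : ℝ × ℝ} (hz : z ∈ P) (hu : u ∈ P) (hv : v ∈ P)
    (huv : u ≠ v) (hb : Blocks z u v) : c z ≠ c u := by
  suffices H : ∀ n, ∀ z ∈ P, (P ∩ openSegment ℝ u z).ncard = n → Blocks z u v → c z ≠ c u from
    H _ z hz rfl hb
  intro n
  induction n using Nat.strong_induction_on with
  | _ n ih =>
    intro z hz hn hb hc
    have hzu := hb.ne_left huv
    obtain ⟨x, hx, hxb⟩ := h.exists_blocker hu hz hzu.symm hc.symm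
    have hxv : Blocks x u v := hb.trans_left hxb
    refine ih _ ?_ x hx rfl hxv ?_
    · rw [← hn]
      refine Set.ncard_lt_ncard ⟨?_, ?_⟩ (h.finite.subset Set.inter_subset_left)
      · rintro y ⟨hyP, hy⟩
        exact ⟨hyP, hxb.trans_left hy⟩
      · intro hsub
        have : x ∈ openSegment ℝ u x := (hsub ⟨hx, hxb⟩).2
        exact hxb.ne_left hzu.symm ((right_mem_openSegment_iff (𝕜 := ℝ)).1 this).symm
    · rw [h.colour_eq hz hx hv (hb.trans_right hxb), h.colour_eq hz hu hv hb]

theorem colour_ne_right (h : FourBlocked P c) {z u v : ℝ × ℝ} (hz : z ∈ P) (hu : u ∈ P)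
    (hv : v ∈ P) (huv : u ≠ v) (hb : Blocks z u v) : c z ≠ c v :=
  h.colour_ne hz hv hu huv.symm hb.symm

/-- No four distinct points of a blocked set are collinear. -/
theorem not_four_collinear (h : FourBlocked P c) {p q r s : ℝ × ℝ} (hp : p ∈ P) (hq : q ∈ P)
    (hr : r ∈ P) (hs : s ∈ P) (hpq : p ≠ q) (hpr : p ≠ r) (hps : p ≠ s) (hqr : q ≠ r)
    (hqs : q ≠ s) (hrs : r ≠ s) (h1 : cross p q r = 0) (h2 : cross p q s = 0) : False := by
  obtain ⟨t, ht⟩ := exists_param_of_cross_eq_zero hpq h1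
  obtain ⟨t', ht'⟩ := exists_param_of_cross_eq_zero hpq h2
  set f : ℝ → ℝ × ℝ := fun a => AffineMap.lineMap p q a with hf
  have hp0 : p = f 0 := by simp [hf]
  have hq1 : q = f 1 := by simp [hf]
  have hrt : r = f t := ht
  have hst : s = f t' := ht'
  set T : Finset ℝ := {0, 1, t, t'} with hT
  have hcard : T.card = 4 := by
    have h1 : t ≠ t' := by rintro rfl; exact hrs (ht.trans ht'.symm)
    have h2 : (0 : ℝ) ≠ t := by rintro rfl; exact hpr (by simpa using ht.symm)
    have h3 : (0 : ℝ) ≠ t' := by rintro rfl; exact hps (by simpa using ht'.symm)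
    have h4 : (1 : ℝ) ≠ t := by rintro rfl; exact hqr (by simpa using ht.symm)
    have h5 : (1 : ℝ) ≠ t' := by rintro rfl; exact hqs (by simpa using ht'.symm)
    simp [*]
  have hTP : ∀ a ∈ T, f a ∈ P := by
    intro a ha
    simp only [hT, Finset.mem_insert, Finset.mem_singleton] at ha
    rcases ha with rfl | rfl | rfl | rfl
    · exact hp0 ▸ hp
    · exact hq1 ▸ hq
    · exact hrt ▸ hr
    · exact hst ▸ hs
  let e := T.orderEmbOfFin hcard
  have hmem : ∀ i, f (e i) ∈ P := fun i => hTP _ (Finset.orderEmbOfFin_mem T hcard i)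
  have hlt : ∀ {i j : Fin 4}, i < j → e i < e j := fun hij => e.strictMono hij
  have hb1 : Blocks (f (e 1)) (f (e 0)) (f (e 2)) := blocks_lineMap (hlt (by decide)) (hlt (by decide))
  have hb2 : Blocks (f (e 2)) (f (e 0)) (f (e 3)) := blocks_lineMap (hlt (by decide)) (hlt (by decide))
  have hne : f (e 0) ≠ f (e 3) := by
    intro he
    have hinj : Function.Injective f := AffineMap.lineMap_injective ℝ hpq
    exact (hlt (show (0 : Fin 4) < 3 by decide)).ne (hinj he)
  exact h.colour_ne (hmem 2) (hmem 0) (hmem 3) hne hb2 (h.colour_eq (hmem 1) (hmem 0) (hmem 2) hb1).symm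

/-- Three distinct points of the same colour are not collinear. -/
theorem cross_ne_zero (h : FourBlocked P c) {u v w : ℝ × ℝ} (hu : u ∈ P) (hv : v ∈ P)
    (hw : w ∈ P) (huv : u ≠ v) (huw : u ≠ w) (hvw : v ≠ w) (hcv : c u = c v) (hcw : c u = c w) :
    cross u v w ≠ 0 := by
  intro h0
  obtain ⟨t, rfl⟩ := exists_param_of_cross_eq_zero huv h0
  set f : ℝ → ℝ × ℝ := fun a => AffineMap.lineMap u v a with hf
  have h0 : f 0 = u := by simp [hf]
  have h1 : f 1 = v := by simp [hf]
  rcases lt_trichotomy t 0 with ht | rfl | ht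
  · have : Blocks (f 0) (f t) (f 1) := blocks_lineMap ht one_pos
    rw [h0, h1] at this
    exact h.colour_ne_right hu hw hv hvw.symm this hcv
  · simp at huw
  rcases lt_trichotomy t 1 with ht1 | rfl | ht1
  · have : Blocks (f t) (f 0) (f 1) := blocks_lineMap ht ht1
    rw [h0, h1] at this
    exact h.colour_ne hw hu hv huv this hcw.symm
  · simp at hvw
  · have : Blocks (f 1) (f 0) (f t) := blocks_lineMap one_pos ht1
    rw [h0, h1] at this
    exact h.colour_ne hv hu hw huw this hcv.symm

/-- A subset containing every point of `P` that blocks two of its points is blocked. -/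
theorem restrict (h : FourBlocked P c) (hQ : Q ⊆ P)
    (hcl : ∀ u ∈ Q, ∀ v ∈ Q, u ≠ v → ∀ z ∈ P, Blocks z u v → z ∈ Q) : FourBlocked Q c := by
  refine ⟨h.finite.subset hQ, fun u hu v hv huv => ?_⟩
  rw [← h.colouring u (hQ hu) v (hQ hv) huv]
  exact ⟨fun H z hz hb => H z (hcl u hu v hv huv z hz hb) hb, fun H z hz => H z (hQ hz)⟩

end FourBlocked

theorem cross_add_cross_add_cross (a b d x : ℝ × ℝ) :
    cross a b x + cross b d x + cross d a x = cross a b d := by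
  unfold cross; ring

/-- Expansion of an affine functional in barycentric coordinates. -/
theorem cross_mul_cross (p q a b d x : ℝ × ℝ) :
    cross p q x * cross a b d =
      cross p q a * cross b d x + cross p q b * cross d a x + cross p q d * cross a b x := by
  unfold cross; ring

theorem ne_of_cross_ne_zero {a b d : ℝ × ℝ} (h : cross a b d ≠ 0) : a ≠ b ∧ a ≠ d ∧ b ≠ d := by
  refine ⟨?_, ?_, ?_⟩ <;> rintro rfl <;>
    simp [cross_self_left, cross_self_mid, cross_self_right] at h

theorem eq_of_cross_eq_zero {a b d x : ℝ × ℝ} (h : cross a b d ≠ 0) (h1 : cross a b x = 0)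
    (h2 : cross d a x = 0) : x = a := by
  have e1 : (x.1 - a.1) * cross a b d = 0 := by
    unfold cross at *
    linear_combination (d.1 - a.1) * h1 + (b.1 - a.1) * h2
  have e2 : (x.2 - a.2) * cross a b d = 0 := by
    unfold cross at *
    linear_combination (d.2 - a.2) * h1 + (b.2 - a.2) * h2
  ext
  · linarith [(mul_eq_zero.1 e1).resolve_right h]
  · linarith [(mul_eq_zero.1 e2).resolve_right h]

namespace Blocks

variable {z u v p q : ℝ × ℝ}

theorem cross_nonneg (h : Blocks z u v) (hu : 0 ≤ cross p q u) (hv : 0 ≤ cross p q v) :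
    0 ≤ cross p q z := by
  obtain ⟨t, h0, h1, ht⟩ := h.cross_eq
  rw [ht]
  have : 0 ≤ 1 - t := by linarith
  positivity

theorem cross_pos (h : Blocks z u v) (hu : 0 < cross p q u) (hv : 0 ≤ cross p q v) :
    0 < cross p q z := by
  obtain ⟨t, h0, h1, ht⟩ := h.cross_eq
  rw [ht]
  have : 0 < 1 - t := by linarith
  positivity

theorem cross_pos' (h : Blocks z u v) (hu : 0 ≤ cross p q u) (hv : 0 < cross p q v) :
    0 < cross p q z :=
  h.symm.cross_pos hv hu

theorem cross_neg (h : Blocks z u v) (hu : cross p q u < 0) (hv : cross p q v ≤ 0) :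
    cross p q z < 0 := by
  have := h.cross_pos (p := q) (q := p) (by rw [cross_swap]; linarith) (by rw [cross_swap]; linarith)
  rw [cross_swap] at this
  linarith

theorem cross_neg' (h : Blocks z u v) (hu : cross p q u ≤ 0) (hv : cross p q v < 0) :
    cross p q z < 0 :=
  h.symm.cross_neg hv hu

end Blocks

/-- The closed triangle with positively oriented vertices `a b d`. -/
def Tri (a b d : ℝ × ℝ) : Set (ℝ × ℝ) :=
  {x | 0 ≤ cross a b x ∧ 0 ≤ cross b d x ∧ 0 ≤ cross d a x}

theorem tri_rotate (a b d : ℝ × ℝ) : Tri a b d = Tri b d a := by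
  ext x
  simp only [Tri, Set.mem_ofPred_eq]
  tauto

theorem left_mem_tri {a b d : ℝ × ℝ} (h : 0 < cross a b d) : a ∈ Tri a b d := by
  refine ⟨?_, ?_, ?_⟩
  · rw [cross_self_mid]
  · rw [← cross_rotate]; exact h.le
  · rw [cross_self_right]

theorem Blocks.mem_tri {z u v a b d : ℝ × ℝ} (h : Blocks z u v) (hu : u ∈ Tri a b d)
    (hv : v ∈ Tri a b d) : z ∈ Tri a b d :=
  ⟨h.cross_nonneg hu.1 hv.1, h.cross_nonneg hu.2.1 hv.2.1, h.cross_nonneg hu.2.2 hv.2.2⟩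

/-- A vertex of a triangle lies between no two points of the triangle. -/
theorem not_blocks_left {u v a b d : ℝ × ℝ} (h : 0 < cross a b d) (hu : u ∈ Tri a b d)
    (hv : v ∈ Tri a b d) (huv : u ≠ v) : ¬ Blocks a u v := by
  intro hb
  have key : ∀ w ∈ Tri a b d, Blocks a u w → u = a := by
    intro w hw hbw
    refine eq_of_cross_eq_zero h.ne' ?_ ?_
    · by_contra hne
      have := hbw.cross_pos (lt_of_le_of_ne hu.1 (Ne.symm hne)) hw.1
      rw [cross_self_mid] at this
      exact this.false
    · by_contra hne
      have := hbw.cross_pos (lt_of_le_of_ne hu.2.2 (Ne.symm hne)) hw.2.2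
      rw [cross_self_right] at this
      exact this.false
  exact hb.ne_left huv (key v hv hb).symm

theorem not_blocks_vertex {u v a b d z : ℝ × ℝ} (h : 0 < cross a b d) (hu : u ∈ Tri a b d)
    (hv : v ∈ Tri a b d) (huv : u ≠ v) (hb : Blocks z u v) : z ≠ a ∧ z ≠ b ∧ z ≠ d := by
  refine ⟨?_, ?_, ?_⟩ <;> rintro rfl
  · exact not_blocks_left h hu hv huv hb
  · rw [tri_rotate] at hu hv
    rw [cross_rotate] at h
    exact not_blocks_left h hu hv huv hb
  · rw [tri_rotate, tri_rotate] at hu hv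
    rw [cross_rotate, cross_rotate] at h
    exact not_blocks_left h hu hv huv hb

namespace FourBlocked

variable {P Q : Set (ℝ × ℝ)} {c : ℝ × ℝ → Fin 4}

theorem tri_diff (h : FourBlocked P c) {a b d : ℝ × ℝ} (habd : 0 < cross a b d) :
    FourBlocked ((P ∩ Tri a b d) \ {a, b, d}) c := by
  refine h.restrict (fun x hx => hx.1.1) ?_
  rintro u ⟨hu, -⟩ v ⟨hv, -⟩ huv z hz hb
  refine ⟨⟨hz, hb.mem_tri hu.2 hv.2⟩, ?_⟩
  have := not_blocks_vertex habd hu.2 hv.2 huv hb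
  simp [this]

/-- A positively oriented monochromatic triangle containing no further point of its colour. -/
structure EmptyTri (P : Set (ℝ × ℝ)) (c : ℝ × ℝ → Fin 4) (a b d : ℝ × ℝ) : Prop where
  mem_a : a ∈ P
  mem_b : b ∈ P
  mem_d : d ∈ P
  pos : 0 < cross a b d
  eq_b : c a = c b
  eq_d : c a = c d
  empty : ∀ x ∈ P, x ∈ Tri a b d → c x = c a → x = a ∨ x = b ∨ x = d

theorem exists_emptyTri (h : FourBlocked P c) {a b d : ℝ × ℝ} (ha : a ∈ P) (hb : b ∈ P)
    (hd : d ∈ P) (hab : a ≠ b) (had : a ≠ d) (hbd : b ≠ d) (hcb : c a = c b) (hcd : c a = c d) :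
    ∃ a' b' d', EmptyTri P c a' b' d' ∧ c a' = c a := by
  suffices H : ∀ n, ∀ a ∈ P, ∀ b ∈ P, ∀ d ∈ P, 0 < cross a b d → c a = c b → c a = c d →
      (P ∩ Tri a b d).ncard = n → ∃ a' b' d', EmptyTri P c a' b' d' ∧ c a' = c a by
    rcases lt_or_gt_of_ne (h.cross_ne_zero ha hb hd hab had hbd hcb hcd) with h0 | h0
    · exact H _ a ha d hd b hb (by rw [cross_swap_right]; linarith) hcd hcb rfl
    · exact H _ a ha b hb d hd h0 hcb hcd rfl
  intro n
  induction n using Nat.strong_induction_on with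
  | _ n ih =>
    intro a ha b hb d hd hpos hcb hcd hn
    by_cases hE : ∀ x ∈ P, x ∈ Tri a b d → c x = c a → x = a ∨ x = b ∨ x = d
    · exact ⟨a, b, d, ⟨ha, hb, hd, hpos, hcb, hcd, hE⟩, rfl⟩
    push Not at hE
    obtain ⟨x, hx, ⟨h1, h2, h3⟩, hcx, hxa, hxb, hxd⟩ := hE
    obtain ⟨hab, had, hbd⟩ := ne_of_cross_ne_zero hpos.ne'
    have h1 : 0 < cross a b x :=
      lt_of_le_of_ne h1 (h.cross_ne_zero ha hb hx hab hxa.symm hxb.symm hcb hcx.symm).symm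
    have h2' : 0 < cross b d x := lt_of_le_of_ne h2
      (h.cross_ne_zero hb hd hx hbd hxb.symm hxd.symm (hcb.symm.trans hcd) (hcb.symm.trans hcx.symm)).symm
    refine ih _ ?_ a ha b hb x hx h1 hcb hcx.symm rfl
    rw [← hn]
    refine Set.ncard_lt_ncard ⟨?_, ?_⟩ (h.finite.subset Set.inter_subset_left)
    · rintro y ⟨hyP, y1, y2, y3⟩
      refine ⟨hyP, y1, ?_, ?_⟩
      · have := cross_mul_cross b d a b x y
        rw [cross_self_mid, ← cross_rotate a b d] at this
        nlinarith [mul_nonneg hpos.le y2, mul_nonneg h2 y1]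
      · have := cross_mul_cross d a a b x y
        rw [cross_self_right, cross_rotate d a b] at this
        nlinarith [mul_nonneg hpos.le y3, mul_nonneg h3 y1]
    · intro hsub
      have hdm : d ∈ P ∩ Tri a b d := by
        refine ⟨hd, ?_⟩
        rw [← tri_rotate]
        exact left_mem_tri (by rwa [cross_rotate d a b])
      have := (hsub hdm).2.2.1
      rw [cross_swap_right] at this
      linarith

namespace EmptyTri

variable {a b d : ℝ × ℝ}

/-- The side blockers of an empty monochromatic triangle are not collinear. -/
theorem exists_side_blockers (h : FourBlocked P c) (e : EmptyTri P c a b d) :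
    ∃ x y z, x ∈ (P ∩ Tri a b d) \ {a, b, d} ∧ y ∈ (P ∩ Tri a b d) \ {a, b, d} ∧
      z ∈ (P ∩ Tri a b d) \ {a, b, d} ∧ cross x y z ≠ 0 := by
  have hpos := e.pos
  obtain ⟨hab, had, hbd⟩ := ne_of_cross_ne_zero e.pos.ne'
  obtain ⟨x, hx, hxb⟩ := h.exists_blocker e.mem_a e.mem_b hab e.eq_b
  obtain ⟨y, hy, hyb⟩ := h.exists_blocker e.mem_b e.mem_d hbd (e.eq_b.symm.trans e.eq_d)
  obtain ⟨z, hz, hzb⟩ := h.exists_blocker e.mem_d e.mem_a had.symm e.eq_d.symm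
  have hat : a ∈ Tri a b d := left_mem_tri e.pos
  have hbt : b ∈ Tri a b d := by
    rw [tri_rotate]; exact left_mem_tri (by rw [← cross_rotate a b d]; exact e.pos)
  have hdt : d ∈ Tri a b d := by
    rw [← tri_rotate]; exact left_mem_tri (by rw [cross_rotate d a b]; exact e.pos)
  have hmem : ∀ {w u v}, w ∈ P → u ∈ Tri a b d → v ∈ Tri a b d → u ≠ v → Blocks w u v →
      w ∈ (P ∩ Tri a b d) \ {a, b, d} := by
    intro w u v hw hu hv huv hb
    have := not_blocks_vertex e.pos hu hv huv hb
    exact ⟨⟨hw, hb.mem_tri hu hv⟩, by simp [this]⟩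
  refine ⟨x, y, z, hmem hx hat hbt hab hxb, hmem hy hbt hdt hbd hyb,
    hmem hz hdt hat had.symm hzb, ?_⟩
  obtain ⟨s, s0, s1, hs1, hs2⟩ := blocks_iff_exists.1 hxb
  obtain ⟨t, t0, t1, ht1, ht2⟩ := blocks_iff_exists.1 hyb
  obtain ⟨r, r0, r1, hr1, hr2⟩ := blocks_iff_exists.1 hzb
  have : cross x y z = ((1 - s) * (1 - t) * (1 - r) + s * t * r) * cross a b d := by
    unfold cross
    rw [hs1, hs2, ht1, ht2, hr1, hr2]
    ring
  rw [this]
  have : 0 < (1 - s) * (1 - t) * (1 - r) + s * t * r := by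
    have := sub_pos.2 s1
    have := sub_pos.2 t1
    have := sub_pos.2 r1
    positivity
  positivity

theorem colour_ne_of_mem (e : EmptyTri P c a b d) {x : ℝ × ℝ}
    (hx : x ∈ (P ∩ Tri a b d) \ {a, b, d}) : c x ≠ c a := by
  intro hc
  have := e.empty x hx.1.1 hx.1.2 hc
  simp only [Set.mem_sdiff, Set.mem_insert_iff, Set.mem_singleton_iff] at hx
  tauto

end EmptyTri

/-- If only two colours occur, all points are collinear. -/
theorem cross_eq_zero_of_two_colours (h : FourBlocked Q c) {γ δ : Fin 4} (hγδ : γ ≠ δ)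
    (hγ : ∀ x ∈ Q, c x ≠ γ) (hδ : ∀ x ∈ Q, c x ≠ δ) {x y z : ℝ × ℝ} (hx : x ∈ Q) (hy : y ∈ Q)
    (hz : z ∈ Q) : cross x y z = 0 := by
  by_contra hne
  have pig : ∀ γ δ p q r : Fin 4, γ ≠ δ → p ≠ γ → q ≠ γ → r ≠ γ → p ≠ δ → q ≠ δ → r ≠ δ →
      p = q ∨ q = r ∨ r = p := by
    omega
  have no3 : ∀ a ∈ Q, ∀ b ∈ Q, ∀ d ∈ Q, a ≠ b → a ≠ d → b ≠ d → c a = c b → c a = c d → False := by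
    intro a ha b hb d hd hab had hbd hcb hcd
    obtain ⟨a', b', d', e, -⟩ := h.exists_emptyTri ha hb hd hab had hbd hcb hcd
    obtain ⟨u, v, w, hu, hv, hw, huvw⟩ := e.exists_side_blockers h
    have hQ := h.tri_diff e.pos
    have pig' : ∀ γ δ ε p q : Fin 4, γ ≠ δ → ε ≠ γ → ε ≠ δ → p ≠ γ → p ≠ δ → p ≠ ε → q ≠ γ →
        q ≠ δ → q ≠ ε → p = q := by
      omega
    have key : ∀ p ∈ (Q ∩ Tri a' b' d') \ {a', b', d'}, ∀ q ∈ (Q ∩ Tri a' b' d') \ {a', b', d'},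
        c p = c q := fun p hp q hq =>
      pig' γ δ (c a') _ _ hγδ (hγ _ e.mem_a) (hδ _ e.mem_a) (hγ p hp.1.1) (hδ p hp.1.1)
        (e.colour_ne_of_mem hp) (hγ q hq.1.1) (hδ q hq.1.1) (e.colour_ne_of_mem hq)
    obtain ⟨z, hz, hzb⟩ := hQ.exists_blocker hu hv (ne_of_cross_ne_zero huvw).1 (key u hu v hv)
    exact hQ.colour_ne hz hu hv (ne_of_cross_ne_zero huvw).1 hzb (key z hz u hu)
  have main : ∀ x ∈ Q, ∀ y ∈ Q, ∀ z ∈ Q, cross x y z ≠ 0 → c x = c y → False := by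
    intro x hx y hy z hz hne hc
    obtain ⟨hxy, hxz, hyz⟩ := ne_of_cross_ne_zero hne
    obtain ⟨w, hw, hwb⟩ := h.exists_blocker hx hy hxy hc
    have hwx := h.colour_ne hw hx hy hxy hwb
    have hzx : c z ≠ c x := fun hzx => no3 x hx y hy z hz hxy hxz hyz hc hzx.symm
    have hwz : w ≠ z := by
      rintro rfl
      exact hne hwb.cross_zero
    have hcwz : c w = c z := by
      rcases pig γ δ (c w) (c z) (c x) hγδ (hγ _ hw) (hγ _ hz) (hγ _ hx) (hδ _ hw) (hδ _ hz)
        (hδ _ hx) with h1 | h1 | h1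
      · exact h1
      · exact absurd h1 hzx
      · exact absurd h1.symm hwx
    obtain ⟨v, hv, hvb⟩ := h.exists_blocker hw hz hwz hcwz
    have hvw := h.colour_ne hv hw hz hwz hvb
    have hcvx : c v = c x := by
      rcases pig γ δ (c v) (c x) (c w) hγδ (hγ _ hv) (hγ _ hx) (hγ _ hw) (hδ _ hv) (hδ _ hx)
        (hδ _ hw) with h1 | h1 | h1
      · exact h1
      · exact absurd h1.symm hwx
      · exact absurd h1.symm hvw
    have hvxy : v = x ∨ v = y := by
      by_contra! hvxy
      exact no3 v hv x hx y hy hvxy.1 hvxy.2 hxy hcvx (hcvx.trans hc)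
    have hwx' := hwb.ne_left hxy
    have hwy' := hwb.ne_right hxy
    rcases hvxy with rfl | rfl
    · refine h.not_four_collinear hx hw hy hz hwx'.symm hxy hxz hwy' hwz hyz ?_ ?_
      · rw [cross_swap_right, hwb.cross_zero, neg_zero]
      · rw [cross_rotate, hvb.cross_zero]
    · refine h.not_four_collinear hy hw hx hz hwy'.symm hxy.symm hyz hwx' hwz hxz ?_ ?_
      · rw [← cross_rotate, hwb.cross_zero]
      · rw [cross_rotate, hvb.cross_zero]
  rcases pig γ δ (c x) (c y) (c z) hγδ (hγ _ hx) (hγ _ hy) (hγ _ hz) (hδ _ hx) (hδ _ hy) (hδ _ hz)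
    with h1 | h1 | h1
  · exact main x hx y hy z hz hne h1
  · exact main y hy z hz x hx (by rwa [← cross_rotate]) h1
  · exact main z hz x hx y hy (by rwa [cross_rotate]) h1

/-- If at most three colours occur, every colour class has at most two points. -/
theorem not_three_of_three_colours (h : FourBlocked Q c) {γ : Fin 4} (hγ : ∀ x ∈ Q, c x ≠ γ)
    {a b d : ℝ × ℝ} (ha : a ∈ Q) (hb : b ∈ Q) (hd : d ∈ Q) (hab : a ≠ b) (had : a ≠ d)
    (hbd : b ≠ d) (hcb : c a = c b) (hcd : c a = c d) : False := by
  obtain ⟨a', b', d', e, -⟩ := h.exists_emptyTri ha hb hd hab had hbd hcb hcd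
  obtain ⟨u, v, w, hu, hv, hw, huvw⟩ := e.exists_side_blockers h
  exact huvw ((h.tri_diff e.pos).cross_eq_zero_of_two_colours (hγ _ e.mem_a)
    (fun x hx => e.colour_ne_of_mem hx) (fun x hx => hγ x hx.1.1) hu hv hw)

end FourBlocked

namespace Blocks

variable {z u v p q : ℝ × ℝ}

theorem cross_neg_right (h : Blocks z u v) (hu : 0 < cross p q u) (hz : cross p q z ≤ 0) :
    cross p q v < 0 := by
  by_contra! hv
  exact absurd (h.cross_pos hu hv) hz.not_gt

theorem cross_neg_left (h : Blocks z u v) (hv : 0 < cross p q v) (hz : cross p q z ≤ 0) :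
    cross p q u < 0 :=
  h.symm.cross_neg_right hv hz

theorem cross_pos_right (h : Blocks z u v) (hu : cross p q u ≤ 0) (hz : 0 < cross p q z) :
    0 < cross p q v := by
  by_contra! hv
  obtain ⟨t, h0, h1, ht⟩ := h.cross_eq
  have := ht p q
  nlinarith

end Blocks

namespace FourBlocked

variable {P : Set (ℝ × ℝ)} {c : ℝ × ℝ → Fin 4}

/-- A line through three points of a blocked set contains no further point of the set. -/
theorem mem_line (h : FourBlocked P c) {u v y w x t : ℝ × ℝ} (hu : u ∈ P) (hv : v ∈ P)
    (hy : y ∈ P) (huv : u ≠ v) (hb : Blocks y u v) (hw : w = u ∨ w = v ∨ w = y)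
    (hx : x = u ∨ x = v ∨ x = y) (hwx : w ≠ x) (ht : t ∈ P) (h0 : cross w x t = 0) :
    t = u ∨ t = v ∨ t = y := by
  have hyu := hb.ne_left huv
  have hyv := hb.ne_right huv
  have e1 := hb.cross_zero
  have e2 : cross v u y = 0 := by rw [cross_swap, e1, neg_zero]
  have e3 : cross u y v = 0 := by rw [cross_swap_right, e1, neg_zero]
  have e4 : cross v y u = 0 := by rw [cross_swap_right, e2, neg_zero]
  have e5 : cross y u v = 0 := by rw [cross_rotate, e1]
  have e6 : cross y v u = 0 := by rw [cross_rotate, e2]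
  by_contra! hn
  obtain ⟨h1, h2, h3⟩ := hn
  rcases hw with rfl | rfl | rfl <;> rcases hx with rfl | rfl | rfl
  · exact hwx rfl
  · exact h.not_four_collinear hu hv hy ht huv hyu.symm h1.symm hyv.symm h2.symm h3.symm e1 h0
  · exact h.not_four_collinear hu hy hv ht hyu.symm huv h1.symm hyv h3.symm h2.symm e3 h0
  · exact h.not_four_collinear hv hu hy ht huv.symm hyv.symm h2.symm hyu.symm h1.symm h3.symm e2 h0
  · exact hwx rfl
  · exact h.not_four_collinear hv hy hu ht hyv.symm huv.symm h2.symm hyu h3.symm h1.symm e4 h0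
  · exact h.not_four_collinear hy hu hv ht hyu hyv h3.symm huv h1.symm h2.symm e5 h0
  · exact h.not_four_collinear hy hv hu ht hyv hyu h3.symm huv.symm h2.symm h1.symm e6 h0
  · exact hwx rfl

end FourBlocked

/-- The blocked quadrilateral: `a b d e` are the vertices, `s₁ s₂ s₃ s₄` block the sides and
`m` blocks both diagonals. -/
structure BlockedQuad (K : Set (ℝ × ℝ)) (c : ℝ × ℝ → Fin 4)
    (a b d e s₁ s₂ s₃ s₄ m : ℝ × ℝ) : Prop where
  eq : K = {a, b, d, e, s₁, s₂, s₃, s₄, m}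
  hs₁ : Blocks s₁ a b
  hs₂ : Blocks s₂ b d
  hs₃ : Blocks s₃ d e
  hs₄ : Blocks s₄ e a
  had : Blocks m a d
  hbe : Blocks m b e
  hs₁₃ : Blocks m s₁ s₃
  hs₂₄ : Blocks m s₂ s₄
  ne_ab : a ≠ b
  ne_bd : b ≠ d
  ne_de : d ≠ e
  ne_ea : e ≠ a
  ne_ad : a ≠ d
  ne_be : b ≠ e
  ne₁₃ : s₁ ≠ s₃
  ne₂₄ : s₂ ≠ s₄
  cb : c b = c a
  cd : c d = c a
  ce : c e = c a
  c₁ : c s₁ ≠ c a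
  c₃ : c s₃ = c s₁
  c₂ : c s₂ ≠ c a
  c₄ : c s₄ = c s₂
  c₁₂ : c s₁ ≠ c s₂
  cm : c m ≠ c a
  cm₁ : c m ≠ c s₁
  cm₂ : c m ≠ c s₂

namespace BlockedQuad

variable {K : Set (ℝ × ℝ)} {c : ℝ × ℝ → Fin 4} {a b d e s₁ s₂ s₃ s₄ m t : ℝ × ℝ}

theorem rotate (k : BlockedQuad K c a b d e s₁ s₂ s₃ s₄ m) :
    BlockedQuad K c b d e a s₂ s₃ s₄ s₁ m where
  eq := by
    rw [k.eq]; ext x; simp only [Set.mem_insert_iff, Set.mem_singleton_iff]; tauto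
  hs₁ := k.hs₂
  hs₂ := k.hs₃
  hs₃ := k.hs₄
  hs₄ := k.hs₁
  had := k.hbe
  hbe := k.had.symm
  hs₁₃ := k.hs₂₄
  hs₂₄ := k.hs₁₃.symm
  ne_ab := k.ne_bd
  ne_bd := k.ne_de
  ne_de := k.ne_ea
  ne_ea := k.ne_ab
  ne_ad := k.ne_be
  ne_be := k.ne_ad.symm
  ne₁₃ := k.ne₂₄
  ne₂₄ := k.ne₁₃.symm
  cb := by rw [k.cb, k.cd]
  cd := by rw [k.cb, k.ce]
  ce := by rw [k.cb]
  c₁ := by rw [k.cb]; exact k.c₂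
  c₃ := k.c₄
  c₂ := by rw [k.cb, k.c₃]; exact k.c₁
  c₄ := by rw [k.c₃]
  c₁₂ := by rw [k.c₃]; exact k.c₁₂.symm
  cm := by rw [k.cb]; exact k.cm
  cm₁ := k.cm₂
  cm₂ := by rw [k.c₃]; exact k.cm₁

theorem reflect (k : BlockedQuad K c a b d e s₁ s₂ s₃ s₄ m) :
    BlockedQuad K c b a e d s₁ s₄ s₃ s₂ m where
  eq := by
    rw [k.eq]; ext x; simp only [Set.mem_insert_iff, Set.mem_singleton_iff]; tauto
  hs₁ := k.hs₁.symm
  hs₂ := k.hs₄.symm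
  hs₃ := k.hs₃.symm
  hs₄ := k.hs₂.symm
  had := k.hbe
  hbe := k.had
  hs₁₃ := k.hs₁₃
  hs₂₄ := k.hs₂₄.symm
  ne_ab := k.ne_ab.symm
  ne_bd := k.ne_ea.symm
  ne_de := k.ne_de.symm
  ne_ea := k.ne_bd.symm
  ne_ad := k.ne_be
  ne_be := k.ne_ad
  ne₁₃ := k.ne₁₃
  ne₂₄ := k.ne₂₄.symm
  cb := by rw [k.cb]
  cd := by rw [k.cb, k.ce]
  ce := by rw [k.cb, k.cd]
  c₁ := by rw [k.cb]; exact k.c₁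
  c₃ := k.c₃
  c₂ := by rw [k.cb, k.c₄]; exact k.c₂
  c₄ := by rw [k.c₄]
  c₁₂ := by rw [k.c₄]; exact k.c₁₂
  cm := by rw [k.cb]; exact k.cm
  cm₁ := k.cm₁
  cm₂ := by rw [k.c₄]; exact k.cm₂

theorem blocker_cases (k : BlockedQuad K c a b d e s₁ s₂ s₃ s₄ m)
    (h : FourBlocked (insert t K) c) (ht : t ∉ K) (hc : c t = c s₂) :
    (Blocks a t s₂ ∨ Blocks e t s₂ ∨ Blocks s₁ t s₂ ∨ Blocks s₃ t s₂) := by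
  have hK : ∀ x, x ∈ K ↔ x = a ∨ x = b ∨ x = d ∨ x = e ∨ x = s₁ ∨ x = s₂ ∨ x = s₃ ∨ x = s₄ ∨
      x = m := by
    intro x; rw [k.eq]; simp only [Set.mem_insert_iff, Set.mem_singleton_iff]
  have hP : ∀ {x}, x ∈ K → x ∈ insert t K := fun hx => Or.inr hx
  have h2 : s₂ ∈ K := by simp [hK]
  have hts : t ≠ s₂ := by rintro rfl; exact ht h2
  obtain ⟨z, hz, hb⟩ := h.exists_blocker (Or.inl rfl) (hP h2) hts hc
  have hcz := h.colour_ne hz (Or.inl rfl) (hP h2) hts hb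
  rw [hc] at hcz
  have hcol : cross z s₂ t = 0 := by
    rw [cross_rotate, cross_swap, hb.cross_zero, neg_zero]
  rcases hz with rfl | hz
  · exact absurd hc hcz
  have noline : ∀ {u v y : ℝ × ℝ}, u ∈ K → v ∈ K → y ∈ K → u ≠ v → Blocks y u v →
      (z = u ∨ z = v ∨ z = y) → (s₂ = u ∨ s₂ = v ∨ s₂ = y) → False := by
    intro u v y hu hv hy huv hby hz hs
    rcases h.mem_line (hP hu) (hP hv) (hP hy) huv hby hz hs (ne_of_apply_ne c hcz)
      (Or.inl rfl) hcol with rfl | rfl | rfl <;> exact ht ‹_›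
  rcases (hK z).1 hz with rfl | rfl | rfl | rfl | rfl | rfl | rfl | rfl | rfl
  · exact Or.inl hb
  · exact (noline hz (by simp [hK]) h2 k.ne_bd k.hs₂ (by simp) (by simp)).elim
  · exact (noline (by simp [hK]) hz h2 k.ne_bd k.hs₂ (by simp) (by simp)).elim
  · exact Or.inr (Or.inl hb)
  · exact Or.inr (Or.inr (Or.inl hb))
  · exact absurd rfl hcz
  · exact Or.inr (Or.inr (Or.inr hb))
  · exact absurd k.c₄ hcz
  · exact (noline h2 (by simp [hK]) hz k.ne₂₄ k.hs₂₄ (by simp) (by simp)).elim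

theorem not_sided_corner (k : BlockedQuad K c a b d e s₁ s₂ s₃ s₄ m) {p q : ℝ × ℝ}
    (ht : cross p q t = 0) (h4 : cross p q s₄ = 0) (h2 : 0 < cross p q s₂)
    (hz : Blocks a t s₂) (hz' : Blocks b t s₄ ∨ Blocks s₁ t s₄) : False := by
  have ha : 0 < cross p q a := hz.cross_pos' ht.ge h2
  have he : cross p q e < 0 := k.hs₄.cross_neg_left ha h4.le
  have hb : cross p q b ≤ 0 := by
    rcases hz' with hz' | hz'
    · obtain ⟨s, -, -, hs⟩ := hz'.cross_eq
      rw [hs, ht, h4]; simp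
    · have : cross p q s₁ = 0 := by
        obtain ⟨s, -, -, hs⟩ := hz'.cross_eq
        rw [hs, ht, h4]; simp
      exact (k.hs₁.cross_neg_right ha this.le).le
  have h1 := k.hbe.cross_neg' hb he
  have h2 := k.hs₂₄.cross_pos h2 h4.ge
  linarith

theorem not_corner (k : BlockedQuad K c a b d e s₁ s₂ s₃ s₄ m) (hts : cross s₂ s₄ t ≠ 0)
    (hz : Blocks a t s₂) (hz' : Blocks b t s₄ ∨ Blocks s₁ t s₄) : False := by
  rcases lt_or_gt_of_ne hts with h0 | h0
  · refine k.not_sided_corner (p := t) (q := s₄) (cross_self_mid _ _) (cross_self_right _ _) ?_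
      hz hz'
    rw [cross_swap, ← cross_rotate]
    linarith
  · refine k.not_sided_corner (p := s₄) (q := t) (cross_self_right _ _) (cross_self_mid _ _) ?_
      hz hz'
    rwa [← cross_rotate]

theorem not_same_side (k : BlockedQuad K c a b d e s₁ s₂ s₃ s₄ m) (hts : cross s₂ s₄ t ≠ 0)
    (hz : Blocks a t s₂ ∨ Blocks s₁ t s₂) (hz' : Blocks b t s₄ ∨ Blocks s₁ t s₄) : False := by
  rcases hz with hz | hz
  · exact k.not_corner hts hz hz'
  rcases hz' with hz' | hz'
  · refine k.reflect.not_corner ?_ hz' (Or.inr hz)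
    rw [cross_swap]
    exact neg_ne_zero.2 hts
  · have h1 := hz.cross_zero
    have h2 := hz'.cross_zero
    rw [cross_swap_right, neg_eq_zero] at h1 h2
    have hs : s₁ ≠ t := hz.ne_left (ne_of_cross_ne_zero hts).2.1.symm
    apply hts
    obtain ⟨x, rfl⟩ := exists_param_of_cross_eq_zero hs.symm h1
    obtain ⟨y, rfl⟩ := exists_param_of_cross_eq_zero hs.symm h2
    simp only [cross, AffineMap.lineMap_apply, vsub_eq_sub, vadd_eq_add, Prod.fst_add,
      Prod.smul_fst, Prod.fst_sub, Prod.snd_add, Prod.smul_snd, Prod.snd_sub, smul_eq_mul]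
    ring

theorem neg_of_pos (k : BlockedQuad K c a b d e s₁ s₂ s₃ s₄ m) {p q : ℝ × ℝ}
    (h2 : cross p q s₂ = 0) (h4 : cross p q s₄ = 0) (hm : cross p q m = 0)
    (h : 0 < cross p q a ∨ 0 < cross p q s₁) :
    cross p q d < 0 ∧ cross p q s₃ < 0 := by
  have ha : 0 < cross p q a := by
    rcases h with h | h
    · exact h
    by_contra! ha
    have hb := k.hs₁.cross_pos_right ha h
    have hd := k.hs₂.cross_neg_right hb h2.le
    have := k.had.cross_neg' ha hd
    linarith
  have hd := k.had.cross_neg_right ha hm.le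
  exact ⟨hd, k.hs₃.cross_neg hd (k.hs₄.cross_neg_left ha h4.le).le⟩

theorem colour_ne₂ (k : BlockedQuad K c a b d e s₁ s₂ s₃ s₄ m)
    (h : FourBlocked (insert t K) c) (ht : t ∉ K) : c t ≠ c s₂ := by
  intro hc
  have h2 := k.blocker_cases h ht hc
  have h4 := k.rotate.rotate.blocker_cases h ht (hc.trans k.c₄.symm)
  have hK : ∀ {x}, x = s₂ ∨ x = s₄ ∨ x = m → x ∈ insert t K := by
    rintro x (rfl | rfl | rfl) <;> simp [k.eq]
  have hts : cross s₂ s₄ t ≠ 0 := by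
    intro h0
    have hK' : ∀ {x}, x = s₂ ∨ x = s₄ ∨ x = m → x ∈ K := by
      rintro x (rfl | rfl | rfl) <;> simp [k.eq]
    exact ht (hK' (h.mem_line (hK (by simp)) (hK (by simp)) (hK (by simp)) k.ne₂₄ k.hs₂₄
      (by simp) (by simp) k.ne₂₄ (Or.inl rfl) h0))
  have hm := k.hs₂₄.cross_zero
  obtain ⟨p, q, e2, e4, em, et⟩ : ∃ p q, cross p q s₂ = 0 ∧ cross p q s₄ = 0 ∧ cross p q m = 0 ∧
      0 < cross p q t := by
    rcases lt_or_gt_of_ne hts with h0 | h0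
    · refine ⟨s₄, s₂, cross_self_right _ _, cross_self_mid _ _, ?_, ?_⟩
      · rw [cross_swap, hm, neg_zero]
      · rw [cross_swap]; linarith
    · exact ⟨s₂, s₄, cross_self_mid _ _, cross_self_right _ _, hm, h0⟩
  have pos2 : ∀ {x}, Blocks x t s₂ → 0 < cross p q x := fun hx => hx.cross_pos et e2.ge
  have pos4 : ∀ {x}, Blocks x t s₄ → 0 < cross p q x := fun hx => hx.cross_pos et e4.ge
  have top : (0 < cross p q a ∨ 0 < cross p q s₁) → Blocks b t s₄ ∨ Blocks s₁ t s₄ := by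
    intro hpos
    obtain ⟨n1, n2⟩ := k.neg_of_pos e2 e4 em hpos
    rcases h4 with h4 | h4 | h4 | h4
    · exact absurd (pos4 h4) n1.not_gt
    · exact Or.inl h4
    · exact absurd (pos4 h4) n2.not_gt
    · exact Or.inr h4
  have bot : (0 < cross p q e ∨ 0 < cross p q s₃) → Blocks d t s₄ ∨ Blocks s₃ t s₄ := by
    intro hpos
    obtain ⟨n1, n2⟩ := k.rotate.rotate.reflect.neg_of_pos e2 e4 em hpos
    rcases h4 with h4 | h4 | h4 | h4
    · exact Or.inl h4
    · exact absurd (pos4 h4) n1.not_gt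
    · exact Or.inr h4
    · exact absurd (pos4 h4) n2.not_gt
  rcases h2 with h2 | h2 | h2 | h2
  · exact k.not_same_side hts (Or.inl h2) (top (Or.inl (pos2 h2)))
  · refine k.rotate.rotate.not_same_side ?_ (bot (Or.inl (pos2 h2))) (Or.inl h2)
    rw [cross_swap]; exact neg_ne_zero.2 hts
  · exact k.not_same_side hts (Or.inr h2) (top (Or.inr (pos2 h2)))
  · refine k.rotate.rotate.not_same_side ?_ (bot (Or.inr (pos2 h2))) (Or.inr h2)
    rw [cross_swap]; exact neg_ne_zero.2 hts

theorem colour_ne_centre (k : BlockedQuad K c a b d e s₁ s₂ s₃ s₄ m)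
    (h : FourBlocked (insert t K) c) (ht : t ∉ K) : c t ≠ c m := by
  intro hc
  have hK : ∀ x, x ∈ K ↔ x = a ∨ x = b ∨ x = d ∨ x = e ∨ x = s₁ ∨ x = s₂ ∨ x = s₃ ∨ x = s₄ ∨
      x = m := by
    intro x; rw [k.eq]; simp only [Set.mem_insert_iff, Set.mem_singleton_iff]
  have hP : ∀ {x}, x ∈ K → x ∈ insert t K := fun hx => Or.inr hx
  have hm : m ∈ K := by simp [hK]
  have htm : t ≠ m := by rintro rfl; exact ht hm
  obtain ⟨z, hz, hb⟩ := h.exists_blocker (Or.inl rfl) (hP hm) htm hc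
  have hcz := h.colour_ne_right hz (Or.inl rfl) (hP hm) htm hb
  have hcol : cross z m t = 0 := by
    rw [cross_rotate, cross_swap, hb.cross_zero, neg_zero]
  rcases hz with rfl | hz
  · exact absurd hc hcz
  have noline : ∀ {u v : ℝ × ℝ}, u ∈ K → v ∈ K → u ≠ v → Blocks m u v →
      (z = u ∨ z = v ∨ z = m) → False := by
    intro u v hu hv huv hby hz
    rcases h.mem_line (hP hu) (hP hv) (hP hm) huv hby hz (by simp) (ne_of_apply_ne c hcz)
      (Or.inl rfl) hcol with rfl | rfl | rfl <;> exact ht ‹_›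
  rcases (hK z).1 hz with rfl | rfl | rfl | rfl | rfl | rfl | rfl | rfl | rfl
  · exact noline hz (by simp [hK]) k.ne_ad k.had (by simp)
  · exact noline hz (by simp [hK]) k.ne_be k.hbe (by simp)
  · exact noline (by simp [hK]) hz k.ne_ad k.had (by simp)
  · exact noline (by simp [hK]) hz k.ne_be k.hbe (by simp)
  · exact noline hz (by simp [hK]) k.ne₁₃ k.hs₁₃ (by simp)
  · exact noline hz (by simp [hK]) k.ne₂₄ k.hs₂₄ (by simp)
  · exact noline (by simp [hK]) hz k.ne₁₃ k.hs₁₃ (by simp)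
  · exact noline (by simp [hK]) hz k.ne₂₄ k.hs₂₄ (by simp)
  · exact absurd rfl hcz

end BlockedQuad

/-- A point strictly beyond a supporting line through `a` is visible from `a`. -/
theorem FourBlocked.colour_ne_of_beyond {K : Set (ℝ × ℝ)} {c : ℝ × ℝ → Fin 4} {a p q t : ℝ × ℝ}
    (h : FourBlocked (insert t K) c) (ha : a ∈ K) (h0 : cross p q a ≤ 0) (ht : cross p q t < 0)
    (hK : ∀ x ∈ K, 0 ≤ cross p q x) : c t ≠ c a := by
  have hta : t ≠ a := by rintro rfl; exact (hK _ ha).not_gt ht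
  intro hc
  obtain ⟨z, hz, hb⟩ := h.exists_blocker (Or.inl rfl) (Or.inr ha) hta hc
  rcases hz with rfl | hz
  · exact hb.ne_left hta rfl
  · exact (hK z hz).not_gt (hb.cross_neg ht h0)

namespace BlockedQuad

variable {K : Set (ℝ × ℝ)} {c : ℝ × ℝ → Fin 4} {a b d e s₁ s₂ s₃ s₄ m t : ℝ × ℝ}

theorem cross_nonneg (k : BlockedQuad K c a b d e s₁ s₂ s₃ s₄ m) {p q : ℝ × ℝ}
    (ha : 0 ≤ cross p q a) (hb : 0 ≤ cross p q b) (hd : 0 ≤ cross p q d)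
    (he : 0 ≤ cross p q e) : ∀ x ∈ K, 0 ≤ cross p q x := by
  intro x hx
  rw [k.eq] at hx
  simp only [Set.mem_insert_iff, Set.mem_singleton_iff] at hx
  rcases hx with rfl | rfl | rfl | rfl | rfl | rfl | rfl | rfl | rfl
  · exact ha
  · exact hb
  · exact hd
  · exact he
  · exact k.hs₁.cross_nonneg ha hb
  · exact k.hs₂.cross_nonneg hb hd
  · exact k.hs₃.cross_nonneg hd he
  · exact k.hs₄.cross_nonneg he ha
  · exact k.had.cross_nonneg ha hd

/-- A blocked quadrilateral cannot be extended by a point outside its convex hull. -/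
theorem not_fourBlocked_insert (k : BlockedQuad K c a b d e s₁ s₂ s₃ s₄ m)
    (h₁ : 0 < cross a b d) (h₂ : 0 < cross b d e) (h₃ : 0 < cross d e a) (h₄ : 0 < cross e a b)
    (ht : cross a b t < 0 ∨ cross b d t < 0 ∨ cross d e t < 0 ∨ cross e a t < 0) :
    ¬ FourBlocked (insert t K) c := by
  intro h
  have key : t ∉ K ∧ c t ≠ c a := by
    have ha : a ∈ K := by simp [k.eq]
    have hd : d ∈ K := by simp [k.eq]
    have hs : ∀ p q, cross p q p = 0 := cross_self_mid
    have hs' : ∀ p q, cross p q q = 0 := cross_self_right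
    have r₁ := cross_rotate a b d
    have r₂ := cross_rotate b d e
    have r₃ := cross_rotate d e a
    have r₄ := cross_rotate e a b
    have R : ∀ p q r, cross p q r = cross r p q := fun p q r => by rw [← cross_rotate]
    rcases ht with ht | ht | ht | ht
    · have H := k.cross_nonneg (p := a) (q := b) (hs _ _).ge (hs' _ _).ge h₁.le
        (by rw [R]; exact h₄.le)
      exact ⟨fun hK => (H t hK).not_gt ht, h.colour_ne_of_beyond ha (hs _ _).le ht H⟩
    · have H := k.cross_nonneg (p := b) (q := d) (by rw [R]; exact h₁.le) (hs _ _).ge (hs' _ _).ge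
        h₂.le
      refine ⟨fun hK => (H t hK).not_gt ht, ?_⟩
      rw [← k.cd]
      exact h.colour_ne_of_beyond hd (hs' _ _).le ht H
    · have H := k.cross_nonneg (p := d) (q := e) h₃.le (by rw [R]; exact h₂.le) (hs _ _).ge
        (hs' _ _).ge
      refine ⟨fun hK => (H t hK).not_gt ht, ?_⟩
      rw [← k.cd]
      exact h.colour_ne_of_beyond hd (hs _ _).le ht H
    · have H := k.cross_nonneg (p := e) (q := a) (hs' _ _).ge h₄.le (by rw [R]; exact h₃.le)
        (hs _ _).ge
      exact ⟨fun hK => (H t hK).not_gt ht, h.colour_ne_of_beyond ha (hs' _ _).le ht H⟩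
  have n2 := k.colour_ne₂ h key.1
  have n1 := k.rotate.colour_ne₂ h key.1
  rw [k.c₃] at n1
  have nm := k.colour_ne_centre h key.1
  have e1 := k.c₁
  have e2 := k.c₂
  have e3 := k.c₁₂
  have e4 := k.cm
  have e5 := k.cm₁
  have e6 := k.cm₂
  have ea := key.2
  omega

end BlockedQuad

/-- The blocked triangle: `r` lies inside the triangle `a b d`, the points `pᵢ` block `r` from the
vertices, the points `qᵢ` block the sides, and the pairs `pᵢ qᵢ` are blocked cyclically. -/
structure BlockedTri (K : Set (ℝ × ℝ)) (c : ℝ × ℝ → Fin 4)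
    (a b d r p₁ p₂ p₃ q₁ q₂ q₃ : ℝ × ℝ) : Prop where
  eq : K = {a, b, d, r, p₁, p₂, p₃, q₁, q₂, q₃}
  hp₁ : Blocks p₁ r a
  hp₂ : Blocks p₂ r b
  hp₃ : Blocks p₃ r d
  hq₁ : Blocks q₁ b d
  hq₂ : Blocks q₂ d a
  hq₃ : Blocks q₃ a b
  hpq₁ : Blocks p₂ p₁ q₁
  hpq₂ : Blocks p₃ p₂ q₂
  hpq₃ : Blocks p₁ p₃ q₃
  ca : c a = c r
  cb : c b = c r
  cd : c d = c r
  cq₁ : c q₁ = c p₁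
  cq₂ : c q₂ = c p₂
  cq₃ : c q₃ = c p₃
  cp₁ : c p₁ ≠ c r
  cp₂ : c p₂ ≠ c r
  cp₃ : c p₃ ≠ c r
  c₁₂ : c p₁ ≠ c p₂
  c₂₃ : c p₂ ≠ c p₃
  c₃₁ : c p₃ ≠ c p₁
  ne_ra : r ≠ a
  ne_rb : r ≠ b
  ne_rd : r ≠ d
  ne₁ : p₁ ≠ q₁
  ne₂ : p₂ ≠ q₂
  ne₃ : p₃ ≠ q₃
  noncollinear : cross a b d ≠ 0

namespace BlockedTri

variable {K : Set (ℝ × ℝ)} {c : ℝ × ℝ → Fin 4} {a b d r p₁ p₂ p₃ q₁ q₂ q₃ t : ℝ × ℝ}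

theorem rotate (k : BlockedTri K c a b d r p₁ p₂ p₃ q₁ q₂ q₃) :
    BlockedTri K c b d a r p₂ p₃ p₁ q₂ q₃ q₁ where
  eq := by
    rw [k.eq]; ext x; simp only [Set.mem_insert_iff, Set.mem_singleton_iff]; tauto
  hp₁ := k.hp₂
  hp₂ := k.hp₃
  hp₃ := k.hp₁
  hq₁ := k.hq₂
  hq₂ := k.hq₃
  hq₃ := k.hq₁
  hpq₁ := k.hpq₂
  hpq₂ := k.hpq₃
  hpq₃ := k.hpq₁
  ca := k.cb
  cb := k.cd
  cd := k.ca
  cq₁ := k.cq₂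
  cq₂ := k.cq₃
  cq₃ := k.cq₁
  cp₁ := k.cp₂
  cp₂ := k.cp₃
  cp₃ := k.cp₁
  c₁₂ := k.c₂₃
  c₂₃ := k.c₃₁
  c₃₁ := k.c₁₂
  ne_ra := k.ne_rb
  ne_rb := k.ne_rd
  ne_rd := k.ne_ra
  ne₁ := k.ne₂
  ne₂ := k.ne₃
  ne₃ := k.ne₁
  noncollinear := by rw [← cross_rotate]; exact k.noncollinear

theorem mem_iff (k : BlockedTri K c a b d r p₁ p₂ p₃ q₁ q₂ q₃) (x : ℝ × ℝ) :
    x ∈ K ↔ x = a ∨ x = b ∨ x = d ∨ x = r ∨ x = p₁ ∨ x = p₂ ∨ x = p₃ ∨ x = q₁ ∨ x = q₂ ∨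
      x = q₃ := by
  rw [k.eq]
  simp only [Set.mem_insert_iff, Set.mem_singleton_iff]

theorem cross_eq_zero_of_blocks {z u v p q : ℝ × ℝ} (h : Blocks z u v) (hu : cross p q u = 0)
    (hv : cross p q v = 0) : cross p q z = 0 := by
  obtain ⟨s, -, -, hs⟩ := h.cross_eq
  rw [hs, hu, hv]; simp

theorem exists_positive (u v x : ℝ × ℝ) (h : cross u v x ≠ 0) :
    ∃ p q, cross p q u = 0 ∧ cross p q v = 0 ∧ 0 < cross p q x ∧
      ∀ y, cross u v y = 0 → cross p q y = 0 := by
  rcases lt_or_gt_of_ne h with h | h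
  · refine ⟨v, u, cross_self_right _ _, cross_self_mid _ _, by rw [cross_swap]; linarith, ?_⟩
    intro y hy
    rw [cross_swap, hy, neg_zero]
  · exact ⟨u, v, cross_self_mid _ _, cross_self_right _ _, h, fun y hy => hy⟩

theorem colour_ne₂ (k : BlockedTri K c a b d r p₁ p₂ p₃ q₁ q₂ q₃)
    (h : FourBlocked (insert t K) c) (ht : t ∉ K)
    (hside : ∀ p q, cross p q d = 0 → cross p q a = 0 → 0 < cross p q b → 0 ≤ cross p q r) :
    c t ≠ c p₂ := by
  intro hc
  have hK := k.mem_iff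
  have hP : ∀ {x}, x ∈ K → x ∈ insert t K := fun hx => Or.inr hx
  have ma : a ∈ K := by simp [hK]
  have mb : b ∈ K := by simp [hK]
  have md : d ∈ K := by simp [hK]
  have mr : r ∈ K := by simp [hK]
  have m1 : p₁ ∈ K := by simp [hK]
  have m2 : p₂ ∈ K := by simp [hK]
  have m3 : p₃ ∈ K := by simp [hK]
  have n1 : q₁ ∈ K := by simp [hK]
  have n2 : q₂ ∈ K := by simp [hK]
  have n3 : q₃ ∈ K := by simp [hK]
  obtain ⟨nab, nad, nbd⟩ := ne_of_cross_ne_zero k.noncollinear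
  have noline : ∀ {u v y w x : ℝ × ℝ}, u ∈ K → v ∈ K → y ∈ K → u ≠ v → Blocks y u v →
      (w = u ∨ w = v ∨ w = y) → (x = u ∨ x = v ∨ x = y) → w ≠ x → cross w x t ≠ 0 := by
    intro u v y w x hu hv hy huv hby hw hx hwx h0
    rcases h.mem_line (hP hu) (hP hv) (hP hy) huv hby hw hx hwx
      (Or.inl rfl) h0 with rfl | rfl | rfl <;> exact ht ‹_›
  have blocker : ∀ {s}, s ∈ K → c s = c p₂ → ∃ z ∈ K, Blocks z t s ∧ z ≠ s ∧ c z ≠ c p₂ ∧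
      cross z s t = 0 := by
    intro s hs hcs
    have hts : t ≠ s := by rintro rfl; exact ht hs
    obtain ⟨z, hz, hb⟩ := h.exists_blocker (Or.inl rfl) (hP hs) hts (hc.trans hcs.symm)
    have hcz := h.colour_ne hz (Or.inl rfl) (hP hs) hts hb
    rcases hz with rfl | hz
    · exact absurd rfl hcz
    · refine ⟨z, hz, hb, hb.ne_right hts, hc ▸ hcz, ?_⟩
      rw [cross_rotate, cross_swap, hb.cross_zero, neg_zero]
  -- `q₃` is the only point that can block `t` and `p₂`
  have b2 : Blocks q₃ t p₂ := by
    obtain ⟨z, hz, hb, hzs, hcz, h0⟩ := blocker m2 rfl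
    obtain ⟨p, q, ed, ea, eb, ey⟩ := exists_positive d a b
      (by rw [cross_rotate]; exact k.noncollinear)
    have er := hside p q ed ea eb
    have hpos : ∀ x ∈ K, 0 ≤ cross p q x := by
      intro x hx
      have e1 := k.hp₁.cross_nonneg er ea.ge
      have e2 := k.hp₂.cross_nonneg er eb.le
      have e3 := k.hp₃.cross_nonneg er ed.ge
      have e4 := k.hq₁.cross_nonneg eb.le ed.ge
      have e5 := k.hq₂.cross_nonneg ed.ge ea.ge
      have e6 := k.hq₃.cross_nonneg ea.ge eb.le
      rcases (hK x).1 hx with rfl | rfl | rfl | rfl | rfl | rfl | rfl | rfl | rfl | rfl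
      · exact ea.ge
      · exact eb.le
      · exact ed.ge
      · exact er
      all_goals assumption
    have et : 0 < cross p q t := by
      by_contra! hneg
      rcases hneg.lt_or_eq with hneg | h0
      · exact h.colour_ne_of_beyond n2 (cross_eq_zero_of_blocks k.hq₂ ed ea).le hneg hpos
          (hc.trans k.cq₂.symm)
      · refine noline md ma n2 nad.symm k.hq₂ (by simp) (by simp) nad.symm ?_
        by_contra hne
        have e1 := cross_mul_cross p q d a b t
        rw [ed, ea, h0] at e1
        have : cross p q b * cross d a t = 0 := by linarith
        exact hne ((mul_eq_zero.1 this).resolve_left eb.ne')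
    have e2 : 0 < cross p q p₂ := k.hp₂.cross_pos' er eb
    have ez := hb.cross_pos et e2.le
    rcases (hK z).1 hz with rfl | rfl | rfl | rfl | rfl | rfl | rfl | rfl | rfl | rfl
    · exact absurd ea ez.ne'
    · exact absurd h0 (noline mr hz m2 k.ne_rb k.hp₂ (by simp) (by simp) hzs)
    · exact absurd ed ez.ne'
    · exact absurd h0 (noline hz mb m2 k.ne_rb k.hp₂ (by simp) (by simp) hzs)
    · exact absurd h0 (noline hz n1 m2 k.ne₁ k.hpq₁ (by simp) (by simp) hzs)
    · exact absurd rfl hzs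
    · exact absurd h0 (noline m2 n2 hz k.ne₂ k.hpq₂ (by simp) (by simp) hzs)
    · exact absurd h0 (noline m1 hz m2 k.ne₁ k.hpq₁ (by simp) (by simp) hzs)
    · exact absurd k.cq₂ hcz
    · exact hb
  have htp : cross p₂ q₂ t ≠ 0 := noline m2 n2 m3 k.ne₂ k.hpq₂ (by simp) (by simp) k.ne₂
  have hpq : cross t q₂ p₂ ≠ 0 := by rw [cross_rotate, cross_swap]; exact neg_ne_zero.2 htp
  obtain ⟨p, q, e2, f2, et, ey⟩ := exists_positive p₂ q₂ t htp
  have e3 : cross p q p₃ = 0 := cross_eq_zero_of_blocks k.hpq₂ e2 f2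
  have e1 : 0 < cross p q p₁ := k.hpq₃.cross_pos' e3.ge (b2.cross_pos et e2.ge)
  obtain ⟨p', q', et', f2', e2', -⟩ := exists_positive t q₂ p₂ hpq
  have f3' : 0 < cross p' q' q₃ := b2.cross_pos' et'.ge e2'
  have e3' : 0 < cross p' q' p₃ := k.hpq₂.cross_pos e2' f2'.ge
  have e1' : 0 < cross p' q' p₁ := k.hpq₃.cross_pos e3' f3'.le
  obtain ⟨z, hz, hb, hzs, hcz, h0⟩ := blocker n2 k.cq₂
  have ez : 0 < cross p q z := hb.cross_pos et f2.ge
  have ez' : cross p' q' z = 0 := cross_eq_zero_of_blocks hb et' f2'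
  rcases (hK z).1 hz with rfl | rfl | rfl | rfl | rfl | rfl | rfl | rfl | rfl | rfl
  · exact noline md hz n2 nad.symm k.hq₂ (by simp) (by simp) hzs h0
  · have er := k.hp₂.cross_neg_left ez e2.le
    have ed : 0 < cross p q d := by
      by_contra! hd
      exact absurd (k.hp₃.cross_neg er hd) e3.not_lt
    have ea := k.hq₂.cross_neg_right ed f2.le
    exact absurd (k.hp₁.cross_neg er ea.le) e1.not_gt
  · exact noline hz ma n2 nad.symm k.hq₂ (by simp) (by simp) hzs h0
  · have ea := k.hp₁.cross_pos_right ez'.le e1'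
    have ed := k.hp₃.cross_pos_right ez'.le e3'
    exact absurd (k.hq₂.cross_pos ed ea.le) f2'.not_gt
  · exact e1'.ne' ez'
  · exact hcz rfl
  · exact e3'.ne' ez'
  · exact absurd (k.hpq₁.cross_pos e1 ez.le) e2.not_gt
  · exact hcz k.cq₂
  · exact f3'.ne' ez'

/-- A blocked triangle cannot be extended by a point outside its convex hull. -/
theorem not_fourBlocked_insert (k : BlockedTri K c a b d r p₁ p₂ p₃ q₁ q₂ q₃) {p q : ℝ × ℝ}
    (hside : ∀ p q, 0 ≤ cross p q a → 0 ≤ cross p q b → 0 ≤ cross p q d → 0 ≤ cross p q r)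
    (ha : 0 ≤ cross p q a) (hb : 0 ≤ cross p q b) (hd : 0 ≤ cross p q d)
    (h0 : cross p q a ≤ 0 ∨ cross p q b ≤ 0 ∨ cross p q d ≤ 0) (ht : cross p q t < 0) :
    ¬ FourBlocked (insert t K) c := by
  intro h
  have hK := k.mem_iff
  have hr := hside p q ha hb hd
  have hpos : ∀ x ∈ K, 0 ≤ cross p q x := by
    intro x hx
    have e1 := k.hp₁.cross_nonneg hr ha
    have e2 := k.hp₂.cross_nonneg hr hb
    have e3 := k.hp₃.cross_nonneg hr hd
    have e4 := k.hq₁.cross_nonneg hb hd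
    have e5 := k.hq₂.cross_nonneg hd ha
    have e6 := k.hq₃.cross_nonneg ha hb
    rcases (hK x).1 hx with rfl | rfl | rfl | rfl | rfl | rfl | rfl | rfl | rfl | rfl <;> assumption
  have htK : t ∉ K := fun hK => (hpos t hK).not_gt ht
  have nr : c t ≠ c r := by
    rcases h0 with h0 | h0 | h0
    · rw [← k.ca]; exact h.colour_ne_of_beyond (by simp [hK]) h0 ht hpos
    · rw [← k.cb]; exact h.colour_ne_of_beyond (by simp [hK]) h0 ht hpos
    · rw [← k.cd]; exact h.colour_ne_of_beyond (by simp [hK]) h0 ht hpos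
  have n2 := k.colour_ne₂ h htK fun p q h1 h2 h3 => hside p q h2.ge h3.le h1.ge
  have n3 := k.rotate.colour_ne₂ h htK fun p q h1 h2 h3 => hside p q h1.ge h2.ge h3.le
  have n1 := k.rotate.rotate.colour_ne₂ h htK fun p q h1 h2 h3 => hside p q h3.le h1.ge h2.ge
  have e1 := k.cp₁
  have e2 := k.cp₂
  have e3 := k.cp₃
  have e4 := k.c₁₂
  have e5 := k.c₂₃
  have e6 := k.c₃₁
  omega

end BlockedTri

theorem not_blocks_corner {a b d u v : ℝ × ℝ} (h : cross a b d ≠ 0) (hu₁ : 0 ≤ cross a b u)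
    (hu₂ : 0 ≤ cross d a u) (hv₁ : 0 ≤ cross a b v) (hv₂ : 0 ≤ cross d a v) (huv : u ≠ v) :
    ¬ Blocks a u v := by
  intro hb
  refine hb.ne_left huv (eq_of_cross_eq_zero h ?_ ?_).symm
  · by_contra hne
    have := hb.cross_pos (lt_of_le_of_ne hu₁ (Ne.symm hne)) hv₁
    rw [cross_self_mid] at this
    exact this.false
  · by_contra hne
    have := hb.cross_pos (lt_of_le_of_ne hu₂ (Ne.symm hne)) hv₂
    rw [cross_self_right] at this
    exact this.false

namespace FourBlocked

variable {P Q : Set (ℝ × ℝ)} {c : ℝ × ℝ → Fin 4}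

theorem ncard_eq_sum (hQ : Q.Finite) (c : ℝ × ℝ → Fin 4) :
    Q.ncard = ∑ i, (Q ∩ c ⁻¹' {i}).ncard := by
  classical
  obtain ⟨s, rfl⟩ := hQ.exists_finset_coe
  rw [Set.ncard_coe_finset, Finset.card_eq_sum_card_fiberwise (f := c) (t := Finset.univ) (by simp)]
  refine Finset.sum_congr rfl fun i _ => ?_
  rw [← Set.ncard_coe_finset]
  congr 1
  ext x
  simp

theorem ncard_class_le_two (h : FourBlocked Q c) {γ : Fin 4} (hγ : ∀ x ∈ Q, c x ≠ γ) (i : Fin 4) :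
    (Q ∩ c ⁻¹' {i}).ncard ≤ 2 := by
  by_contra! hlt
  obtain ⟨x, y, z, hx, hy, hz, hxy, hxz, hyz⟩ :=
    (Set.two_lt_ncard_iff (h.finite.subset Set.inter_subset_left)).1 hlt
  exact h.not_three_of_three_colours hγ hx.1 hy.1 hz.1 hxy hxz hyz (hx.2.trans hy.2.symm)
    (hx.2.trans hz.2.symm)

/-- A three-coloured blocked set has at most six points, and a partner of the same colour exists
for each of its points when it has exactly six. -/
theorem exists_partner (h : FourBlocked Q c) {γ : Fin 4} (hγ : ∀ x ∈ Q, c x ≠ γ)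
    (h6 : 6 ≤ Q.ncard) {x : ℝ × ℝ} (hx : x ∈ Q) : ∃ y ∈ Q, y ≠ x ∧ c y = c x := by
  by_contra! hn
  have hx1 : (Q ∩ c ⁻¹' {c x}).ncard ≤ 1 := by
    refine (Set.ncard_le_one (h.finite.subset Set.inter_subset_left)).2 ?_
    have : ∀ y ∈ Q ∩ c ⁻¹' {c x}, y = x := fun y hy => by
      by_contra hyx
      exact hn y hy.1 hyx hy.2
    intro a ha b hb
    rw [this a ha, this b hb]
  have h0 : (Q ∩ c ⁻¹' {γ}).ncard = 0 := by
    rw [Set.ncard_eq_zero (h.finite.subset Set.inter_subset_left)]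
    ext y
    simpa using hγ y
  have hne := hγ x hx
  have hs := ncard_eq_sum h.finite c
  have e := h.ncard_class_le_two hγ
  rw [← Finset.add_sum_erase _ _ (Finset.mem_univ γ),
    ← Finset.add_sum_erase _ _ (Finset.mem_erase.2 ⟨hne, Finset.mem_univ (c x)⟩), h0] at hs
  have hle := Finset.sum_le_card_nsmul ((Finset.univ.erase γ).erase (c x))
    (fun i => (Q ∩ c ⁻¹' {i}).ncard) 2 fun i _ => e i
  rw [Finset.card_erase_of_mem (Finset.mem_erase.2 ⟨hne, Finset.mem_univ (c x)⟩),
    Finset.card_erase_of_mem (Finset.mem_univ γ), Finset.card_univ, Fintype.card_fin] at hle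
  simp only [smul_eq_mul] at hle
  omega

theorem ncard_le_six (h : FourBlocked Q c) {γ : Fin 4} (hγ : ∀ x ∈ Q, c x ≠ γ) :
    Q.ncard ≤ 6 := by
  have h0 : (Q ∩ c ⁻¹' {γ}).ncard = 0 := by
    rw [Set.ncard_eq_zero (h.finite.subset Set.inter_subset_left)]
    ext y
    simpa using hγ y
  have hs := ncard_eq_sum h.finite c
  rw [← Finset.add_sum_erase _ _ (Finset.mem_univ γ), h0] at hs
  have hle := Finset.sum_le_card_nsmul (Finset.univ.erase γ)
    (fun i => (Q ∩ c ⁻¹' {i}).ncard) 2 fun i _ => h.ncard_class_le_two hγ i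
  rw [Finset.card_erase_of_mem (Finset.mem_univ γ), Finset.card_univ, Fintype.card_fin] at hle
  simp only [smul_eq_mul] at hle
  omega

end FourBlocked

/-- A blocked set contained in a convex quadrilateral whose vertices form a colour class. -/
structure HullQuad (P : Set (ℝ × ℝ)) (c : ℝ × ℝ → Fin 4) (a b d e s₁ s₂ s₃ s₄ : ℝ × ℝ) :
    Prop where
  blocked : FourBlocked P c
  ma : a ∈ P
  mb : b ∈ P
  md : d ∈ P
  me : e ∈ P
  cb : c b = c a
  cd : c d = c a
  ce : c e = c a
  only : ∀ x ∈ P, c x = c a → x = a ∨ x = b ∨ x = d ∨ x = e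
  pa : 0 < cross e a b
  pb : 0 < cross a b d
  pd : 0 < cross b d e
  pe : 0 < cross d e a
  nonneg : ∀ x ∈ P, 0 ≤ cross a b x ∧ 0 ≤ cross b d x ∧ 0 ≤ cross d e x ∧ 0 ≤ cross e a x
  m₁ : s₁ ∈ P
  m₂ : s₂ ∈ P
  m₃ : s₃ ∈ P
  m₄ : s₄ ∈ P
  hs₁ : Blocks s₁ a b
  hs₂ : Blocks s₂ b d
  hs₃ : Blocks s₃ d e
  hs₄ : Blocks s₄ e a

namespace HullQuad

variable {P : Set (ℝ × ℝ)} {c : ℝ × ℝ → Fin 4} {a b d e s₁ s₂ s₃ s₄ : ℝ × ℝ}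

theorem rotate (k : HullQuad P c a b d e s₁ s₂ s₃ s₄) : HullQuad P c b d e a s₂ s₃ s₄ s₁ where
  blocked := k.blocked
  ma := k.mb
  mb := k.md
  md := k.me
  me := k.ma
  cb := by rw [k.cb, k.cd]
  cd := by rw [k.cb, k.ce]
  ce := by rw [k.cb]
  only := fun x hx hc => by have := k.only x hx (hc.trans k.cb); tauto
  pa := k.pb
  pb := k.pd
  pd := k.pe
  pe := k.pa
  nonneg := fun x hx => by have := k.nonneg x hx; tauto
  m₁ := k.m₂
  m₂ := k.m₃
  m₃ := k.m₄
  m₄ := k.m₁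
  hs₁ := k.hs₂
  hs₂ := k.hs₃
  hs₃ := k.hs₄
  hs₄ := k.hs₁

theorem ne (k : HullQuad P c a b d e s₁ s₂ s₃ s₄) : a ≠ b ∧ a ≠ d :=
  ⟨(ne_of_cross_ne_zero k.pb.ne').1, (ne_of_cross_ne_zero k.pb.ne').2.1⟩

theorem not_blocks (k : HullQuad P c a b d e s₁ s₂ s₃ s₄) {u v : ℝ × ℝ} (hu : u ∈ P)
    (hv : v ∈ P) (huv : u ≠ v) : ¬ Blocks a u v :=
  not_blocks_corner (by rw [← cross_rotate]; exact k.pa.ne') (k.nonneg u hu).1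
    (k.nonneg u hu).2.2.2 (k.nonneg v hv).1 (k.nonneg v hv).2.2.2 huv

theorem restrict (k : HullQuad P c a b d e s₁ s₂ s₃ s₄) : FourBlocked (P \ {a, b, d, e}) c := by
  refine k.blocked.restrict Set.sdiff_subset ?_
  rintro u ⟨hu, -⟩ v ⟨hv, -⟩ huv z hz hb
  refine ⟨hz, ?_⟩
  rintro (rfl | rfl | rfl | rfl)
  · exact k.not_blocks hu hv huv hb
  · exact k.rotate.not_blocks hu hv huv hb
  · exact k.rotate.rotate.not_blocks hu hv huv hb
  · exact k.rotate.rotate.rotate.not_blocks hu hv huv hb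

theorem mem_inner (k : HullQuad P c a b d e s₁ s₂ s₃ s₄) {x : ℝ × ℝ} :
    x ∈ P \ {a, b, d, e} ↔ x ∈ P ∧ c x ≠ c a := by
  constructor
  · rintro ⟨hx, hn⟩
    refine ⟨hx, fun hc => hn ?_⟩
    simpa using k.only x hx hc
  · rintro ⟨hx, hc⟩
    refine ⟨hx, ?_⟩
    rintro (rfl | rfl | rfl | rfl)
    · exact hc rfl
    · exact hc k.cb
    · exact hc k.cd
    · exact hc k.ce

theorem colour₁ (k : HullQuad P c a b d e s₁ s₂ s₃ s₄) : c s₁ ≠ c a :=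
  k.blocked.colour_ne k.m₁ k.ma k.mb k.ne.1 k.hs₁

/-- The blocker of a side blocks no other pair. -/
theorem side_not_blocks (k : HullQuad P c a b d e s₁ s₂ s₃ s₄) {u v : ℝ × ℝ} (hu : u ∈ P)
    (hv : v ∈ P) (huv : u ≠ v) (hcu : c u ≠ c a) : ¬ Blocks s₁ u v := by
  intro hb
  have h0 : cross a b u = 0 := by
    by_contra hne
    have := hb.cross_pos (lt_of_le_of_ne (k.nonneg u hu).1 (Ne.symm hne)) (k.nonneg v hv).1
    rw [k.hs₁.cross_zero] at this
    exact this.false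
  rcases k.blocked.mem_line k.ma k.mb k.m₁ k.ne.1 k.hs₁ (Or.inl rfl) (Or.inr (Or.inl rfl)) k.ne.1
    hu h0 with rfl | rfl | rfl
  · exact hcu rfl
  · exact hcu k.cb
  · exact hb.ne_left huv rfl

theorem not_side (k : HullQuad P c a b d e s₁ s₂ s₃ s₄) {u v z : ℝ × ℝ} (hu : u ∈ P)
    (hv : v ∈ P) (huv : u ≠ v) (hcu : c u ≠ c a) (hb : Blocks z u v) :
    z ≠ s₁ ∧ z ≠ s₂ ∧ z ≠ s₃ ∧ z ≠ s₄ := by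
  refine ⟨?_, ?_, ?_, ?_⟩ <;> rintro rfl
  · exact k.side_not_blocks hu hv huv hcu hb
  · exact k.rotate.side_not_blocks hu hv huv (by rwa [k.cb]) hb
  · exact k.rotate.rotate.side_not_blocks hu hv huv (by rwa [k.cd]) hb
  · exact k.rotate.rotate.rotate.side_not_blocks hu hv huv (by rwa [k.ce]) hb

theorem side_ne (k : HullQuad P c a b d e s₁ s₂ s₃ s₄) : s₁ ≠ s₂ ∧ s₁ ≠ s₃ ∧ s₁ ≠ s₄ := by
  have h0 := k.hs₁.cross_zero
  have hb : 0 = cross a b b := (cross_self_right a b).symm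
  have he : 0 < cross a b e := by rw [← cross_rotate]; exact k.pa
  have h2 := k.hs₂.cross_pos' hb.le k.pb
  have h3 := k.hs₃.cross_pos k.pb he.le
  have h4 := k.hs₄.cross_pos he (cross_self_mid a b).ge
  refine ⟨?_, ?_, ?_⟩ <;> rintro rfl <;> linarith

/-- There is at most one point besides the vertices and the side blockers. -/
theorem inner_unique (k : HullQuad P c a b d e s₁ s₂ s₃ s₄) {p q : ℝ × ℝ} (hp : p ∈ P)
    (hq : q ∈ P) (hcp : c p ≠ c a) (hcq : c q ≠ c a)
    (hps : p ≠ s₁ ∧ p ≠ s₂ ∧ p ≠ s₃ ∧ p ≠ s₄) (hqs : q ≠ s₁ ∧ q ≠ s₂ ∧ q ≠ s₃ ∧ q ≠ s₄) :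
    p = q := by
  by_contra hpq
  set X := P \ {a, b, d, e} with hX
  have hXb : FourBlocked X c := k.restrict
  have hXc : ∀ x ∈ X, c x ≠ c a := fun x hx => (k.mem_inner.1 hx).2
  have hsub : ({p, q, s₁, s₂, s₃, s₄} : Finset (ℝ × ℝ)) ≤ hXb.finite.toFinset := by
    intro x hx
    rw [Set.Finite.mem_toFinset]
    simp only [Finset.mem_insert, Finset.mem_singleton] at hx
    refine k.mem_inner.2 ?_
    rcases hx with rfl | rfl | rfl | rfl | rfl | rfl
    · exact ⟨hp, hcp⟩
    · exact ⟨hq, hcq⟩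
    · exact ⟨k.m₁, k.colour₁⟩
    · exact ⟨k.m₂, by rw [← k.cb]; exact k.rotate.colour₁⟩
    · exact ⟨k.m₃, by rw [← k.cd]; exact k.rotate.rotate.colour₁⟩
    · exact ⟨k.m₄, by rw [← k.ce]; exact k.rotate.rotate.rotate.colour₁⟩
  have h6 : ({p, q, s₁, s₂, s₃, s₄} : Finset (ℝ × ℝ)).card = 6 := by
    have e1 := k.side_ne
    have e2 := k.rotate.side_ne
    have e3 := k.rotate.rotate.side_ne
    simp [hpq, hps, hqs, e1, e2.1, e2.2.1, e3.1]
  have hcard : X.ncard = hXb.finite.toFinset.card := Set.ncard_eq_toFinset_card X hXb.finite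
  have hle := hXb.ncard_le_six hXc
  have heq := Finset.eq_of_subset_of_card_le hsub (by omega)
  have hge : 6 ≤ X.ncard := by rw [hcard, ← heq, h6]
  have hmem : ∀ x ∈ X, x = p ∨ x = q ∨ x = s₁ ∨ x = s₂ ∨ x = s₃ ∨ x = s₄ := by
    intro x hx
    have : x ∈ hXb.finite.toFinset := by simpa using hx
    rw [← heq] at this
    simpa using this
  have hblock : ∀ u ∈ X, ∀ v ∈ X, u ≠ v → c u = c v → Blocks p u v ∨ Blocks q u v := by
    intro u hu v hv huv hc
    obtain ⟨z, hz, hb⟩ := hXb.exists_blocker hu hv huv hc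
    have := k.not_side hu.1 hv.1 huv (hXc u hu) hb
    rcases hmem z hz with rfl | rfl | rfl | rfl | rfl | rfl
    · exact Or.inl hb
    · exact Or.inr hb
    all_goals simp at this
  have hpX : p ∈ X := k.mem_inner.2 ⟨hp, hcp⟩
  have hqX : q ∈ X := k.mem_inner.2 ⟨hq, hcq⟩
  have hne : c p ≠ c q := by
    intro hc
    rcases hblock p hpX q hqX hpq hc with hb | hb
    · exact hb.ne_left hpq rfl
    · exact hb.ne_right hpq rfl
  obtain ⟨p', hp', hpp, hcp'⟩ := hXb.exists_partner hXc hge hpX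
  obtain ⟨q', hq', hqq, hcq'⟩ := hXb.exists_partner hXc hge hqX
  have b1 : Blocks q p p' := (hblock p hpX p' hp' hpp.symm hcp'.symm).resolve_left
    fun hb => hb.ne_left hpp.symm rfl
  have b2 : Blocks p q q' := (hblock q hqX q' hq' hqq.symm hcq'.symm).resolve_right
    fun hb => hb.ne_left hqq.symm rfl
  have : cross p q q' = 0 := by rw [cross_rotate, b2.cross_zero]
  rcases k.blocked.mem_line hp hp'.1 hq hpp.symm b1 (Or.inl rfl) (by simp) hpq hq'.1 this with
    rfl | rfl | rfl
  · exact hne hcq'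
  · exact hne (hcp'.symm.trans hcq')
  · exact hqq rfl

/-- Such a set is a blocked quadrilateral. -/
theorem exists_blockedQuad (k : HullQuad P c a b d e s₁ s₂ s₃ s₄) :
    ∃ m, BlockedQuad P c a b d e s₁ s₂ s₃ s₄ m := by
  obtain ⟨hab, had⟩ := k.ne
  obtain ⟨hbd, hbe⟩ := k.rotate.ne
  obtain ⟨hde, -⟩ := k.rotate.rotate.ne
  obtain ⟨hea, -⟩ := k.rotate.rotate.rotate.ne
  have cs1 := k.colour₁
  have cs2 := k.rotate.colour₁
  have cs3 := k.rotate.rotate.colour₁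
  have cs4 := k.rotate.rotate.rotate.colour₁
  rw [k.cb] at cs2
  rw [k.cd] at cs3
  rw [k.ce] at cs4
  obtain ⟨m, hm, hmb⟩ := k.blocked.exists_blocker k.ma k.md had k.cd.symm
  obtain ⟨m', hm', hmb'⟩ := k.blocked.exists_blocker k.mb k.me hbe (k.cb.trans k.ce.symm)
  have hcm := k.blocked.colour_ne hm k.ma k.md had hmb
  have hcm' := k.blocked.colour_ne hm' k.mb k.me hbe hmb'
  rw [k.cb] at hcm'
  have diag : ∀ {a b d e s₁ s₂ s₃ s₄ m}, HullQuad P c a b d e s₁ s₂ s₃ s₄ → Blocks m a d →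
      m ≠ s₁ ∧ m ≠ s₂ ∧ m ≠ s₃ ∧ m ≠ s₄ ∧ ¬ Blocks m s₁ s₂ := by
    intro a b d e s₁ s₂ s₃ s₄ m k hmb
    have h0 := hmb.cross_zero
    have hb : 0 < cross d a b := by rw [cross_rotate]; exact k.pb
    have he : 0 < cross a d e := by rw [cross_rotate]; exact k.pe
    have h0' : cross d a m = 0 := by rw [cross_swap, h0, neg_zero]
    have e1 := k.hs₁.cross_pos' (cross_self_right d a).ge hb
    have e2 := k.hs₂.cross_pos hb (cross_self_mid d a).ge
    have e3 := k.hs₃.cross_pos' (cross_self_right a d).ge he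
    have e4 := k.hs₄.cross_pos he (cross_self_mid a d).ge
    refine ⟨?_, ?_, ?_, ?_, fun hb => ?_⟩
    · rintro rfl; exact e1.ne' h0'
    · rintro rfl; exact e2.ne' h0'
    · rintro rfl; exact e3.ne' h0
    · rintro rfl; exact e4.ne' h0
    · exact (hb.cross_pos e1 e2.le).ne' h0'
  have d1 := diag k hmb
  have d2 := diag k.rotate hmb'
  have hmm : m' = m := k.inner_unique hm' hm hcm' hcm
    ⟨d2.2.2.2.1, d2.1, d2.2.1, d2.2.2.1⟩ ⟨d1.1, d1.2.1, d1.2.2.1, d1.2.2.2.1⟩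
  subst hmm
  have d3 := diag k.rotate.rotate hmb.symm
  have d4 := diag k.rotate.rotate.rotate hmb'.symm
  obtain ⟨n1, n2, n3, n4, nb1⟩ := d1
  have hall : ∀ x ∈ P, c x ≠ c a → x = s₁ ∨ x = s₂ ∨ x = s₃ ∨ x = s₄ ∨ x = m' := by
    intro x hx hcx
    by_contra! hn
    exact hn.2.2.2.2 (k.inner_unique hx hm hcx hcm ⟨hn.1, hn.2.1, hn.2.2.1, hn.2.2.2.1⟩
      ⟨n1, n2, n3, n4⟩)
  have hblock : ∀ {u v}, u ∈ P → v ∈ P → u ≠ v → c u = c v → c u ≠ c a → Blocks m' u v := by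
    intro u v hu hv huv hc hcu
    obtain ⟨z, hz, hb⟩ := k.restrict.exists_blocker (k.mem_inner.2 ⟨hu, hcu⟩)
      (k.mem_inner.2 ⟨hv, hc ▸ hcu⟩) huv hc
    have := k.not_side hu hv huv hcu hb
    rcases hall z hz.1 (k.mem_inner.1 hz).2 with rfl | rfl | rfl | rfl | rfl
    on_goal 5 => exact hb
    all_goals simp at this
  have e1 := k.side_ne
  have e2 := k.rotate.side_ne
  have e3 := k.rotate.rotate.side_ne
  have c12 : c s₁ ≠ c s₂ := fun hc => nb1 (hblock k.m₁ k.m₂ e1.1 hc cs1)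
  have c23 : c s₂ ≠ c s₃ := fun hc => d2.2.2.2.2 (hblock k.m₂ k.m₃ e2.1 hc cs2)
  have c34 : c s₃ ≠ c s₄ := fun hc => d3.2.2.2.2 (hblock k.m₃ k.m₄ e3.1 hc cs3)
  have c41 : c s₄ ≠ c s₁ := fun hc => d4.2.2.2.2 (hblock k.m₄ k.m₁ e1.2.2.symm hc cs4)
  have cm : ∀ {x}, x ∈ P → m' ≠ x → c m' ≠ c x := fun hx hne hc =>
    (hblock hm hx hne hc hcm).ne_left hne rfl
  have cm1 := cm k.m₁ n1
  have cm2 := cm k.m₂ n2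
  have cm3 := cm k.m₃ n3
  have cm4 := cm k.m₄ n4
  have c13 : c s₃ = c s₁ := by omega
  have c24 : c s₄ = c s₂ := by omega
  refine ⟨m', ⟨?_, k.hs₁, k.hs₂, k.hs₃, k.hs₄, hmb, hmb', hblock k.m₁ k.m₃ e1.2.1 c13.symm cs1,
    hblock k.m₂ k.m₄ e2.2.1 c24.symm cs2, hab, hbd, hde, hea, had, hbe, e1.2.1, e2.2.1, k.cb, k.cd,
    k.ce, cs1, c13, cs2, c24, c12, hcm, cm1, cm2⟩⟩
  ext x
  simp only [Set.mem_insert_iff, Set.mem_singleton_iff]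
  constructor
  · intro hx
    by_cases hc : c x = c a
    · have := k.only x hx hc
      tauto
    · have := hall x hx hc
      tauto
  · rintro (rfl | rfl | rfl | rfl | rfl | rfl | rfl | rfl | rfl)
    exacts [k.ma, k.mb, k.md, k.me, k.m₁, k.m₂, k.m₃, k.m₄, hm]

end HullQuad

/-! ### Cyclic words

Points around a centre are numbered `0, …, n - 1` by increasing angle and the centre gets the
number `n`. A triple `(i, j, z)` with `i < j` records that `z` blocks the pair `i, j`. -/

namespace CyclicWord

/-- Words of length `m` over three letters without equal consecutive letters. -/
def words : ℕ → List (List ℕ)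
  | 0 => [[]]
  | m + 1 => (words m).flatMap fun l => ([0, 1, 2].filter fun x => l.head? ≠ some x).map (· :: l)

/-- The comparison of the angle from `i` to `j` with a half turn forced by the triple `(i, j, z)`:
`0` if it is smaller, `1` if it is equal, `2` if it is larger. -/
def turn (n : ℕ) (T : ℕ × ℕ × ℕ) : ℕ :=
  if T.2.2 = n then 1 else if T.1 < T.2.2 ∧ T.2.2 < T.2.1 then 0 else 2

/-- The angles forced by two triples do not contradict each other. -/
def Nested (n : ℕ) (T U : ℕ × ℕ × ℕ) : Prop :=
  T.1 ≤ U.1 → U.2.1 ≤ T.2.1 → turn n U ≤ turn n T ∧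
    (turn n T = 1 → turn n U = 1 → T.1 = U.1 ∧ T.2.1 = U.2.1)

/-- The three points of a triple. -/
def points (T : ℕ × ℕ × ℕ) : List ℕ := [T.1, T.2.1, T.2.2]

/-- The lines of two triples share at most one point or contain the same points. -/
def LineOk (T U : ℕ × ℕ × ℕ) : Prop :=
  ∀ x ∈ points T, x ∈ points U → ∀ y ∈ points T, x ≠ y → y ∈ points U →
    ∀ z ∈ points U, z ∈ points T

/-- Two triples can occur together. -/
def Compatible (n : ℕ) (T U : ℕ × ℕ × ℕ) : Prop :=
  Nested n T U ∧ Nested n U T ∧ LineOk T U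

/-- The triple can occur in a word with letters `w` and special positions `0`, `a`, `b`. -/
def Admissible (n a b : ℕ) (w : List ℕ) (T : ℕ × ℕ × ℕ) : Prop :=
  T.2.2 ≠ T.1 ∧ T.2.2 ≠ T.2.1 ∧ (T.2.2 = n ∨ w.getD T.2.2 0 ≠ w.getD T.1 0) ∧
    (T.2.2 = n → T.1 ∉ [0, a, b] ∧ T.2.1 ∉ [0, a, b]) ∧
    (T.2.1 ≤ a ∨ (a ≤ T.1 ∧ T.2.1 ≤ b) ∨ b ≤ T.1 → turn n T = 0) ∧
    (T.1 = 0 → b ≤ T.2.1 → turn n T = 2) ∧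
    ∀ k < n, w.getD k 0 = w.getD T.1 0 → k ≠ T.1 → k ≠ T.2.1 →
      (T.1 < k ∧ k < T.2.1 → turn n T ≠ 0) ∧ (k < T.1 ∨ T.2.1 < k → turn n T ≠ 2)

set_option synthInstance.maxSize 2000
set_option synthInstance.maxHeartbeats 400000

instance (n : ℕ) (T U : ℕ × ℕ × ℕ) : Decidable (Compatible n T U) := by
  unfold Compatible Nested LineOk; infer_instance

instance (n a b : ℕ) (w : List ℕ) (T : ℕ × ℕ × ℕ) : Decidable (Admissible n a b w T) := by
  unfold Admissible; infer_instance

/-- Choose one triple from each list of options, compatibly with the triples already chosen; the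
result is `true` if every complete choice satisfies `leaf`. -/
def search (n : ℕ) (leaf : List (ℕ × ℕ × ℕ) → Bool) :
    List (List (ℕ × ℕ × ℕ)) → List (ℕ × ℕ × ℕ) → Bool
  | [], acc => leaf acc
  | o :: os, acc => o.all fun T =>
      !(acc.all fun U => decide (Compatible n T U)) || search n leaf os (T :: acc)

/-- The options for the pairs of equal letters. -/
def options (n a b : ℕ) (w : List ℕ) : List (List (ℕ × ℕ × ℕ)) :=
  (List.range n).flatMap fun j =>
    ((List.range j).filter fun i => w.getD i 0 = w.getD j 0).map fun i =>
      ((List.range (n + 1)).filter fun z => Admissible n a b w (i, j, z)).map fun z => (i, j, z)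

/-- The triple recording that `z` blocks `x` and `y`. -/
def triple (x y z : ℕ) : ℕ × ℕ × ℕ := (min x y, max x y, z)

/-- The configuration of seven points that is excluded by convexity. -/
def Excluded (n : ℕ) (acc : List (ℕ × ℕ × ℕ)) (x y z qx qz : ℕ) : Prop :=
  triple x qx z ∈ acc ∧ ∃ w < n, triple x qz w ∈ acc ∧ triple z w y ∈ acc ∧
    ∃ v ∈ [n, x, y, z, w], triple qz qx v ∈ acc

/-- The two chiral ways in which the special points block each other. -/
def Cyclic (acc : List (ℕ × ℕ × ℕ)) (a b q₁ q₂ q₃ : ℕ) : Prop :=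
  triple 0 q₁ a ∈ acc ∧ triple a q₂ b ∈ acc ∧ triple b q₃ 0 ∈ acc

instance (n : ℕ) (acc : List (ℕ × ℕ × ℕ)) (x y z qx qz : ℕ) :
    Decidable (Excluded n acc x y z qx qz) := by
  unfold Excluded; infer_instance

instance (acc : List (ℕ × ℕ × ℕ)) (a b q₁ q₂ q₃ : ℕ) :
    Decidable (Cyclic acc a b q₁ q₂ q₃) := by
  unfold Cyclic; infer_instance

/-- The outcomes that a complete choice may have. -/
def Outcome (n a b q₁ q₂ q₃ : ℕ) (acc : List (ℕ × ℕ × ℕ)) : Prop :=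
  (Excluded n acc 0 a b q₁ q₃ ∨ Excluded n acc 0 b a q₁ q₂ ∨ Excluded n acc a 0 b q₂ q₃ ∨
    Excluded n acc a b 0 q₂ q₁ ∨ Excluded n acc b 0 a q₃ q₂ ∨ Excluded n acc b a 0 q₃ q₁) ∨
  n = 6 ∧ (Cyclic acc a b q₁ q₂ q₃ ∨
    triple 0 q₁ b ∈ acc ∧ triple a q₂ 0 ∈ acc ∧ triple b q₃ a ∈ acc)

instance (n a b q₁ q₂ q₃ : ℕ) (acc : List (ℕ × ℕ × ℕ)) :
    Decidable (Outcome n a b q₁ q₂ q₃ acc) := by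
  unfold Outcome; infer_instance

/-- Every letter occurs once or twice in the positions `s`. -/
def Balanced (w s : List ℕ) : Prop :=
  ∀ γ < 3, 0 < s.countP (fun k => w.getD k 0 = γ) ∧ s.countP (fun k => w.getD k 0 = γ) ≤ 2

instance (w s : List ℕ) : Decidable (Balanced w s) := by
  unfold Balanced; infer_instance

/-- The search succeeds for the word `w` with special positions `0`, `a`, `b`, if the positions
`q₁`, `q₂`, `q₃` block nothing. -/
def VerifiedAt (n a b : ℕ) (w : List ℕ) : Prop :=
  ∀ q₃ < a, 0 < q₃ → ∀ q₁ < b, a < q₁ → ∀ q₂ < n, b < q₂ →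
    search n (fun acc => Outcome n a b q₁ q₂ q₃ acc)
      ((options n a b w).map fun o => o.filter fun T => T.2.2 ∉ [q₁, q₂, q₃]) [] = true

instance (n a b : ℕ) (w : List ℕ) : Decidable (VerifiedAt n a b w) := by
  unfold VerifiedAt; infer_instance

/-- The search succeeds for all words of length `n`. -/
def Verified (n : ℕ) : Prop :=
  ∀ w ∈ words n, w.getD 0 0 = 0 → w.getD 1 0 = 1 →
    (∀ γ < 3, (List.range n).countP (fun k => w.getD k 0 = γ) ≤ 3) →
    ∀ a < n, Balanced w (List.range' 0 (a + 1)) →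
    ∀ b < n, a < b → Balanced w (List.range' a (b + 1 - a)) →
      Balanced w (0 :: List.range' b (n - b)) → VerifiedAt n a b w

instance (n : ℕ) : Decidable (Verified n) := by
  unfold Verified; infer_instance

set_option maxRecDepth 100000 in
theorem verified_six : Verified 6 := by decide +kernel

set_option maxRecDepth 100000 in
theorem verified_seven : Verified 7 := by decide +kernel

set_option maxRecDepth 100000 in
theorem verified_eight : Verified 8 := by decide +kernel

set_option maxRecDepth 100000 in
theorem verified_nine : Verified 9 := by decide +kernel

end CyclicWord

namespace CyclicWord

theorem mem_words : ∀ l : List ℕ, (∀ x ∈ l, x < 3) → l.IsChain (· ≠ ·) → l ∈ words l.length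
  | [], _, _ => by simp [words]
  | x :: l, h, hc => by
    refine List.mem_flatMap.2 ⟨l, mem_words l (fun y hy => h y (List.mem_cons_of_mem _ hy))
      hc.tail, List.mem_map.2 ⟨x, List.mem_filter.2 ⟨?_, ?_⟩, rfl⟩⟩
    · have := h x List.mem_cons_self
      interval_cases x <;> simp
    · rw [List.isChain_cons] at hc
      simp only [ne_eq, decide_not, Bool.not_eq_eq_eq_not, Bool.not_true, decide_eq_false_iff_not]
      exact fun hx => hc.1 x hx rfl

theorem exists_of_search {n : ℕ} {leaf : List (ℕ × ℕ × ℕ) → Bool} {R : ℕ × ℕ × ℕ → Prop}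
    (hR : ∀ T U, R T → R U → Compatible n T U) :
    ∀ (opts : List (List (ℕ × ℕ × ℕ))) (acc : List (ℕ × ℕ × ℕ)), search n leaf opts acc = true →
      (∀ o ∈ opts, ∃ T ∈ o, R T) → (∀ T ∈ acc, R T) →
      ∃ acc' : List (ℕ × ℕ × ℕ), (∀ T ∈ acc', R T) ∧ leaf acc' = true
  | [], acc, h, _, hacc => ⟨acc, hacc, h⟩
  | o :: os, acc, h, ho, hacc => by
    obtain ⟨T, hT, hRT⟩ := ho o List.mem_cons_self
    have := List.all_eq_true.1 h T hT
    rw [Bool.or_eq_true, Bool.not_eq_true'] at this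
    refine exists_of_search hR os (T :: acc) (this.resolve_left ?_)
      (fun o' ho' => ho o' (List.mem_cons_of_mem _ ho')) ?_
    · rw [Bool.not_eq_false, List.all_eq_true]
      exact fun U hU => decide_eq_true (hR T U hRT (hacc U hU))
    · intro U hU
      rcases List.mem_cons.1 hU with rfl | hU
      exacts [hRT, hacc U hU]

/-- Points with letters `col` at the angles `θ`, where `B z i j` says that `z` blocks `i, j`. -/
structure Model (n a b q₁ q₂ q₃ : ℕ) (col : ℕ → ℕ) (θ : ℕ → ℝ) (B : ℕ → ℕ → ℕ → Prop) :
    Prop where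
  six_le : 6 ≤ n
  le_nine : n ≤ 9
  q₃_pos : 0 < q₃
  q₃_lt : q₃ < a
  lt_q₁ : a < q₁
  q₁_lt : q₁ < b
  lt_q₂ : b < q₂
  q₂_lt : q₂ < n
  col_lt : ∀ k < n, col k < 3
  col_zero : col 0 = 0
  col_one : col 1 = 1
  count_le : ∀ γ < 3, (List.range n).countP (fun k => col k = γ) ≤ 3
  balanced₁ : ∀ γ < 3, 0 < (List.range' 0 (a + 1)).countP (fun k => col k = γ) ∧
    (List.range' 0 (a + 1)).countP (fun k => col k = γ) ≤ 2
  balanced₂ : ∀ γ < 3, 0 < (List.range' a (b + 1 - a)).countP (fun k => col k = γ) ∧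
    (List.range' a (b + 1 - a)).countP (fun k => col k = γ) ≤ 2
  balanced₃ : ∀ γ < 3, 0 < (0 :: List.range' b (n - b)).countP (fun k => col k = γ) ∧
    (0 :: List.range' b (n - b)).countP (fun k => col k = γ) ≤ 2
  mono : ∀ i j, i < j → j < n → θ i < θ j
  angle_zero : θ 0 = 0
  angle_lt : ∀ k < n, θ k < 2 * Real.pi
  angle_a : θ a < Real.pi
  angle_ab : θ b - θ a < Real.pi
  angle_b : Real.pi < θ b
  exists_blocker : ∀ i j, i < j → j < n → col i = col j → ∃ z ≤ n, B z i j
  centre : ∀ i j, i < j → j < n → B n i j →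
    θ j - θ i = Real.pi ∧ i ∉ [0, a, b] ∧ j ∉ [0, a, b]
  blocker : ∀ i j z, i < j → j < n → z < n → B z i j → z ≠ i ∧ z ≠ j ∧ col z ≠ col i ∧
    z ∉ [q₁, q₂, q₃] ∧ (θ j - θ i < Real.pi ∧ i < z ∧ z < j ∨
      Real.pi < θ j - θ i ∧ (z < i ∨ j < z))
  triple : ∀ i j k, i < j → j < k → k < n → col i = col j → col j = col k →
    θ j - θ i ≤ Real.pi ∧ θ k - θ j ≤ Real.pi ∧ Real.pi ≤ θ k - θ i
  line : ∀ i j z i' j' z', i < j → j < n → z ≤ n → B z i j → i' < j' → j' < n → z' ≤ n →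
    B z' i' j' → LineOk (i, j, z) (i', j', z')

namespace Model

variable {n a b q₁ q₂ q₃ : ℕ} {col : ℕ → ℕ} {θ : ℕ → ℝ} {B : ℕ → ℕ → ℕ → Prop}

/-- A triple that occurs in the model. -/
def Occurs (n : ℕ) (B : ℕ → ℕ → ℕ → Prop) (col : ℕ → ℕ) (T : ℕ × ℕ × ℕ) : Prop :=
  T.1 < T.2.1 ∧ T.2.1 < n ∧ T.2.2 ≤ n ∧ col T.1 = col T.2.1 ∧ B T.2.2 T.1 T.2.1

theorem order (M : Model n a b q₁ q₂ q₃ col θ B) :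
    0 < q₃ ∧ q₃ < a ∧ a < q₁ ∧ q₁ < b ∧ b < q₂ ∧ q₂ < n :=
  ⟨M.q₃_pos, M.q₃_lt, M.lt_q₁, M.q₁_lt, M.lt_q₂, M.q₂_lt⟩

theorem turn_cases (M : Model n a b q₁ q₂ q₃ col θ B) {T : ℕ × ℕ × ℕ} (hT : Occurs n B col T) :
    (turn n T = 0 ∧ θ T.2.1 - θ T.1 < Real.pi) ∨ (turn n T = 1 ∧ θ T.2.1 - θ T.1 = Real.pi) ∨
      (turn n T = 2 ∧ Real.pi < θ T.2.1 - θ T.1) := by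
  obtain ⟨i, j, z⟩ := T
  obtain ⟨hij, hj, hz, -, hB⟩ := hT
  dsimp only at hij hj hz hB ⊢
  unfold turn
  dsimp only
  rcases hz.lt_or_eq with hz | rfl
  · obtain ⟨-, -, -, -, h⟩ := M.blocker i j z hij hj hz hB
    rw [if_neg hz.ne]
    rcases h with ⟨h, hz'⟩ | ⟨h, hz'⟩
    · rw [if_pos hz']
      exact Or.inl ⟨rfl, h⟩
    · rw [if_neg (by omega)]
      exact Or.inr (Or.inr ⟨rfl, h⟩)
  · rw [if_pos rfl]
    exact Or.inr (Or.inl ⟨rfl, (M.centre i j hij hj hB).1⟩)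

theorem le_angle (M : Model n a b q₁ q₂ q₃ col θ B) {i j : ℕ} (hij : i ≤ j) (hj : j < n) :
    θ i ≤ θ j := by
  rcases hij.eq_or_lt with rfl | h
  exacts [le_rfl, (M.mono i j h hj).le]

theorem nested (M : Model n a b q₁ q₂ q₃ col θ B) {T U : ℕ × ℕ × ℕ} (hT : Occurs n B col T)
    (hU : Occurs n B col U) : Nested n T U := by
  intro h1 h2
  have e1 := M.le_angle h1 (hU.1.trans hU.2.1)
  have e2 := M.le_angle h2 hT.2.1
  refine ⟨?_, fun h3 h4 => ?_⟩
  · rcases M.turn_cases hT with ⟨h, h'⟩ | ⟨h, h'⟩ | ⟨h, h'⟩ <;>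
      rcases M.turn_cases hU with ⟨k, k'⟩ | ⟨k, k'⟩ | ⟨k, k'⟩ <;> first | omega | linarith
  · have h5 : θ T.2.1 - θ T.1 = θ U.2.1 - θ U.1 := by
      rcases M.turn_cases hT with ⟨h, h'⟩ | ⟨h, h'⟩ | ⟨h, h'⟩ <;>
      rcases M.turn_cases hU with ⟨k, k'⟩ | ⟨k, k'⟩ | ⟨k, k'⟩ <;> first | omega | linarith
    constructor
    · by_contra hne
      have := M.mono _ _ (lt_of_le_of_ne h1 hne) (hU.1.trans hU.2.1)
      linarith
    · by_contra hne
      have := M.mono _ _ (lt_of_le_of_ne h2 (Ne.symm hne)) hT.2.1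
      linarith

theorem compatible (M : Model n a b q₁ q₂ q₃ col θ B) {T U : ℕ × ℕ × ℕ} (hT : Occurs n B col T)
    (hU : Occurs n B col U) : Compatible n T U :=
  ⟨M.nested hT hU, M.nested hU hT, M.line _ _ _ _ _ _ hT.1 hT.2.1 hT.2.2.1 hT.2.2.2.2
    hU.1 hU.2.1 hU.2.2.1 hU.2.2.2.2⟩

theorem angle_sector (M : Model n a b q₁ q₂ q₃ col θ B) {i j : ℕ} (hij : i < j) (hj : j < n)
    (h : j ≤ a ∨ (a ≤ i ∧ j ≤ b) ∨ b ≤ i) : θ j - θ i < Real.pi := by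
  obtain ⟨h1, h2, h3, h4, h5, h6⟩ := M.order
  have e0 := M.le_angle (Nat.zero_le i) (hij.trans hj)
  have := M.angle_zero
  have := M.angle_a
  have := M.angle_ab
  have := M.angle_b
  rcases h with h | ⟨h, h'⟩ | h
  · have := M.le_angle h (by omega)
    linarith
  · have := M.le_angle h (by omega)
    have := M.le_angle h' (by omega)
    linarith
  · have := M.le_angle h (by omega)
    have := M.angle_lt j hj
    linarith

theorem getD_col {k : ℕ} (hk : k < n) : ((List.range n).map col).getD k 0 = col k := by
  simp [List.getD, hk]

theorem admissible (M : Model n a b q₁ q₂ q₃ col θ B) {T : ℕ × ℕ × ℕ} (hT : Occurs n B col T) :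
    T.2.2 ∉ [q₁, q₂, q₃] ∧ Admissible n a b ((List.range n).map col) T := by
  have ht := M.turn_cases hT
  obtain ⟨i, j, z⟩ := T
  obtain ⟨hij, hj, hz, hc, hB⟩ := hT
  dsimp only at hij hj hz hc hB ht
  have hz' : z ∉ [q₁, q₂, q₃] ∧ z ≠ i ∧ z ≠ j ∧ (z = n ∨ col z ≠ col i) := by
    rcases hz.lt_or_eq with hz | rfl
    · obtain ⟨h1, h2, h3, h4, -⟩ := M.blocker i j z hij hj hz hB
      exact ⟨h4, h1, h2, Or.inr h3⟩
    · obtain ⟨h1, h2, h3, h4, h5, h6⟩ := M.order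
      refine ⟨?_, by omega, by omega, Or.inl rfl⟩
      simp only [List.mem_cons, List.not_mem_nil, or_false]
      omega
  refine ⟨hz'.1, hz'.2.1, hz'.2.2.1, ?_, ?_, ?_, ?_, ?_⟩
  · rcases hz'.2.2.2 with h | h
    · exact Or.inl h
    · rcases hz.lt_or_eq with hz | hz
      · right
        dsimp only
        rwa [getD_col hz, getD_col (hij.trans hj)]
      · exact Or.inl hz
  · intro h
    dsimp only at h
    subst h
    exact (M.centre i j hij hj hB).2
  · intro h
    have := M.angle_sector hij hj h
    rcases ht with ht | ht | ht
    · exact ht.1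
    · linarith
    · linarith
  · intro h1 h2
    dsimp only at h1 h2
    subst h1
    have := M.le_angle h2 hj
    have := M.angle_zero
    have := M.angle_b
    rcases ht with ht | ht | ht
    · linarith
    · linarith
    · exact ht.1
  · intro k hk hck hki hkj
    dsimp only at hck hki hkj
    rw [getD_col hk, getD_col (hij.trans hj)] at hck
    refine ⟨fun h => ?_, fun h => ?_⟩
    · have := M.triple i k j h.1 h.2 hj hck.symm (hck.trans hc)
      rcases ht with ht | ht | ht <;> first | omega | linarith
    · rcases h with h | h
      · have := M.triple k i j h hij hj hck hc
        rcases ht with ht | ht | ht <;> first | omega | linarith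
      · have := M.triple i j k hij h hk hc (hc.symm.trans hck.symm)
        rcases ht with ht | ht | ht <;> first | omega | linarith

theorem col_ne_succ (M : Model n a b q₁ q₂ q₃ col θ B) {k : ℕ} (hk : k + 1 < n) :
    col k ≠ col (k + 1) := by
  intro h
  obtain ⟨z, hz, hB⟩ := M.exists_blocker k (k + 1) (by omega) hk h
  have := M.turn_cases (T := (k, k + 1, z)) ⟨by simp, hk, hz, h, hB⟩
  have h1 := M.angle_sector (i := k) (j := k + 1) (by omega) hk (by
    obtain ⟨h1, h2, h3, h4, h5, h6⟩ := M.order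
    omega)
  dsimp only at this
  rcases this with ⟨h2, -⟩ | ⟨-, h2⟩ | ⟨-, h2⟩
  · unfold turn at h2
    dsimp only at h2
    split_ifs at h2
    omega
  · linarith
  · linarith

theorem countP_getD (γ : ℕ) {s : List ℕ} (hs : ∀ k ∈ s, k < n) :
    s.countP (fun k => ((List.range n).map col).getD k 0 = γ) = s.countP (fun k => col k = γ) :=
  List.countP_congr fun k hk => by rw [getD_col (hs k hk)]

theorem balanced_iff {s : List ℕ} (hs : ∀ k ∈ s, k < n)
    (h : ∀ γ < 3, 0 < s.countP (fun k => col k = γ) ∧ s.countP (fun k => col k = γ) ≤ 2) :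
    Balanced ((List.range n).map col) s := by
  intro γ hγ
  rw [countP_getD γ hs]
  exact h γ hγ

theorem exists_outcome (M : Model n a b q₁ q₂ q₃ col θ B) :
    ∃ acc : List (ℕ × ℕ × ℕ), (∀ T ∈ acc, Occurs n B col T) ∧ Outcome n a b q₁ q₂ q₃ acc := by
  have hV : Verified n := by
    have h6 := M.six_le
    have h9 := M.le_nine
    interval_cases n
    exacts [verified_six, verified_seven, verified_eight, verified_nine]
  have hw : (List.range n).map col ∈ words n := by
    have := mem_words ((List.range n).map col) (by simpa using M.col_lt) (by
      rw [List.isChain_iff_getElem]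
      intro i hi
      simp only [List.length_map, List.length_range] at hi
      simpa using M.col_ne_succ hi)
    simpa using this
  have h6 := M.six_le
  obtain ⟨h1, h2, h3, h4, h5, h6'⟩ := M.order
  have hs := hV _ hw (by rw [getD_col (by omega), M.col_zero])
    (by rw [getD_col (by omega), M.col_one])
    (fun γ hγ => by rw [countP_getD γ (by simp)]; exact M.count_le γ hγ) a (by omega)
    (balanced_iff (fun k hk => by simp at hk; omega) M.balanced₁) b (by omega) (by omega)
    (balanced_iff (fun k hk => by rw [List.mem_range'_1] at hk; omega) M.balanced₂)
    (balanced_iff (fun k hk => by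
      rw [List.mem_cons, List.mem_range'_1] at hk; omega) M.balanced₃)
    q₃ h2 h1 q₁ h4 h3 q₂ h6' h5
  obtain ⟨acc, hacc, hl⟩ := exists_of_search (fun T U hT hU => M.compatible hT hU) _ _ hs (by
    intro o' ho'
    obtain ⟨o, ho, rfl⟩ := List.mem_map.1 ho'
    obtain ⟨j, hj, ho⟩ := List.mem_flatMap.1 ho
    obtain ⟨i, hi, rfl⟩ := List.mem_map.1 ho
    rw [List.mem_filter, List.mem_range] at hi
    rw [List.mem_range] at hj
    have hc := of_decide_eq_true hi.2
    rw [getD_col hj, getD_col (hi.1.trans hj)] at hc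
    obtain ⟨z, hz, hB⟩ := M.exists_blocker i j hi.1 hj hc
    have hT : Occurs n B col (i, j, z) := ⟨hi.1, hj, hz, hc, hB⟩
    obtain ⟨hq, hadm⟩ := M.admissible hT
    exact ⟨_, List.mem_filter.2 ⟨List.mem_map.2 ⟨z, List.mem_filter.2
      ⟨by simpa [Nat.lt_succ_iff] using hz, decide_eq_true hadm⟩, rfl⟩, decide_eq_true hq⟩, hT⟩)
      (by simp)
  exact ⟨acc, hacc, of_decide_eq_true hl⟩

end Model

end CyclicWord

/-- `θ` is the angle of the polar coordinates around `r`, up to a rotation. -/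
structure IsAngle (r : ℝ × ℝ) (θ : ℝ × ℝ → ℝ) : Prop where
  nonneg : ∀ x, 0 ≤ θ x
  lt : ∀ x, θ x < 2 * Real.pi
  cross_eq : ∀ u v, u ≠ r → v ≠ r → ∃ k : ℝ, 0 < k ∧ cross r u v = k * Real.sin (θ v - θ u)
  ray : ∀ u v, u ≠ r → v ≠ r → u ≠ v → θ u = θ v → Blocks u r v ∨ Blocks v r u

theorem exists_isAngle (r p : ℝ × ℝ) : ∃ θ : ℝ × ℝ → ℝ, θ p = 0 ∧ IsAngle r θ := by
  let f : ℝ × ℝ → ℂ := fun x => ⟨x.1 - r.1, x.2 - r.2⟩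
  have hf : ∀ x, x ≠ r → 0 < ‖f x‖ := fun x hx => by
    rw [norm_pos_iff]
    intro h
    refine hx (Prod.ext ?_ ?_)
    · have := congrArg Complex.re h
      simpa [f, sub_eq_zero] using this
    · have := congrArg Complex.im h
      simpa [f, sub_eq_zero] using this
  let θ : ℝ × ℝ → ℝ := fun x => toIcoMod Real.two_pi_pos 0 ((f x).arg - (f p).arg)
  have hθ : ∀ x, ∃ m : ℤ, (f x).arg - (f p).arg = θ x + m * (2 * Real.pi) := fun x =>
    ⟨toIcoDiv Real.two_pi_pos 0 ((f x).arg - (f p).arg), by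
      rw [← zsmul_eq_mul]; exact (toIcoMod_add_toIcoDiv_zsmul _ _ _).symm⟩
  have hre : ∀ x, x.1 - r.1 = ‖f x‖ * Real.cos (f x).arg := fun x =>
    (Complex.norm_mul_cos_arg (f x)).symm
  have him : ∀ x, x.2 - r.2 = ‖f x‖ * Real.sin (f x).arg := fun x =>
    (Complex.norm_mul_sin_arg (f x)).symm
  refine ⟨θ, by simp [θ], ⟨fun x => ?_, fun x => ?_, fun u v hu hv => ?_, fun u v hu hv huv h => ?_⟩⟩
  · exact left_le_toIcoMod _ _ _
  · simpa using toIcoMod_lt_right Real.two_pi_pos 0 ((f x).arg - (f p).arg)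
  · refine ⟨‖f u‖ * ‖f v‖, mul_pos (hf u hu) (hf v hv), ?_⟩
    obtain ⟨m, hm⟩ := hθ u
    obtain ⟨k, hk⟩ := hθ v
    have : Real.sin ((f v).arg - (f u).arg) = Real.sin (θ v - θ u) := by
      rw [← Real.sin_add_int_mul_two_pi (θ v - θ u) (k - m)]
      congr 1
      push_cast
      linarith
    rw [← this, Real.sin_sub]
    unfold cross
    rw [hre u, hre v, him u, him v]
    ring
  · obtain ⟨m, hm⟩ := hθ u
    obtain ⟨k, hk⟩ := hθ v
    have hum : (f u).arg = (f v).arg + (m - k : ℤ) * (2 * Real.pi) := by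
      push_cast
      linarith
    have hcos : Real.cos (f u).arg = Real.cos (f v).arg := by
      rw [hum, Real.cos_add_int_mul_two_pi]
    have hsin : Real.sin (f u).arg = Real.sin (f v).arg := by
      rw [hum, Real.sin_add_int_mul_two_pi]
    have key : ∀ u v, v ≠ r → u ≠ r → Real.cos (f u).arg = Real.cos (f v).arg →
        Real.sin (f u).arg = Real.sin (f v).arg → ‖f u‖ < ‖f v‖ → Blocks u r v := by
      intro u v hv hu hcos hsin hlt
      refine blocks_iff_exists.2 ⟨‖f u‖ / ‖f v‖, div_pos (hf u hu) (hf v hv),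
        (div_lt_one (hf v hv)).2 hlt, ?_, ?_⟩
      · have h1 := hre u
        have h2 := hre v
        rw [hcos] at h1
        have := (hf v hv).ne'
        have e : ‖f u‖ / ‖f v‖ * (v.1 - r.1) = u.1 - r.1 := by
          rw [h2, h1]; field_simp
        linarith
      · have h1 := him u
        have h2 := him v
        rw [hsin] at h1
        have := (hf v hv).ne'
        have e : ‖f u‖ / ‖f v‖ * (v.2 - r.2) = u.2 - r.2 := by
          rw [h2, h1]; field_simp
        linarith
    rcases lt_trichotomy ‖f u‖ ‖f v‖ with hlt | heq | hlt
    · exact Or.inl (key u v hv hu hcos hsin hlt)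
    · refine absurd (Prod.ext ?_ ?_) huv
      · have h1 := hre u
        rw [hcos, heq, ← hre v] at h1
        linarith
      · have h1 := him u
        rw [hsin, heq, ← him v] at h1
        linarith
    · exact Or.inr (key v u hu hv hcos.symm hsin.symm hlt)

namespace IsAngle

variable {r u v z : ℝ × ℝ} {θ : ℝ × ℝ → ℝ}

theorem cross_pos (h : IsAngle r θ) (hu : u ≠ r) (hv : v ≠ r) (huv : θ u < θ v)
    (hπ : θ v - θ u < Real.pi) : 0 < cross r u v := by
  obtain ⟨k, hk, e⟩ := h.cross_eq u v hu hv
  rw [e]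
  exact mul_pos hk (Real.sin_pos_of_pos_of_lt_pi (by linarith) hπ)

theorem cross_neg (h : IsAngle r θ) (hu : u ≠ r) (hv : v ≠ r) (hπ : Real.pi < θ v - θ u) :
    cross r u v < 0 := by
  obtain ⟨k, hk, e⟩ := h.cross_eq u v hu hv
  have h1 := h.lt v
  have h2 := h.nonneg u
  have := Real.sin_pos_of_pos_of_lt_pi (x := θ v - θ u - Real.pi) (by linarith) (by linarith)
  rw [Real.sin_sub_pi] at this
  rw [e]
  nlinarith

theorem cross_zero (h : IsAngle r θ) (hu : u ≠ r) (hv : v ≠ r) (hπ : θ v - θ u = Real.pi) :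
    cross r u v = 0 := by
  obtain ⟨k, hk, e⟩ := h.cross_eq u v hu hv
  rw [e, hπ, Real.sin_pi, mul_zero]

theorem lt_pi_iff (h : IsAngle r θ) (hu : u ≠ r) (hv : v ≠ r) (huv : θ u < θ v) :
    θ v - θ u < Real.pi ↔ 0 < cross r u v := by
  refine ⟨h.cross_pos hu hv huv, fun hc => ?_⟩
  rcases lt_trichotomy (θ v - θ u) Real.pi with hlt | heq | hlt
  · exact hlt
  · exact absurd (h.cross_zero hu hv heq) hc.ne'
  · exact absurd (h.cross_neg hu hv hlt) hc.not_gt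

theorem pi_lt_iff (h : IsAngle r θ) (hu : u ≠ r) (hv : v ≠ r) (huv : θ u < θ v) :
    Real.pi < θ v - θ u ↔ cross r u v < 0 := by
  refine ⟨h.cross_neg hu hv, fun hc => ?_⟩
  rcases lt_trichotomy (θ v - θ u) Real.pi with hlt | heq | hlt
  · exact absurd (h.cross_pos hu hv huv hlt) hc.not_gt
  · exact absurd (h.cross_zero hu hv heq) hc.ne
  · exact hlt

theorem cross_nonneg (h : IsAngle r θ) (hu : u ≠ r) (hv : v ≠ r) (huv : θ u ≤ θ v)
    (hπ : θ v - θ u ≤ Real.pi) : 0 ≤ cross r u v := by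
  obtain ⟨k, hk, e⟩ := h.cross_eq u v hu hv
  rw [e]
  exact mul_nonneg hk.le (Real.sin_nonneg_of_nonneg_of_le_pi (by linarith) hπ)

theorem pi_le (h : IsAngle r θ) (hu : u ≠ r) (hv : v ≠ r) (huv : θ u < θ v)
    (hc : cross r u v ≤ 0) : Real.pi ≤ θ v - θ u := by
  by_contra! hlt
  exact absurd (h.cross_pos hu hv huv hlt) hc.not_gt

/-- The angular order of two points and a blocker of them. -/
theorem of_blocks (h : IsAngle r θ) (hu : u ≠ r) (hv : v ≠ r) (hz : z ≠ r) (huv : θ u < θ v)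
    (huz : θ u ≠ θ z) (hvz : θ v ≠ θ z) (hb : Blocks z u v) (hc : cross r u v ≠ 0) :
    (θ v - θ u < Real.pi ∧ θ u < θ z ∧ θ z < θ v) ∨
      (Real.pi < θ v - θ u ∧ (θ z < θ u ∨ θ v < θ z)) := by
  rcases hc.lt_or_gt with hc | hc
  · refine Or.inr ⟨(h.pi_lt_iff hu hv huv).2 hc, ?_⟩
    by_contra! hn
    have h1 : cross r u z < 0 := hb.cross_neg' (cross_self_right r u).le hc
    have h2 : cross r v z > 0 := hb.cross_pos (by rw [cross_swap_right]; linarith)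
      (cross_self_right r v).ge
    have h3 := (h.pi_lt_iff hu hz (lt_of_le_of_ne hn.1 huz)).2 h1
    have h4 := (h.pi_lt_iff hz hv (lt_of_le_of_ne hn.2 hvz.symm)).2 (by
      rw [cross_swap_right]; linarith)
    linarith [h.lt v, h.nonneg u]
  · have h0 := (h.lt_pi_iff hu hv huv).2 hc
    have h1 : 0 < cross r u z := hb.cross_pos' (cross_self_right r u).ge hc
    have h2 : cross r v z < 0 := hb.cross_neg (by rw [cross_swap_right]; linarith)
      (cross_self_right r v).le
    refine Or.inl ⟨h0, ?_, ?_⟩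
    · by_contra! hn
      have h3 := (h.pi_lt_iff hz hu (lt_of_le_of_ne hn huz.symm)).2 (by
        rw [cross_swap_right]; linarith)
      linarith [(h.lt_pi_iff hz hv (hn.trans_lt huv)).2 (by rw [cross_swap_right]; linarith)]
    · by_contra! hn
      have h3 := (h.pi_lt_iff hv hz (lt_of_le_of_ne hn hvz)).2 h2
      linarith [(h.lt_pi_iff hu hz (huv.trans_le hn)).2 h1]

end IsAngle

/-- The points of `S` other than `r` in the convex angle from `u` to `v` at `r`. -/
def sector (S : Set (ℝ × ℝ)) (r u v : ℝ × ℝ) : Set (ℝ × ℝ) :=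
  {x | x ∈ S ∧ x ≠ r ∧ 0 ≤ cross r u x ∧ 0 ≤ cross r x v}

/-- Every colour other than that of `r` occurs once or twice in the angle from `u` to `v`. -/
def BalancedSector (S : Set (ℝ × ℝ)) (c : ℝ × ℝ → Fin 4) (r u v : ℝ × ℝ) : Prop :=
  ∀ γ ≠ c r, (sector S r u v ∩ c ⁻¹' {γ}).Nonempty ∧ (sector S r u v ∩ c ⁻¹' {γ}).ncard ≤ 2

/-- The situation inside a triangle whose vertices and inner point `r` form a colour class: the
points `pᵢ` block `r` from the vertices and the points `qᵢ` lie on the sides. -/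
structure BlockedStar (S : Set (ℝ × ℝ)) (c : ℝ × ℝ → Fin 4) (r p₁ p₂ p₃ q₁ q₂ q₃ : ℝ × ℝ) : Prop where
  blocked : FourBlocked S c
  mem_r : r ∈ S
  unique : ∀ x ∈ S, c x = c r → x = r
  mp₁ : p₁ ∈ S
  mp₂ : p₂ ∈ S
  mp₃ : p₃ ∈ S
  mq₁ : q₁ ∈ S
  mq₂ : q₂ ∈ S
  mq₃ : q₃ ∈ S
  p₁₂ : 0 < cross r p₁ p₂
  p₂₃ : 0 < cross r p₂ p₃
  p₃₁ : 0 < cross r p₃ p₁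
  p₁q₃ : 0 < cross r p₁ q₃
  q₃p₂ : 0 < cross r q₃ p₂
  p₂q₁ : 0 < cross r p₂ q₁
  q₁p₃ : 0 < cross r q₁ p₃
  p₃q₂ : 0 < cross r p₃ q₂
  q₂p₁ : 0 < cross r q₂ p₁
  q_block : ∀ z, z = q₁ ∨ z = q₂ ∨ z = q₃ → ∀ u ∈ S, ∀ v ∈ S, u ≠ v → ¬ Blocks z u v
  r_block : ∀ p, p = p₁ ∨ p = p₂ ∨ p = p₃ → ∀ v ∈ S, ¬ Blocks r p v
  class_le : ∀ i, (S ∩ c ⁻¹' {i}).ncard ≤ 3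
  triple : ∀ x ∈ S, ∀ y ∈ S, ∀ z ∈ S, x ≠ y → x ≠ z → y ≠ z → c x = c y → c y = c z →
    (0 ≤ cross r x y ∧ 0 ≤ cross r y z ∧ 0 ≤ cross r z x) ∨
      (cross r x y ≤ 0 ∧ cross r y z ≤ 0 ∧ cross r z x ≤ 0)
  balanced₁ : BalancedSector S c r p₁ p₂
  balanced₂ : BalancedSector S c r p₂ p₃
  balanced₃ : BalancedSector S c r p₃ p₁

theorem exists_sorted {α : Type*} (N : Finset α) (θ : α → ℝ) (hθ : Set.InjOn θ N) (r : α) :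
    ∃ g : ℕ → α, (∀ k < N.card, g k ∈ N) ∧
      (∀ i j, i < j → j < N.card → θ (g i) < θ (g j)) ∧ (∀ x ∈ N, ∃ k < N.card, g k = x) ∧
      g N.card = r := by
  classical
  have hcard : (N.image θ).card = N.card := Finset.card_image_of_injOn hθ
  let e := (N.image θ).orderEmbOfFin hcard
  have he : ∀ i, ∃ x ∈ N, θ x = e i := fun i =>
    Finset.mem_image.1 ((N.image θ).orderEmbOfFin_mem hcard i)
  choose f hf hfe using he
  refine ⟨fun k => if h : k < N.card then f ⟨k, h⟩ else r, fun k hk => ?_, fun i j hij hj => ?_,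
    fun x hx => ?_, ?_⟩
  · dsimp only
    rw [dif_pos hk]
    exact hf _
  · dsimp only
    rw [dif_pos (hij.trans hj), dif_pos hj, hfe, hfe]
    exact e.strictMono hij
  · have hx' : θ x ∈ Set.range e := by
      rw [Finset.range_orderEmbOfFin]
      exact Finset.mem_coe.2 (Finset.mem_image_of_mem θ hx)
    obtain ⟨i, hi⟩ := hx'
    refine ⟨i, i.2, ?_⟩
    dsimp only
    rw [dif_pos i.2]
    exact hθ (hf i) hx (by rw [hfe, hi])
  · dsimp only
    rw [dif_neg (lt_irrefl _)]

/-- The points of `S` other than `r` are `g 0, …, g (n - 1)`, by increasing angle, and `g n` is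
`r`. -/
structure AngularOrder (S : Set (ℝ × ℝ)) (r : ℝ × ℝ) (θ : ℝ × ℝ → ℝ) (g : ℕ → ℝ × ℝ) (n : ℕ) :
    Prop where
  angle : IsAngle r θ
  mem : ∀ k < n, g k ∈ S
  ne : ∀ k < n, g k ≠ r
  mono : ∀ i j, i < j → j < n → θ (g i) < θ (g j)
  surj : ∀ x ∈ S, x ≠ r → ∃ k < n, g k = x
  centre : g n = r
  ncard : S.ncard = n + 1

namespace AngularOrder

variable {S : Set (ℝ × ℝ)} {r : ℝ × ℝ} {θ : ℝ × ℝ → ℝ} {g : ℕ → ℝ × ℝ} {n : ℕ}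

theorem lt_of (N : AngularOrder S r θ g n) {i j : ℕ} (hi : i < n) (h : θ (g i) < θ (g j)) :
    i < j := by
  by_contra! hn
  rcases hn.eq_or_lt with rfl | hn
  · exact h.false
  · exact (h.trans (N.mono j i hn hi)).false

theorem inj (N : AngularOrder S r θ g n) {i j : ℕ} (hi : i < n) (hj : j < n) (h : g i = g j) :
    i = j := by
  rcases lt_trichotomy i j with hlt | heq | hlt
  · exact absurd (h ▸ N.mono i j hlt hj) (lt_irrefl _)
  · exact heq
  · exact absurd (h ▸ N.mono j i hlt hi) (lt_irrefl _)

theorem inj_le (N : AngularOrder S r θ g n) {i j : ℕ} (hi : i ≤ n) (hj : j ≤ n) (h : g i = g j) :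
    i = j := by
  rcases hi.lt_or_eq with hi | rfl <;> rcases hj.lt_or_eq with hj | rfl
  · exact N.inj hi hj h
  · exact absurd (h.trans N.centre) (N.ne i hi)
  · exact absurd (h.symm.trans N.centre) (N.ne j hj)
  · rfl

theorem countP_le (N : AngularOrder S r θ g n) {c : ℝ × ℝ → Fin 4} {A : Set (ℝ × ℝ)} (hA : A.Finite)
    {s : List ℕ} (hs : s.Nodup) (hn : ∀ k ∈ s, k < n ∧ g k ∈ A) (e : Fin 4) {q : ℕ → Prop}
    [DecidablePred q] (hq : ∀ k < n, q k → c (g k) = e) :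
    s.countP (fun k => q k) ≤ (A ∩ c ⁻¹' {e}).ncard := by
  classical
  rw [List.countP_eq_length_filter, ← List.toFinset_card_of_nodup (hs.filter _),
    ← Set.ncard_coe_finset]
  refine Set.ncard_le_ncard_of_injOn g ?_ ?_ (hA.subset Set.inter_subset_left)
  · intro k hk
    simp only [List.coe_toFinset, List.mem_filter, decide_eq_true_eq, Set.mem_ofPred_eq] at hk
    exact ⟨(hn k hk.1).2, hq k (hn k hk.1).1 hk.2⟩
  · intro i hi j hj hij
    simp only [List.coe_toFinset, List.mem_filter, Set.mem_ofPred_eq] at hi hj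
    exact N.inj (hn i hi.1).1 (hn j hj.1).1 hij

theorem countP_pos (N : AngularOrder S r θ g n) {c : ℝ × ℝ → Fin 4} {A : Set (ℝ × ℝ)} (hA : A ⊆ S)
    (hr : ∀ x ∈ A, x ≠ r)
    {s : List ℕ} (hn : ∀ k < n, g k ∈ A → k ∈ s) {e : Fin 4} {q : ℕ → Prop}
    [DecidablePred q] (hq : ∀ k < n, c (g k) = e → q k) (hne : (A ∩ c ⁻¹' {e}).Nonempty) :
    0 < s.countP (fun k => q k) := by
  obtain ⟨x, hx, hxe⟩ := hne
  obtain ⟨k, hk, rfl⟩ := N.surj x (hA hx) (hr x hx)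
  exact List.countP_pos_iff.2 ⟨k, hn k hk hx, decide_eq_true (hq k hk hxe)⟩

end AngularOrder

/-- The number of a colour when the colours `x` and `y` get the numbers `0` and `1`. -/
def letter (x y v : Fin 4) : ℕ :=
  if v = x then 0 else if v = y then 1 else 2

theorem letter_lt (x y v : Fin 4) : letter x y v < 3 := by
  unfold letter
  split_ifs <;> omega

theorem letter_iff {ρ x y : Fin 4} (hx : x ≠ ρ) (hy : y ≠ ρ) (hxy : x ≠ y) {γ : ℕ} (hγ : γ < 3) :
    ∃ e ≠ ρ, ∀ v ≠ ρ, letter x y v = γ ↔ v = e := by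
  have H : ∀ ρ x y : Fin 4, x ≠ ρ → y ≠ ρ → x ≠ y → ∀ γ < 3, ∃ e, e ≠ ρ ∧ ∀ v, v ≠ ρ →
      (letter x y v = γ ↔ v = e) := by
    unfold letter
    decide
  exact H ρ x y hx hy hxy γ hγ

theorem letter_eq_iff {ρ x y u v : Fin 4} (hx : x ≠ ρ) (hy : y ≠ ρ) (hxy : x ≠ y) (hu : u ≠ ρ)
    (hv : v ≠ ρ) : letter x y u = letter x y v ↔ u = v := by
  obtain ⟨e, -, he⟩ := letter_iff hx hy hxy (letter_lt x y v)
  rw [he u hu, ← (he v hv).1 rfl]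

/-- A blocked star together with a numbering of its points by increasing angle. -/
structure NumberedStar (S : Set (ℝ × ℝ)) (c : ℝ × ℝ → Fin 4) (r p₁ p₂ p₃ q₁ q₂ q₃ : ℝ × ℝ)
    (θ : ℝ × ℝ → ℝ) (g : ℕ → ℝ × ℝ) (n a b i₁ i₂ i₃ : ℕ) : Prop
    extends BlockedStar S c r p₁ p₂ p₃ q₁ q₂ q₃, AngularOrder S r θ g n where
  zero : g 0 = p₁
  ga : g a = p₂
  gb : g b = p₃
  g₁ : g i₁ = q₁
  g₂ : g i₂ = q₂
  g₃ : g i₃ = q₃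
  a_lt : a < n
  b_lt : b < n
  i₁_lt : i₁ < n
  i₂_lt : i₂ < n
  i₃_lt : i₃ < n
  angle_zero : θ (g 0) = 0

namespace BlockedStar

variable {S : Set (ℝ × ℝ)} {c : ℝ × ℝ → Fin 4} {r p₁ p₂ p₃ q₁ q₂ q₃ : ℝ × ℝ}

theorem angle_inj (s : BlockedStar S c r p₁ p₂ p₃ q₁ q₂ q₃) {θ : ℝ × ℝ → ℝ} (h : IsAngle r θ)
    {u v : ℝ × ℝ} (hu : u ∈ S) (hv : v ∈ S) (hur : u ≠ r) (hvr : v ≠ r) (huv : θ u = θ v) :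
    u = v := by
  by_contra hne
  rcases h.ray u v hur hvr hne huv with hb | hb
  · exact hvr (s.unique v hv (s.blocked.colour_eq hu s.mem_r hv hb).symm)
  · exact hur (s.unique u hu (s.blocked.colour_eq hv s.mem_r hu hb).symm)

theorem exists_numberedStar (s : BlockedStar S c r p₁ p₂ p₃ q₁ q₂ q₃) :
    ∃ θ g n a b i₁ i₂ i₃, NumberedStar S c r p₁ p₂ p₃ q₁ q₂ q₃ θ g n a b i₁ i₂ i₃ := by
  classical
  obtain ⟨θ, hθ, hA⟩ := exists_isAngle r p₁
  let N := s.blocked.finite.toFinset.erase r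
  have hN : ∀ x, x ∈ N ↔ x ≠ r ∧ x ∈ S := by simp [N]
  obtain ⟨g, hg, hmono, hsurj, hr⟩ := exists_sorted N θ (fun u hu v hv huv =>
    s.angle_inj hA ((hN u).1 hu).2 ((hN v).1 hv).2 ((hN u).1 hu).1 ((hN v).1 hv).1 huv) r
  have O : AngularOrder S r θ g N.card := {
    angle := hA
    mem := fun k hk => ((hN _).1 (hg k hk)).2
    ne := fun k hk => ((hN _).1 (hg k hk)).1
    mono := hmono
    surj := fun x hx hxr => hsurj x ((hN x).2 ⟨hxr, hx⟩)
    centre := hr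
    ncard := by
      rw [Finset.card_erase_add_one (by simpa using s.mem_r),
        ← Set.ncard_eq_toFinset_card S s.blocked.finite] }
  obtain ⟨h1, -, -⟩ := ne_of_cross_ne_zero s.p₁₂.ne'
  obtain ⟨h2, h3, -⟩ := ne_of_cross_ne_zero s.p₂₃.ne'
  obtain ⟨-, h4, -⟩ := ne_of_cross_ne_zero s.p₁q₃.ne'
  obtain ⟨-, h5, -⟩ := ne_of_cross_ne_zero s.p₂q₁.ne'
  obtain ⟨-, h6, -⟩ := ne_of_cross_ne_zero s.p₃q₂.ne'
  obtain ⟨k, hk, hk'⟩ := O.surj p₁ s.mp₁ h1.symm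
  obtain ⟨a, ha, ha'⟩ := O.surj p₂ s.mp₂ h2.symm
  obtain ⟨b, hb, hb'⟩ := O.surj p₃ s.mp₃ h3.symm
  obtain ⟨i₁, h₁, h₁'⟩ := O.surj q₁ s.mq₁ h5.symm
  obtain ⟨i₂, h₂, h₂'⟩ := O.surj q₂ s.mq₂ h6.symm
  obtain ⟨i₃, h₃, h₃'⟩ := O.surj q₃ s.mq₃ h4.symm
  have hk0 : k = 0 := by
    by_contra hne
    have := O.mono 0 k (Nat.pos_of_ne_zero hne) hk
    rw [hk', hθ] at this
    exact this.not_ge (hA.nonneg _)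
  subst hk0
  exact ⟨θ, g, _, a, b, i₁, i₂, i₃, { s, O with
    zero := hk', ga := ha', gb := hb', g₁ := h₁', g₂ := h₂', g₃ := h₃', a_lt := ha, b_lt := hb,
    i₁_lt := h₁, i₂_lt := h₂, i₃_lt := h₃, angle_zero := by rw [hk', hθ] }⟩

end BlockedStar

namespace NumberedStar

variable {S : Set (ℝ × ℝ)} {c : ℝ × ℝ → Fin 4} {r p₁ p₂ p₃ q₁ q₂ q₃ : ℝ × ℝ} {θ : ℝ × ℝ → ℝ}
  {g : ℕ → ℝ × ℝ} {n a b i₁ i₂ i₃ : ℕ}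

theorem angles (s : NumberedStar S c r p₁ p₂ p₃ q₁ q₂ q₃ θ g n a b i₁ i₂ i₃) :
    (0 < i₃ ∧ i₃ < a ∧ a < i₁ ∧ i₁ < b ∧ b < i₂) ∧ θ (g a) < Real.pi ∧
      θ (g b) - θ (g a) < Real.pi ∧ Real.pi < θ (g b) := by
  have h0 := s.angle_zero
  have e₁ : g 0 ≠ r := s.ne 0 (by have := s.a_lt; omega)
  have e₂ := s.ne a s.a_lt
  have e₃ := s.ne b s.b_lt
  have f₁ := s.ne i₁ s.i₁_lt
  have f₂ := s.ne i₂ s.i₂_lt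
  have f₃ := s.ne i₃ s.i₃_lt
  have c₁₂ := s.p₁₂
  have c₂₃ := s.p₂₃
  have c₃₁ := s.p₃₁
  have d₁ := s.p₁q₃
  have d₂ := s.q₃p₂
  have d₃ := s.p₂q₁
  have d₄ := s.q₁p₃
  have d₅ := s.p₃q₂
  have d₆ := s.q₂p₁
  rw [← s.zero, ← s.ga] at c₁₂
  rw [← s.ga, ← s.gb] at c₂₃
  rw [← s.gb, ← s.zero] at c₃₁
  rw [← s.zero, ← s.g₃] at d₁
  rw [← s.g₃, ← s.ga] at d₂
  rw [← s.ga, ← s.g₁] at d₃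
  rw [← s.g₁, ← s.gb] at d₄
  rw [← s.gb, ← s.g₂] at d₅
  rw [← s.g₂, ← s.zero] at d₆
  have hpos : ∀ k, 0 < k → k < n → 0 < θ (g k) := fun k hk hkn => by
    rw [← h0]; exact s.mono 0 k hk hkn
  have pos : ∀ k, 0 < cross r (g 0) (g k) → 0 < k := by
    intro k hk
    by_contra hn
    rw [Nat.eq_zero_of_not_pos hn, cross_self_right] at hk
    exact hk.false
  have pos' : ∀ k, 0 < cross r (g k) (g 0) → 0 < k := by
    intro k hk
    by_contra hn
    rw [Nat.eq_zero_of_not_pos hn, cross_self_right] at hk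
    exact hk.false
  have hlt : ∀ k, k < n → 0 < cross r (g 0) (g k) → θ (g k) < Real.pi := by
    intro k hk hc
    have h1 := s.angle.lt_pi_iff e₁ (s.ne k hk) (s.mono 0 k (pos k hc) hk)
    have := h1.2 hc
    linarith
  have hgt : ∀ k, k < n → 0 < cross r (g k) (g 0) → Real.pi < θ (g k) := by
    intro k hk hc
    have h1 := s.angle.pi_lt_iff e₁ (s.ne k hk) (s.mono 0 k (pos' k hc) hk)
    have := h1.2 (by rw [cross_swap_right]; linarith)
    linarith
  have ord : ∀ i j, i < n → j < n → 0 < cross r (g i) (g j) →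
      i < j ∧ θ (g j) - θ (g i) < Real.pi ∨ j < i ∧ Real.pi < θ (g i) - θ (g j) := by
    intro i j hi hj hc
    rcases lt_trichotomy i j with h | rfl | h
    · exact Or.inl ⟨h, (s.angle.lt_pi_iff (s.ne i hi) (s.ne j hj) (s.mono i j h hj)).2 hc⟩
    · rw [cross_self_right] at hc
      exact absurd hc (lt_irrefl _)
    · exact Or.inr ⟨h, (s.angle.pi_lt_iff (s.ne j hj) (s.ne i hi) (s.mono j i h hi)).2 (by
        rw [cross_swap_right]; linarith)⟩
  have ha := hlt a s.a_lt c₁₂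
  have hb := hgt b s.b_lt c₃₁
  have h3 := hlt i₃ s.i₃_lt d₁
  have h2 := hgt i₂ s.i₂_lt d₆
  have nn := s.angle.nonneg
  have l2 := s.angle.lt
  refine ⟨⟨pos _ d₁, ?_, ?_, ?_, ?_⟩, ha, ?_, hb⟩
  · rcases ord _ _ s.i₃_lt s.a_lt d₂ with h | h
    · exact h.1
    · linarith [nn (g a)]
  · rcases ord _ _ s.a_lt s.i₁_lt d₃ with h | h
    · exact h.1
    · linarith [nn (g i₁)]
  · rcases ord _ _ s.i₁_lt s.b_lt d₄ with h | h
    · exact h.1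
    · linarith [l2 (g i₁)]
  · rcases ord _ _ s.b_lt s.i₂_lt d₅ with h | h
    · exact h.1
    · linarith [l2 (g b)]
  · rcases ord _ _ s.a_lt s.b_lt c₂₃ with h | h
    · exact h.2
    · linarith [nn (g b)]

theorem colour_ne (s : NumberedStar S c r p₁ p₂ p₃ q₁ q₂ q₃ θ g n a b i₁ i₂ i₃) {k : ℕ}
    (hk : k < n) : c (g k) ≠ c r :=
  fun h => s.ne k hk (s.unique _ (s.mem k hk) h)

theorem ne_of_lt (s : NumberedStar S c r p₁ p₂ p₃ q₁ q₂ q₃ θ g n a b i₁ i₂ i₃) {i j : ℕ}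
    (hij : i < j) (hj : j < n) : g i ≠ g j :=
  fun h => hij.ne (s.inj (hij.trans hj) hj h)

theorem exists_index (s : NumberedStar S c r p₁ p₂ p₃ q₁ q₂ q₃ θ g n a b i₁ i₂ i₃) {x : ℝ × ℝ}
    (hx : x ∈ S) : ∃ z ≤ n, g z = x := by
  by_cases hxr : x = r
  · exact ⟨n, le_rfl, hxr ▸ s.centre⟩
  · obtain ⟨z, hz, h⟩ := s.surj x hx hxr
    exact ⟨z, hz.le, h⟩

theorem mem_le (s : NumberedStar S c r p₁ p₂ p₃ q₁ q₂ q₃ θ g n a b i₁ i₂ i₃) {z : ℕ}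
    (hz : z ≤ n) : g z ∈ S := by
  rcases hz.lt_or_eq with hz | rfl
  · exact s.mem z hz
  · rw [s.centre]; exact s.mem_r

theorem centre_blocks (s : NumberedStar S c r p₁ p₂ p₃ q₁ q₂ q₃ θ g n a b i₁ i₂ i₃) {i j : ℕ}
    (hij : i < j) (hj : j < n) (hb : Blocks (g n) (g i) (g j)) :
    θ (g j) - θ (g i) = Real.pi ∧ i ∉ [0, a, b] ∧ j ∉ [0, a, b] := by
  have hi := hij.trans hj
  rw [s.centre] at hb
  have h0 : cross r (g i) (g j) = 0 := by rw [cross_rotate]; exact hb.cross_zero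
  have key : ∀ k, k ∈ [0, a, b] → ∀ v ∈ S, ¬ Blocks r (g k) v := by
    intro k hk
    simp only [List.mem_cons, List.not_mem_nil, or_false] at hk
    refine s.r_block _ ?_
    rcases hk with rfl | rfl | rfl
    exacts [Or.inl s.zero, Or.inr (Or.inl s.ga), Or.inr (Or.inr s.gb)]
  refine ⟨?_, fun h => key i h _ (s.mem j hj) hb, fun h => key j h _ (s.mem i hi) hb.symm⟩
  rcases lt_trichotomy (θ (g j) - θ (g i)) Real.pi with h | h | h
  · exact absurd h0 (s.angle.cross_pos (s.ne i hi) (s.ne j hj) (s.mono i j hij hj) h).ne'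
  · exact h
  · exact absurd h0 (s.angle.cross_neg (s.ne i hi) (s.ne j hj) h).ne

theorem blocks_angles (s : NumberedStar S c r p₁ p₂ p₃ q₁ q₂ q₃ θ g n a b i₁ i₂ i₃) {i j z : ℕ}
    (hij : i < j) (hj : j < n) (hz : z < n) (hb : Blocks (g z) (g i) (g j)) :
    θ (g j) - θ (g i) < Real.pi ∧ i < z ∧ z < j ∨
      Real.pi < θ (g j) - θ (g i) ∧ (z < i ∨ j < z) := by
  have hi := hij.trans hj
  have hne := s.ne_of_lt hij hj
  have h1 := s.angle_inj s.angle (s.mem i hi) (s.mem z hz) (s.ne i hi) (s.ne z hz)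
  have h2 := s.angle_inj s.angle (s.mem j hj) (s.mem z hz) (s.ne j hj) (s.ne z hz)
  have h0 : cross r (g i) (g j) ≠ 0 := fun h0 => by
    rw [cross_rotate] at h0
    rcases s.blocked.mem_line (s.mem i hi) (s.mem j hj) (s.mem z hz) hne hb (Or.inl rfl)
      (Or.inr (Or.inl rfl)) hne s.mem_r h0 with h | h | h
    exacts [s.ne i hi h.symm, s.ne j hj h.symm, s.ne z hz h.symm]
  rcases s.angle.of_blocks (s.ne i hi) (s.ne j hj) (s.ne z hz) (s.mono i j hij hj)
    (fun h => (hb.ne_left hne).symm (h1 h)) (fun h => (hb.ne_right hne).symm (h2 h)) hb h0 with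
    ⟨h, h3, h4⟩ | ⟨h, h3 | h3⟩
  · exact Or.inl ⟨h, s.lt_of hi h3, s.lt_of hz h4⟩
  · exact Or.inr ⟨h, Or.inl (s.lt_of hz h3)⟩
  · exact Or.inr ⟨h, Or.inr (s.lt_of hj h3)⟩

theorem triple_angles (s : NumberedStar S c r p₁ p₂ p₃ q₁ q₂ q₃ θ g n a b i₁ i₂ i₃) {i j k : ℕ}
    (hij : i < j) (hjk : j < k) (hk : k < n) (h₁ : c (g i) = c (g j)) (h₂ : c (g j) = c (g k)) :
    θ (g j) - θ (g i) ≤ Real.pi ∧ θ (g k) - θ (g j) ≤ Real.pi ∧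
      Real.pi ≤ θ (g k) - θ (g i) := by
  have hj := hjk.trans hk
  have hi := hij.trans hj
  have m₁ := s.mono i j hij hj
  have m₂ := s.mono j k hjk hk
  have nonneg : ∀ {i j}, i < j → j < n → 0 ≤ cross r (g i) (g j) →
      θ (g j) - θ (g i) ≤ Real.pi := by
    intro i j hij hj h
    by_contra! hlt
    exact h.not_gt (s.angle.cross_neg (s.ne i (hij.trans hj)) (s.ne j hj) hlt)
  have nonpos : ∀ {i j}, i < j → j < n → cross r (g i) (g j) ≤ 0 →
      Real.pi ≤ θ (g j) - θ (g i) := fun hij hj h =>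
    s.angle.pi_le (s.ne _ (hij.trans hj)) (s.ne _ hj) (s.mono _ _ hij hj) h
  rcases s.triple _ (s.mem i hi) _ (s.mem j hj) _ (s.mem k hk) (s.ne_of_lt hij hj)
    (s.ne_of_lt (hij.trans hjk) hk) (s.ne_of_lt hjk hk) h₁ h₂ with ⟨h, h', h''⟩ | ⟨h, h', -⟩
  · exact ⟨nonneg hij hj h, nonneg hjk hk h',
      nonpos (hij.trans hjk) hk (by rw [cross_swap_right]; linarith)⟩
  · have := nonpos hij hj h
    have := nonpos hjk hk h'
    linarith [s.angle.lt (g k), s.angle.nonneg (g i)]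

theorem lineOk (s : NumberedStar S c r p₁ p₂ p₃ q₁ q₂ q₃ θ g n a b i₁ i₂ i₃) {i j z i' j' z' : ℕ}
    (hij : i < j) (hj : j < n) (hz : z ≤ n) (hb : Blocks (g z) (g i) (g j)) (hij' : i' < j')
    (hj' : j' < n) (hz' : z' ≤ n) (hb' : Blocks (g z') (g i') (g j')) :
    CyclicWord.LineOk (i, j, z) (i', j', z') := by
  have hi := hij.trans hj
  have hi' := hij'.trans hj'
  intro x hx hx' y hy hxy hy' t ht
  simp only [CyclicWord.points, List.mem_cons, List.not_mem_nil, or_false] at hx hx' hy hy' ht ⊢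
  have hle : ∀ {i j z x : ℕ}, i < j → j < n → z ≤ n → x = i ∨ x = j ∨ x = z → x ≤ n := by
    omega
  have hxn := hle hij hj hz hx
  have hyn := hle hij hj hz hy
  have htn := hle hij' hj' hz' ht
  have hne := s.ne_of_lt hij' hj'
  by_cases htx : t = x
  · rwa [htx]
  by_cases hty : t = y
  · rwa [hty]
  have hg : ∀ {i j z x : ℕ}, x = i ∨ x = j ∨ x = z → g x = g i ∨ g x = g j ∨ g x = g z := by
    rintro i j z x (rfl | rfl | rfl) <;> simp
  have h0 : cross (g x) (g y) (g t) = 0 := by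
    have e1 := hb'.cross_zero
    have e2 : cross (g j') (g i') (g z') = 0 := by rw [cross_swap, e1, neg_zero]
    have e3 : cross (g i') (g z') (g j') = 0 := by rw [cross_swap_right, e1, neg_zero]
    have e4 : cross (g j') (g z') (g i') = 0 := by rw [cross_swap_right, e2, neg_zero]
    have e5 : cross (g z') (g i') (g j') = 0 := by rw [cross_rotate, e1]
    have e6 : cross (g z') (g j') (g i') = 0 := by rw [cross_rotate, e2]
    rcases hx' with rfl | rfl | rfl <;> rcases hy' with rfl | rfl | rfl <;>
      rcases ht with rfl | rfl | rfl <;> first | assumption | exact absurd rfl ‹_›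
  have := s.blocked.mem_line (s.mem i hi) (s.mem j hj) (s.mem_le hz) (s.ne_of_lt hij hj) hb
    (hg hx) (hg hy) (fun h => hxy (s.inj_le hxn hyn h)) (s.mem_le htn) h0
  rcases this with h | h | h
  · exact Or.inl (s.inj_le htn hi.le h)
  · exact Or.inr (Or.inl (s.inj_le htn hj.le h))
  · exact Or.inr (Or.inr (s.inj_le htn hz h))

end NumberedStar

namespace NumberedStar

variable {S : Set (ℝ × ℝ)} {c : ℝ × ℝ → Fin 4} {r p₁ p₂ p₃ q₁ q₂ q₃ : ℝ × ℝ} {θ : ℝ × ℝ → ℝ}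
  {g : ℕ → ℝ × ℝ} {n a b i₁ i₂ i₃ : ℕ}

theorem colour_zero_ne_one (s : NumberedStar S c r p₁ p₂ p₃ q₁ q₂ q₃ θ g n a b i₁ i₂ i₃) :
    c (g 0) ≠ c (g 1) := by
  obtain ⟨⟨h1, h2, -, -, -⟩, ha, -, -⟩ := s.angles
  have hn : 1 < n := by have := s.a_lt; omega
  have hne := s.ne_of_lt zero_lt_one hn
  intro hc
  obtain ⟨x, hx, hb⟩ := s.blocked.exists_blocker (s.mem 0 (by omega)) (s.mem 1 hn) hne hc
  obtain ⟨z, hz, rfl⟩ := s.exists_index hx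
  have hπ : θ (g 1) - θ (g 0) < Real.pi := by
    have := s.angle.nonneg (g 0)
    have := s.mono 1 a (by omega) s.a_lt
    linarith
  rcases hz.lt_or_eq with hz | rfl
  · rcases s.blocks_angles zero_lt_one hn hz hb with h | h
    · omega
    · linarith
  · linarith [(s.centre_blocks zero_lt_one hn hb).1]

theorem sector₁_iff (s : NumberedStar S c r p₁ p₂ p₃ q₁ q₂ q₃ θ g n a b i₁ i₂ i₃) {k : ℕ}
    (hk : k < n) : g k ∈ sector S r p₁ p₂ ↔ k ≤ a := by
  obtain ⟨-, ha, -, -⟩ := s.angles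
  have h0 := s.angle_zero
  have h0n : 0 < n := by omega
  have hk0 : 0 < k → θ (g 0) < θ (g k) := fun h => s.mono 0 k h hk
  have hk0' : θ (g 0) ≤ θ (g k) := h0 ▸ s.angle.nonneg _
  rw [← s.zero, ← s.ga]
  constructor
  · rintro ⟨-, -, h1, h2⟩
    by_contra! hak
    have e2 := s.mono a k hak hk
    have := s.angle.nonneg (g a)
    have e4 := s.angle.pi_le (s.ne a s.a_lt) (s.ne k hk) e2 (by rw [cross_swap_right]; linarith)
    have e5 : 0 < θ (g a) := by
      obtain ⟨⟨h3, h4, -⟩, -⟩ := s.angles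
      linarith [s.mono 0 a (by omega) s.a_lt]
    have : Real.pi < θ (g k) - θ (g 0) := by linarith
    linarith [s.angle.cross_neg (s.ne 0 h0n) (s.ne k hk) this]
  · intro hka
    have e2 : θ (g k) ≤ θ (g a) := by
      rcases hka.lt_or_eq with h | rfl
      exacts [(s.mono k a h s.a_lt).le, le_rfl]
    exact ⟨s.mem k hk, s.ne k hk, s.angle.cross_nonneg (s.ne 0 h0n) (s.ne k hk) hk0' (by linarith),
      s.angle.cross_nonneg (s.ne k hk) (s.ne a s.a_lt) e2 (by linarith)⟩

theorem sector₂_iff (s : NumberedStar S c r p₁ p₂ p₃ q₁ q₂ q₃ θ g n a b i₁ i₂ i₃) {k : ℕ}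
    (hk : k < n) : g k ∈ sector S r p₂ p₃ ↔ a ≤ k ∧ k ≤ b := by
  obtain ⟨⟨-, -, h5, h6, -⟩, ha, hab, hb⟩ := s.angles
  have hlt := s.mono a b (by omega) s.b_lt
  rw [← s.ga, ← s.gb]
  constructor
  · rintro ⟨-, -, h1, h2⟩
    have h3 : a ≤ k := by
      by_contra! hka
      have e1 := s.mono k a hka s.a_lt
      have : Real.pi ≤ θ (g a) - θ (g k) :=
        s.angle.pi_le (s.ne k hk) (s.ne a s.a_lt) e1 (by rw [cross_swap_right]; linarith)
      linarith [s.angle.nonneg (g k)]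
    refine ⟨h3, ?_⟩
    by_contra! hbk
    have e1 := s.mono b k hbk hk
    have : Real.pi ≤ θ (g k) - θ (g b) :=
      s.angle.pi_le (s.ne b s.b_lt) (s.ne k hk) e1 (by rw [cross_swap_right]; linarith)
    linarith [s.angle.lt (g k)]
  · rintro ⟨hak, hkb⟩
    have e1 : θ (g a) ≤ θ (g k) := by
      rcases hak.lt_or_eq with h | rfl
      exacts [(s.mono a k h hk).le, le_rfl]
    have e2 : θ (g k) ≤ θ (g b) := by
      rcases hkb.lt_or_eq with h | rfl
      exacts [(s.mono k b h s.b_lt).le, le_rfl]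
    exact ⟨s.mem k hk, s.ne k hk,
      s.angle.cross_nonneg (s.ne a s.a_lt) (s.ne k hk) e1 (by linarith),
      s.angle.cross_nonneg (s.ne k hk) (s.ne b s.b_lt) e2 (by linarith)⟩

theorem sector₃_iff (s : NumberedStar S c r p₁ p₂ p₃ q₁ q₂ q₃ θ g n a b i₁ i₂ i₃) {k : ℕ}
    (hk : k < n) : g k ∈ sector S r p₃ p₁ ↔ k = 0 ∨ b ≤ k := by
  obtain ⟨⟨h3, h4, h5, h6, -⟩, ha, hab, hb⟩ := s.angles
  have h0 := s.angle_zero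
  have h0n : 0 < n := by omega
  rw [← s.zero, ← s.gb]
  constructor
  · rintro ⟨-, -, h1, h2⟩
    by_contra! hn
    have e1 := s.mono k b hn.2 s.b_lt
    have e2 : Real.pi ≤ θ (g b) - θ (g k) :=
      s.angle.pi_le (s.ne k hk) (s.ne b s.b_lt) e1 (by rw [cross_swap_right]; linarith)
    have e3 := s.mono 0 k (Nat.pos_of_ne_zero hn.1) hk
    have e4 : Real.pi ≤ θ (g k) - θ (g 0) :=
      s.angle.pi_le (s.ne 0 h0n) (s.ne k hk) e3 (by rw [cross_swap_right]; linarith)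
    linarith [s.angle.lt (g b)]
  · have hneg : ∀ j < n, Real.pi < θ (g j) → 0 ≤ cross r (g j) (g 0) := fun j hj h => by
      rw [cross_swap_right]
      linarith [s.angle.cross_neg (s.ne 0 h0n) (s.ne j hj) (by linarith)]
    rintro (rfl | hbk)
    · exact ⟨s.mem _ hk, s.ne _ hk, hneg b s.b_lt hb, by rw [cross_self_right]⟩
    · have e1 : θ (g b) ≤ θ (g k) := by
        rcases hbk.lt_or_eq with h | rfl
        exacts [(s.mono b k h hk).le, le_rfl]
      exact ⟨s.mem k hk, s.ne k hk, s.angle.cross_nonneg (s.ne b s.b_lt) (s.ne k hk) e1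
        (by linarith [s.angle.lt (g k)]), hneg k hk (by linarith)⟩

theorem balanced (s : NumberedStar S c r p₁ p₂ p₃ q₁ q₂ q₃ θ g n a b i₁ i₂ i₃) {u v : ℝ × ℝ}
    (hB : BalancedSector S c r u v) {l : List ℕ} (hl : l.Nodup)
    (hmem : ∀ k, k ∈ l ↔ k < n ∧ g k ∈ sector S r u v) (γ : ℕ) (hγ : γ < 3) :
    0 < l.countP (fun k => letter (c (g 0)) (c (g 1)) (c (g k)) = γ) ∧
      l.countP (fun k => letter (c (g 0)) (c (g 1)) (c (g k)) = γ) ≤ 2 := by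
  have hn : 1 < n := by have := s.angles.1; have := s.a_lt; omega
  obtain ⟨e, he, h⟩ := letter_iff (s.colour_ne (zero_lt_one.trans hn)) (s.colour_ne hn)
    s.colour_zero_ne_one hγ
  have hsub : sector S r u v ⊆ S := fun x hx => hx.1
  obtain ⟨h1, h2⟩ := hB e he
  refine ⟨s.countP_pos hsub (fun x hx => hx.2.1) (fun k hk hg => (hmem k).2 ⟨hk, hg⟩)
    (fun k hk hc => (h _ (s.colour_ne hk)).2 hc) h1, ?_⟩
  exact (s.countP_le (s.blocked.finite.subset hsub) hl (fun k hk => (hmem k).1 hk) e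
    (fun k hk hc => (h _ (s.colour_ne hk)).1 hc)).trans h2

theorem le_nine (s : NumberedStar S c r p₁ p₂ p₃ q₁ q₂ q₃ θ g n a b i₁ i₂ i₃) : n ≤ 9 := by
  have h := FourBlocked.ncard_eq_sum s.blocked.finite c
  have h1 : (S ∩ c ⁻¹' {c r}).ncard = 1 := by
    rw [Set.ncard_eq_one]
    refine ⟨r, Set.ext fun x => ⟨fun hx => s.unique x hx.1 hx.2, ?_⟩⟩
    rintro rfl
    exact ⟨s.mem_r, rfl⟩
  have hcl := s.class_le
  have hsum : ∑ i, (S ∩ c ⁻¹' {i}).ncard ≤ 10 := by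
    rw [← Finset.add_sum_erase _ _ (Finset.mem_univ (c r)), h1]
    have := Finset.sum_le_card_nsmul (Finset.univ.erase (c r)) (fun i => (S ∩ c ⁻¹' {i}).ncard) 3
      (fun i _ => hcl i)
    rw [Finset.card_erase_of_mem (Finset.mem_univ _), Finset.card_univ, Fintype.card_fin] at this
    simpa using Nat.add_le_add_left this 1
  have := s.ncard
  omega

theorem letter_eq_iff (s : NumberedStar S c r p₁ p₂ p₃ q₁ q₂ q₃ θ g n a b i₁ i₂ i₃) {i j : ℕ}
    (hi : i < n) (hj : j < n) :
    letter (c (g 0)) (c (g 1)) (c (g i)) = letter (c (g 0)) (c (g 1)) (c (g j)) ↔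
      c (g i) = c (g j) :=
  _root_.letter_eq_iff (s.colour_ne (by have := s.angles.1; omega))
    (s.colour_ne (by have := s.angles.1; have := s.a_lt; omega)) s.colour_zero_ne_one
    (s.colour_ne hi) (s.colour_ne hj)

open CyclicWord in
theorem model (s : NumberedStar S c r p₁ p₂ p₃ q₁ q₂ q₃ θ g n a b i₁ i₂ i₃) :
    Model n a b i₁ i₂ i₃ (fun k => letter (c (g 0)) (c (g 1)) (c (g k))) (fun k => θ (g k))
      (fun z i j => Blocks (g z) (g i) (g j)) := by
  obtain ⟨⟨h1, h2, h3, h4, h5⟩, ha, hab, hb⟩ := s.angles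
  have h6 := s.i₂_lt
  have h7 := s.a_lt
  have h8 := s.b_lt
  refine {
    six_le := by omega, le_nine := s.le_nine, q₃_pos := h1, q₃_lt := h2, lt_q₁ := h3,
    q₁_lt := h4, lt_q₂ := h5, q₂_lt := h6, col_lt := fun k _ => letter_lt _ _ _,
    col_zero := by simp [letter], col_one := by simp [letter, s.colour_zero_ne_one.symm],
    count_le := ?_, balanced₁ := ?_, balanced₂ := ?_, balanced₃ := ?_, mono := s.mono,
    angle_zero := s.angle_zero, angle_lt := fun k _ => s.angle.lt _, angle_a := ha,
    angle_ab := hab, angle_b := hb, exists_blocker := ?_, centre := fun i j hij hj h =>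
      s.centre_blocks hij hj h, blocker := ?_, triple := ?_, line := fun i j z i' j' z' =>
      s.lineOk }
  · intro γ hγ
    obtain ⟨e, he, h⟩ := letter_iff (s.colour_ne (by omega)) (s.colour_ne (by omega))
      s.colour_zero_ne_one hγ
    exact (s.countP_le s.blocked.finite List.nodup_range
      (fun k hk => ⟨List.mem_range.1 hk, s.mem k (List.mem_range.1 hk)⟩) e
      (fun k hk hc => (h _ (s.colour_ne hk)).1 hc)).trans (s.class_le e)
  · refine s.balanced s.balanced₁ (List.nodup_range' ..) fun k => ?_
    rw [List.mem_range'_1]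
    by_cases hk : k < n
    · rw [s.sector₁_iff hk]; omega
    · simp only [hk, false_and, iff_false]; omega
  · refine s.balanced s.balanced₂ (List.nodup_range' ..) fun k => ?_
    rw [List.mem_range'_1]
    by_cases hk : k < n
    · rw [s.sector₂_iff hk]; omega
    · simp only [hk, false_and, iff_false]; omega
  · refine s.balanced s.balanced₃ (List.nodup_cons.2 ⟨?_, List.nodup_range' ..⟩) fun k => ?_
    · rw [List.mem_range'_1]; omega
    rw [List.mem_cons, List.mem_range'_1]
    by_cases hk : k < n
    · rw [s.sector₃_iff hk]; omega
    · simp only [hk, false_and, iff_false]; omega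
  · intro i j hij hj hc
    obtain ⟨x, hx, hbl⟩ := s.blocked.exists_blocker (s.mem i (hij.trans hj)) (s.mem j hj)
      (s.ne_of_lt hij hj) ((s.letter_eq_iff (hij.trans hj) hj).1 hc)
    obtain ⟨z, hz, rfl⟩ := s.exists_index hx
    exact ⟨z, hz, hbl⟩
  · intro i j z hij hj hz hbl
    have hi := hij.trans hj
    have hne := s.ne_of_lt hij hj
    refine ⟨fun h => hbl.ne_left hne (congrArg g h), fun h => hbl.ne_right hne (congrArg g h),
      fun h => s.blocked.colour_ne (s.mem z hz) (s.mem i hi) (s.mem j hj) hne hbl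
        ((s.letter_eq_iff hz hi).1 h), fun h => ?_, s.blocks_angles hij hj hz hbl⟩
    simp only [List.mem_cons, List.not_mem_nil, or_false] at h
    refine s.q_block (g z) ?_ _ (s.mem i hi) _ (s.mem j hj) hne hbl
    rcases h with rfl | rfl | rfl
    exacts [Or.inl s.g₁, Or.inr (Or.inl s.g₂), Or.inr (Or.inr s.g₃)]
  · intro i j k hij hjk hk e1 e2
    exact s.triple_angles hij hjk hk ((s.letter_eq_iff (by omega) (by omega)).1 e1)
      ((s.letter_eq_iff (by omega) (by omega)).1 e2)

end NumberedStar

namespace NumberedStar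

variable {S : Set (ℝ × ℝ)} {c : ℝ × ℝ → Fin 4} {r p₁ p₂ p₃ q₁ q₂ q₃ : ℝ × ℝ} {θ : ℝ × ℝ → ℝ}
  {g : ℕ → ℝ × ℝ} {n a b i₁ i₂ i₃ : ℕ} {acc : List (ℕ × ℕ × ℕ)}

open CyclicWord

/-- The triples in the list occur in the star. -/
def Realises (c : ℝ × ℝ → Fin 4) (g : ℕ → ℝ × ℝ) (n : ℕ) (acc : List (ℕ × ℕ × ℕ)) : Prop :=
  ∀ T ∈ acc, Model.Occurs n (fun z i j => Blocks (g z) (g i) (g j))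
    (fun k => letter (c (g 0)) (c (g 1)) (c (g k))) T

theorem of_triple (s : NumberedStar S c r p₁ p₂ p₃ q₁ q₂ q₃ θ g n a b i₁ i₂ i₃)
    (hacc : Realises c g n acc) {x y z : ℕ} (h : triple x y z ∈ acc) :
    g x ≠ g y ∧ c (g x) = c (g y) ∧ Blocks (g z) (g x) (g y) := by
  obtain ⟨h1, h2, -, h4, h5⟩ := hacc _ h
  dsimp only [triple] at h1 h2 h4 h5
  rw [s.letter_eq_iff (h1.trans h2) h2] at h4
  have hne := s.ne_of_lt h1 h2
  rcases le_total x y with hxy | hxy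
  · rw [min_eq_left hxy, max_eq_right hxy] at *
    exact ⟨hne, h4, h5⟩
  · rw [min_eq_right hxy, max_eq_left hxy] at *
    exact ⟨hne.symm, h4.symm, h5.symm⟩

theorem not_excluded (s : NumberedStar S c r p₁ p₂ p₃ q₁ q₂ q₃ θ g n a b i₁ i₂ i₃)
    (hacc : Realises c g n acc) {x y z qx qz : ℕ} {e f : ℝ × ℝ} (hy : cross e f (g y) = 0)
    (hz : cross e f (g z) = 0) (hr : 0 < cross e f r) (hx : 0 < cross e f (g x)) :
    ¬ Excluded n acc x y z qx qz := by
  have neg : ∀ {u v w : ℝ × ℝ}, Blocks u v w → cross e f u = 0 → 0 < cross e f v →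
      cross e f w < 0 := by
    intro u v w hb hu hv
    by_contra! h
    exact (hb.cross_pos hv h).ne' hu
  rintro ⟨h1, w, hw, h2, h3, v, hv, h4⟩
  obtain ⟨-, -, b1⟩ := s.of_triple hacc h1
  obtain ⟨-, -, b2⟩ := s.of_triple hacc h2
  obtain ⟨-, -, b3⟩ := s.of_triple hacc h3
  obtain ⟨-, -, b4⟩ := s.of_triple hacc h4
  have hw0 : cross e f (g w) = 0 := by
    rcases lt_trichotomy (cross e f (g w)) 0 with h | h | h
    · exact absurd hy (b3.cross_neg' hz.le h).ne
    · exact h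
    · exact absurd hy (b3.cross_pos' hz.ge h).ne'
  have hv0 := b4.cross_neg (neg b2 hw0 hx) (neg b1 hz hx).le
  simp only [List.mem_cons, List.not_mem_nil, or_false] at hv
  rcases hv with rfl | rfl | rfl | rfl | rfl
  · rw [s.centre] at hv0
    linarith
  all_goals linarith

end NumberedStar

theorem BlockedStar.exists_chirality {S : Set (ℝ × ℝ)} {c : ℝ × ℝ → Fin 4}
    {r p₁ p₂ p₃ q₁ q₂ q₃ : ℝ × ℝ} (s : BlockedStar S c r p₁ p₂ p₃ q₁ q₂ q₃) :
    S = {r, p₁, p₂, p₃, q₁, q₂, q₃} ∧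
      (p₁ ≠ q₁ ∧ p₂ ≠ q₂ ∧ p₃ ≠ q₃) ∧ (c p₁ = c q₁ ∧ c p₂ = c q₂ ∧ c p₃ = c q₃) ∧
      ((Blocks p₂ p₁ q₁ ∧ Blocks p₃ p₂ q₂ ∧ Blocks p₁ p₃ q₃) ∨
        (Blocks p₃ p₁ q₁ ∧ Blocks p₁ p₂ q₂ ∧ Blocks p₂ p₃ q₃)) := by
  obtain ⟨θ, g, n, a, b, i₁, i₂, i₃, N⟩ := s.exists_numberedStar
  obtain ⟨acc, hacc, h⟩ := N.model.exists_outcome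
  have hp₁ := s.p₁₂
  have hp₂ := s.p₂₃
  have hp₃ := s.p₃₁
  have key := cross_add_cross_add_cross p₁ p₂ p₃ r
  have e₁ : cross r p₁ p₂ = cross p₁ p₂ r := cross_rotate ..
  have e₂ : cross r p₂ p₃ = cross p₂ p₃ r := cross_rotate ..
  have e₃ : cross r p₃ p₁ = cross p₃ p₁ r := cross_rotate ..
  have f₂ : cross p₂ p₃ p₁ = cross p₁ p₂ p₃ := (cross_rotate ..).symm
  have f₃ : cross p₃ p₁ p₂ = cross p₁ p₂ p₃ := by rw [cross_rotate]
  have x₁ : ∀ qx qz, ¬ CyclicWord.Excluded n acc 0 a b qx qz := fun _ _ =>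
    N.not_excluded (e := p₂) (f := p₃) hacc (by rw [N.ga, cross_self_mid])
      (by rw [N.gb, cross_self_right]) (by linarith) (by rw [N.zero]; linarith)
  have x₂ : ∀ qx qz, ¬ CyclicWord.Excluded n acc 0 b a qx qz := fun _ _ =>
    N.not_excluded (e := p₂) (f := p₃) hacc (by rw [N.gb, cross_self_right])
      (by rw [N.ga, cross_self_mid]) (by linarith) (by rw [N.zero]; linarith)
  have x₃ : ∀ qx qz, ¬ CyclicWord.Excluded n acc a 0 b qx qz := fun _ _ =>
    N.not_excluded (e := p₃) (f := p₁) hacc (by rw [N.zero, cross_self_right])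
      (by rw [N.gb, cross_self_mid]) (by linarith) (by rw [N.ga]; linarith)
  have x₄ : ∀ qx qz, ¬ CyclicWord.Excluded n acc a b 0 qx qz := fun _ _ =>
    N.not_excluded (e := p₃) (f := p₁) hacc (by rw [N.gb, cross_self_mid])
      (by rw [N.zero, cross_self_right]) (by linarith) (by rw [N.ga]; linarith)
  have x₅ : ∀ qx qz, ¬ CyclicWord.Excluded n acc b 0 a qx qz := fun _ _ =>
    N.not_excluded (e := p₁) (f := p₂) hacc (by rw [N.zero, cross_self_mid])
      (by rw [N.ga, cross_self_right]) (by linarith) (by rw [N.gb]; linarith)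
  have x₆ : ∀ qx qz, ¬ CyclicWord.Excluded n acc b a 0 qx qz := fun _ _ =>
    N.not_excluded (e := p₁) (f := p₂) hacc (by rw [N.ga, cross_self_right])
      (by rw [N.zero, cross_self_mid]) (by linarith) (by rw [N.gb]; linarith)
  rcases h with (h | h | h | h | h | h) | ⟨hn, h⟩
  · exact absurd h (x₁ _ _)
  · exact absurd h (x₂ _ _)
  · exact absurd h (x₃ _ _)
  · exact absurd h (x₄ _ _)
  · exact absurd h (x₅ _ _)
  · exact absurd h (x₆ _ _)
  obtain ⟨⟨o₁, o₂, o₃, o₄, o₅⟩, -⟩ := N.angles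
  have o₆ := N.i₂_lt
  refine ⟨?_, ?_⟩
  · ext x
    simp only [Set.mem_insert_iff, Set.mem_singleton_iff]
    constructor
    · intro hx
      by_cases hxr : x = r
      · exact Or.inl hxr
      obtain ⟨k, hk, rfl⟩ := N.surj x hx hxr
      have : k = 0 ∨ k = a ∨ k = b ∨ k = i₁ ∨ k = i₂ ∨ k = i₃ := by omega
      refine Or.inr ?_
      rcases this with rfl | rfl | rfl | rfl | rfl | rfl
      · exact Or.inl N.zero
      · exact Or.inr (Or.inl N.ga)
      · exact Or.inr (Or.inr (Or.inl N.gb))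
      · exact Or.inr (Or.inr (Or.inr (Or.inl N.g₁)))
      · exact Or.inr (Or.inr (Or.inr (Or.inr (Or.inl N.g₂))))
      · exact Or.inr (Or.inr (Or.inr (Or.inr (Or.inr N.g₃))))
    · rintro (rfl | rfl | rfl | rfl | rfl | rfl | rfl)
      exacts [s.mem_r, s.mp₁, s.mp₂, s.mp₃, s.mq₁, s.mq₂, s.mq₃]
  · have T : ∀ {x y z : ℕ}, CyclicWord.triple x y z ∈ acc →
        g x ≠ g y ∧ c (g x) = c (g y) ∧ Blocks (g z) (g x) (g y) := N.of_triple hacc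
    rw [← N.zero, ← N.ga, ← N.gb, ← N.g₁, ← N.g₂, ← N.g₃]
    rcases h with ⟨h₁, h₂, h₃⟩ | ⟨h₁, h₂, h₃⟩
    · obtain ⟨n₁, c₁, b₁⟩ := T h₁
      obtain ⟨n₂, c₂, b₂⟩ := T h₂
      obtain ⟨n₃, c₃, b₃⟩ := T h₃
      exact ⟨⟨n₁, n₂, n₃⟩, ⟨c₁, c₂, c₃⟩, Or.inl ⟨b₁, b₂, b₃⟩⟩
    · obtain ⟨n₁, c₁, b₁⟩ := T h₁
      obtain ⟨n₂, c₂, b₂⟩ := T h₂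
      obtain ⟨n₃, c₃, b₃⟩ := T h₃
      exact ⟨⟨n₁, n₂, n₃⟩, ⟨c₁, c₂, c₃⟩, Or.inr ⟨b₁, b₂, b₃⟩⟩

theorem Blocks.exists_cross_ray {p r u : ℝ × ℝ} (h : Blocks p r u) :
    ∃ t : ℝ, 0 < t ∧ ∀ x, cross r p x = t * cross r u x ∧ cross r x p = t * cross r x u := by
  obtain ⟨t, h0, -, ht⟩ := h.cross_eq
  refine ⟨t, h0, fun x => ?_⟩
  have h1 := ht x r
  have h2 : cross r x r = 0 := cross_self_mid ..
  rw [cross_self_right, cross_rotate] at h1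
  have h3 := ht r x
  rw [h2] at h3
  rw [cross_rotate r u x, cross_rotate u x r]
  have h4 : cross p x r = -cross x p r := cross_swap ..
  have e1 : cross x r u = cross r u x := cross_rotate ..
  have e2 : cross r p x = cross p x r := cross_rotate ..
  constructor <;> linarith

/-- A class of four points, one of them inside the triangle of the others, which is the convex hull
of the whole set. -/
structure HullTri (P : Set (ℝ × ℝ)) (c : ℝ × ℝ → Fin 4) (a b d r : ℝ × ℝ) : Prop where
  blocked : FourBlocked P c
  ma : a ∈ P
  mb : b ∈ P
  md : d ∈ P
  mr : r ∈ P
  ca : c a = c r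
  cb : c b = c r
  cd : c d = c r
  only : ∀ x ∈ P, c x = c r → x = a ∨ x = b ∨ x = d ∨ x = r
  pos : 0 < cross a b d
  rd : 0 < cross a b r
  ra : 0 < cross b d r
  rb : 0 < cross d a r
  subset : P ⊆ Tri a b d

namespace HullTri

variable {P : Set (ℝ × ℝ)} {c : ℝ × ℝ → Fin 4} {a b d r p₁ p₂ p₃ q₁ q₂ q₃ : ℝ × ℝ}

theorem rotate (k : HullTri P c a b d r) : HullTri P c b d a r where
  blocked := k.blocked
  ma := k.mb
  mb := k.md
  md := k.ma
  mr := k.mr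
  ca := k.cb
  cb := k.cd
  cd := k.ca
  only x hx h := by have := k.only x hx h; tauto
  pos := by rw [← cross_rotate]; exact k.pos
  rd := k.ra
  ra := k.rb
  rb := k.rd
  subset := by rw [← tri_rotate]; exact k.subset

theorem pos_r (k : HullTri P c a b d r) : 0 < cross r a b := by
  rw [cross_rotate]; exact k.rd

theorem restrict (k : HullTri P c a b d r) : FourBlocked (P \ {a, b, d}) c := by
  have := k.blocked.tri_diff k.pos
  rwa [Set.inter_eq_left.2 k.subset] at this

theorem ne_r (k : HullTri P c a b d r) : r ≠ a ∧ r ≠ b ∧ r ≠ d := by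
  obtain ⟨h1, h2, -⟩ := ne_of_cross_ne_zero k.pos_r.ne'
  exact ⟨h1, h2, (ne_of_cross_ne_zero k.ra.ne').2.2.symm⟩

theorem mem_of_colour_ne (k : HullTri P c a b d r) {x : ℝ × ℝ} (hx : x ∈ P) (h : c x ≠ c r) :
    x ∈ P \ {a, b, d} := by
  refine ⟨hx, ?_⟩
  rintro (rfl | rfl | rfl)
  exacts [h k.ca, h k.cb, h k.cd]

theorem emptyTri (k : HullTri P c a b d r) : FourBlocked.EmptyTri P c r a b where
  mem_a := k.mr
  mem_b := k.ma
  mem_d := k.mb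
  pos := k.pos_r
  eq_b := k.ca.symm
  eq_d := k.cb.symm
  empty x hx ht hc := by
    rcases k.only x hx hc with h | h | rfl | h
    · exact Or.inr (Or.inl h)
    · exact Or.inr (Or.inr h)
    · have := ht.1
      have e : cross r a x = -cross x a r := by unfold cross; ring
      linarith [k.rb]
    · exact Or.inl h

theorem sector_eq (k : HullTri P c a b d r) (h₁ : Blocks p₁ r a) (h₂ : Blocks p₂ r b) :
    sector (P \ {a, b, d}) r p₁ p₂ = (P ∩ Tri r a b) \ {r, a, b} := by
  obtain ⟨t, ht, e⟩ := h₁.exists_cross_ray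
  obtain ⟨t', ht', e'⟩ := h₂.exists_cross_ray
  ext x
  have e1 : cross r x b = cross b r x := by rw [cross_rotate, cross_rotate]
  simp only [sector, Tri, Set.mem_ofPred_eq, (e x).1, (e' x).2, mul_nonneg_iff_of_pos_left ht,
    mul_nonneg_iff_of_pos_left ht', Set.mem_sdiff, Set.mem_insert_iff, Set.mem_singleton_iff,
    Set.mem_inter_iff]
  constructor
  · rintro ⟨⟨hx, hn⟩, hxr, h1, h2⟩
    refine ⟨⟨hx, h1, (k.subset hx).1, by rwa [← e1]⟩, ?_⟩
    tauto
  · rintro ⟨⟨hx, h1, -, h2⟩, hn⟩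
    refine ⟨⟨hx, ?_⟩, fun h => hn (Or.inl h), h1, by rwa [e1]⟩
    rintro (h | h | rfl)
    · exact hn (Or.inr (Or.inl h))
    · exact hn (Or.inr (Or.inr h))
    · have e : cross r a x = -cross x a r := by unfold cross; ring
      linarith [k.rb]

theorem balanced (k : HullTri P c a b d r) (h₁ : Blocks p₁ r a) (h₂ : Blocks p₂ r b) :
    BalancedSector (P \ {a, b, d}) c r p₁ p₂ := by
  intro γ hγ
  rw [k.sector_eq h₁ h₂]
  have hQ := k.blocked.tri_diff k.pos_r
  have hr : ∀ x ∈ (P ∩ Tri r a b) \ {r, a, b}, c x ≠ c r := fun x hx =>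
    k.emptyTri.colour_ne_of_mem hx
  refine ⟨?_, hQ.ncard_class_le_two hr γ⟩
  by_contra hne
  rw [Set.not_nonempty_iff_eq_empty] at hne
  obtain ⟨x, y, z, hx, hy, hz, h0⟩ := k.emptyTri.exists_side_blockers k.blocked
  exact h0 (hQ.cross_eq_zero_of_two_colours hγ
    (fun x hx hc => Set.eq_empty_iff_forall_notMem.1 hne x ⟨hx, hc⟩) hr hx hy hz)

theorem not_side_blocks (k : HullTri P c a b d r) (hq : Blocks q₃ a b) (mq : q₃ ∈ P) {u v : ℝ × ℝ}
    (hu : u ∈ P \ {a, b, d}) (hv : v ∈ P \ {a, b, d}) (huv : u ≠ v) : ¬ Blocks q₃ u v := by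
  intro hb
  have hab := (ne_of_cross_ne_zero k.pos.ne').1
  have h0 : cross a b u = 0 := by
    by_contra hne
    exact (hb.cross_pos (lt_of_le_of_ne (k.subset hu.1).1 (Ne.symm hne)) (k.subset hv.1).1).ne'
      hq.cross_zero
  rcases k.blocked.mem_line k.ma k.mb mq hab hq (Or.inl rfl) (Or.inr (Or.inl rfl)) hab hu.1 h0 with
    h | h | h
  · exact hu.2 (Or.inl h)
  · exact hu.2 (Or.inr (Or.inl h))
  · exact hb.ne_left huv h.symm

theorem not_centre_blocks (k : HullTri P c a b d r) (hp : Blocks p₁ r a) (mp : p₁ ∈ P) {v : ℝ × ℝ}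
    (hv : v ∈ P \ {a, b, d}) : ¬ Blocks r p₁ v := by
  intro hb
  have hne := hp.ne_left k.ne_r.1
  have h0 : cross r p₁ v = 0 := by rw [cross_rotate]; exact hb.cross_zero
  have hpv : p₁ ≠ v := by
    rintro rfl
    rw [Blocks, openSegment_same] at hb
    exact hne hb.symm
  rcases k.blocked.mem_line k.mr k.ma mp k.ne_r.1 hp (Or.inl rfl) (Or.inr (Or.inr rfl)) hne.symm
    hv.1 h0 with h | h | h
  · exact hb.ne_right hpv h.symm
  · exact hv.2 (Or.inl h)
  · exact hpv h.symm

theorem unique (k : HullTri P c a b d r) {x : ℝ × ℝ} (hx : x ∈ P \ {a, b, d}) (h : c x = c r) :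
    x = r := by
  rcases k.only x hx.1 h with h | h | h | h
  · exact absurd (Or.inl h) hx.2
  · exact absurd (Or.inr (Or.inl h)) hx.2
  · exact absurd (Or.inr (Or.inr h)) hx.2
  · exact h

theorem mem_tri (k : HullTri P c a b d r) {x y z : ℝ × ℝ} (hx : x ∈ P \ {a, b, d})
    (hy : y ∈ P \ {a, b, d}) (hz : z ∈ P \ {a, b, d}) (hpos : 0 < cross x y z) (h₁ : c x = c y)
    (h₂ : c y = c z) : r ∈ Tri x y z := by
  by_contra hr
  obtain ⟨hxy, hxz, hyz⟩ := ne_of_cross_ne_zero hpos.ne'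
  have hQ : FourBlocked ((P \ {a, b, d}) ∩ Tri x y z) c := by
    refine k.restrict.restrict Set.inter_subset_left ?_
    rintro u ⟨-, hu⟩ v ⟨-, hv⟩ - z hz hb
    exact ⟨hz, hb.mem_tri hu hv⟩
  refine hQ.not_three_of_three_colours (γ := c r) (fun w hw hc => ?_) ⟨hx, left_mem_tri hpos⟩
    ⟨hy, ?_⟩ ⟨hz, ?_⟩ hxy hxz hyz h₁ (h₁.trans h₂)
  · rw [k.unique hw.1 hc] at hw
    exact hr hw.2
  · rw [tri_rotate]
    exact left_mem_tri (by rwa [← cross_rotate])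
  · rw [← tri_rotate]
    exact left_mem_tri (by rwa [cross_rotate])

theorem triple (k : HullTri P c a b d r) {x y z : ℝ × ℝ} (hx : x ∈ P \ {a, b, d})
    (hy : y ∈ P \ {a, b, d}) (hz : z ∈ P \ {a, b, d}) (hxy : x ≠ y) (hxz : x ≠ z) (hyz : y ≠ z)
    (h₁ : c x = c y) (h₂ : c y = c z) :
    (0 ≤ cross r x y ∧ 0 ≤ cross r y z ∧ 0 ≤ cross r z x) ∨
      (cross r x y ≤ 0 ∧ cross r y z ≤ 0 ∧ cross r z x ≤ 0) := by
  have e1 : cross r x y = cross x y r := cross_rotate ..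
  have e2 : cross r y z = cross y z r := cross_rotate ..
  have e3 : cross r z x = cross z x r := cross_rotate ..
  rw [e1, e2, e3]
  rcases (k.blocked.cross_ne_zero hx.1 hy.1 hz.1 hxy hxz hyz h₁ (h₁.trans h₂)).lt_or_gt with h | h
  · obtain ⟨t1, t2, t3⟩ := k.mem_tri hy hx hz (by rw [cross_swap]; linarith) h₁.symm
      (h₁.trans h₂)
    rw [cross_swap] at t1 t2 t3
    exact Or.inr ⟨by linarith, by linarith, by linarith⟩
  · exact Or.inl (k.mem_tri hx hy hz h h₁ h₂)

theorem star (k : HullTri P c a b d r) (hcl : ∀ i, ((P \ {a, b, d}) ∩ c ⁻¹' {i}).ncard ≤ 3)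
    (mp₁ : p₁ ∈ P) (mp₂ : p₂ ∈ P) (mp₃ : p₃ ∈ P) (mq₁ : q₁ ∈ P) (mq₂ : q₂ ∈ P) (mq₃ : q₃ ∈ P)
    (hp₁ : Blocks p₁ r a) (hp₂ : Blocks p₂ r b) (hp₃ : Blocks p₃ r d) (hq₁ : Blocks q₁ b d)
    (hq₂ : Blocks q₂ d a) (hq₃ : Blocks q₃ a b) :
    BlockedStar (P \ {a, b, d}) c r p₁ p₂ p₃ q₁ q₂ q₃ := by
  have k' := k.rotate
  have k'' := k'.rotate
  have e' : P \ {b, d, a} = P \ {a, b, d} := by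
    congr 1; ext x; simp only [Set.mem_insert_iff, Set.mem_singleton_iff]; tauto
  have e'' : P \ {d, a, b} = P \ {a, b, d} := by
    congr 1; ext x; simp only [Set.mem_insert_iff, Set.mem_singleton_iff]; tauto
  obtain ⟨ra, rb, rd⟩ := k.ne_r
  obtain ⟨hab, had, hbd⟩ := ne_of_cross_ne_zero k.pos.ne'
  have np : ∀ {p u : ℝ × ℝ}, p ∈ P → u ∈ P → r ≠ u → Blocks p r u → c p ≠ c r :=
    fun hp hu hne hb => k.blocked.colour_ne hp k.mr hu hne hb
  obtain ⟨t₁, ht₁, e₁⟩ := hp₁.exists_cross_ray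
  obtain ⟨t₂, ht₂, e₂⟩ := hp₂.exists_cross_ray
  obtain ⟨t₃, ht₃, e₃⟩ := hp₃.exists_cross_ray
  have w₁ := k.pos_r
  have w₂ := k'.pos_r
  have w₃ := k''.pos_r
  have v₁ : 0 < cross b r a := by rwa [cross_rotate]
  have v₂ : 0 < cross d r b := by rwa [cross_rotate]
  have v₃ : 0 < cross a r d := by rwa [cross_rotate]
  have side : ∀ {u v q : ℝ × ℝ}, Blocks q u v → 0 < cross r u v →
      0 < cross r u q ∧ 0 < cross r q v := by
    intro u v q hb h
    refine ⟨hb.cross_pos' (by rw [cross_self_right]) h, ?_⟩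
    rw [cross_rotate, cross_rotate]
    exact hb.cross_pos (by rwa [cross_rotate]) (cross_self_mid ..).ge
  exact {
    blocked := k.restrict
    mem_r := ⟨k.mr, by simp [ra, rb, rd]⟩
    unique := fun x => k.unique
    mp₁ := k.mem_of_colour_ne mp₁ (np mp₁ k.ma ra hp₁)
    mp₂ := k.mem_of_colour_ne mp₂ (np mp₂ k.mb rb hp₂)
    mp₃ := k.mem_of_colour_ne mp₃ (np mp₃ k.md rd hp₃)
    mq₁ := k.mem_of_colour_ne mq₁ (k.cb ▸ k.blocked.colour_ne mq₁ k.mb k.md hbd hq₁)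
    mq₂ := k.mem_of_colour_ne mq₂ (k.cd ▸ k.blocked.colour_ne mq₂ k.md k.ma had.symm hq₂)
    mq₃ := k.mem_of_colour_ne mq₃ (k.ca ▸ k.blocked.colour_ne mq₃ k.ma k.mb hab hq₃)
    p₁₂ := by rw [(e₁ p₂).1, (e₂ a).2]; positivity
    p₂₃ := by rw [(e₂ p₃).1, (e₃ b).2]; positivity
    p₃₁ := by rw [(e₃ p₁).1, (e₁ d).2]; positivity
    p₁q₃ := by rw [(e₁ q₃).1]; exact mul_pos ht₁ (side hq₃ w₁).1
    q₃p₂ := by rw [(e₂ q₃).2]; exact mul_pos ht₂ (side hq₃ w₁).2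
    p₂q₁ := by rw [(e₂ q₁).1]; exact mul_pos ht₂ (side hq₁ w₂).1
    q₁p₃ := by rw [(e₃ q₁).2]; exact mul_pos ht₃ (side hq₁ w₂).2
    p₃q₂ := by rw [(e₃ q₂).1]; exact mul_pos ht₃ (side hq₂ w₃).1
    q₂p₁ := by rw [(e₁ q₂).2]; exact mul_pos ht₁ (side hq₂ w₃).2
    q_block := by
      rintro z (rfl | rfl | rfl) u hu v hv huv
      · exact k'.not_side_blocks hq₁ mq₁ (e' ▸ hu) (e' ▸ hv) huv
      · exact k''.not_side_blocks hq₂ mq₂ (e'' ▸ hu) (e'' ▸ hv) huv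
      · exact k.not_side_blocks hq₃ mq₃ hu hv huv
    r_block := by
      rintro p (rfl | rfl | rfl) v hv
      · exact k.not_centre_blocks hp₁ mp₁ hv
      · exact k'.not_centre_blocks hp₂ mp₂ (e' ▸ hv)
      · exact k''.not_centre_blocks hp₃ mp₃ (e'' ▸ hv)
    class_le := hcl
    triple := fun x hx y hy z hz => k.triple hx hy hz
    balanced₁ := k.balanced hp₁ hp₂
    balanced₂ := e' ▸ k'.balanced hp₂ hp₃
    balanced₃ := e'' ▸ k''.balanced hp₃ hp₁ }

theorem exists_blockedTri (k : HullTri P c a b d r)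
    (hcl : ∀ i, ((P \ {a, b, d}) ∩ c ⁻¹' {i}).ncard ≤ 3) : ∃ p₁ p₂ p₃ q₁ q₂ q₃,
      BlockedTri P c a b d r p₁ p₂ p₃ q₁ q₂ q₃ ∨ BlockedTri P c b a d r p₂ p₁ p₃ q₂ q₁ q₃ := by
  obtain ⟨ra, rb, rd⟩ := k.ne_r
  obtain ⟨hab, had, hbd⟩ := ne_of_cross_ne_zero k.pos.ne'
  obtain ⟨p₁, mp₁, hp₁⟩ := k.blocked.exists_blocker k.mr k.ma ra k.ca.symm
  obtain ⟨p₂, mp₂, hp₂⟩ := k.blocked.exists_blocker k.mr k.mb rb k.cb.symm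
  obtain ⟨p₃, mp₃, hp₃⟩ := k.blocked.exists_blocker k.mr k.md rd k.cd.symm
  obtain ⟨q₁, mq₁, hq₁⟩ := k.blocked.exists_blocker k.mb k.md hbd (k.cb.trans k.cd.symm)
  obtain ⟨q₂, mq₂, hq₂⟩ := k.blocked.exists_blocker k.md k.ma had.symm (k.cd.trans k.ca.symm)
  obtain ⟨q₃, mq₃, hq₃⟩ := k.blocked.exists_blocker k.ma k.mb hab (k.ca.trans k.cb.symm)
  have np : ∀ {p u : ℝ × ℝ}, p ∈ P → u ∈ P → r ≠ u → Blocks p r u → c p ≠ c r :=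
    fun hp hu hne hb => k.blocked.colour_ne hp k.mr hu hne hb
  have cp₁ := np mp₁ k.ma ra hp₁
  have cp₂ := np mp₂ k.mb rb hp₂
  have cp₃ := np mp₃ k.md rd hp₃
  obtain ⟨hS, ⟨n₁, n₂, n₃⟩, ⟨c₁, c₂, c₃⟩, h⟩ :=
    (k.star hcl mp₁ mp₂ mp₃ mq₁ mq₂ mq₃ hp₁ hp₂ hp₃ hq₁ hq₂ hq₃).exists_chirality
  have hP : P = {a, b, d, r, p₁, p₂, p₃, q₁, q₂, q₃} := by
    rw [← Set.singleton_union (a := d), ← Set.insert_union, ← Set.insert_union, ← hS,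
      Set.union_sdiff_cancel]
    rintro x (rfl | rfl | rfl)
    exacts [k.ma, k.mb, k.md]
  refine ⟨p₁, p₂, p₃, q₁, q₂, q₃, ?_⟩
  rcases h with ⟨h₁, h₂, h₃⟩ | ⟨h₁, h₂, h₃⟩
  · have c₁₂ := k.blocked.colour_ne mp₂ mp₁ mq₁ n₁ h₁
    have c₂₃ := k.blocked.colour_ne mp₃ mp₂ mq₂ n₂ h₂
    have c₃₁ := k.blocked.colour_ne mp₁ mp₃ mq₃ n₃ h₃
    exact Or.inl {
      eq := hP
      hp₁ := hp₁, hp₂ := hp₂, hp₃ := hp₃, hq₁ := hq₁, hq₂ := hq₂, hq₃ := hq₃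
      hpq₁ := h₁, hpq₂ := h₂, hpq₃ := h₃, ca := k.ca, cb := k.cb, cd := k.cd
      cq₁ := c₁.symm, cq₂ := c₂.symm, cq₃ := c₃.symm, cp₁ := cp₁, cp₂ := cp₂, cp₃ := cp₃
      c₁₂ := c₁₂.symm, c₂₃ := c₂₃.symm, c₃₁ := c₃₁.symm, ne_ra := ra, ne_rb := rb, ne_rd := rd
      ne₁ := n₁, ne₂ := n₂, ne₃ := n₃, noncollinear := k.pos.ne' }
  · have c₁₃ := k.blocked.colour_ne mp₃ mp₁ mq₁ n₁ h₁
    have c₂₁ := k.blocked.colour_ne mp₁ mp₂ mq₂ n₂ h₂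
    have c₃₂ := k.blocked.colour_ne mp₂ mp₃ mq₃ n₃ h₃
    exact Or.inr {
      eq := by
        rw [hP, Set.insert_comm a b, Set.insert_comm p₁ p₂, Set.insert_comm q₁ q₂]
      hp₁ := hp₂, hp₂ := hp₁, hp₃ := hp₃, hq₁ := hq₂.symm, hq₂ := hq₁.symm, hq₃ := hq₃.symm
      hpq₁ := h₂, hpq₂ := h₁, hpq₃ := h₃, ca := k.cb, cb := k.ca, cd := k.cd
      cq₁ := c₂.symm, cq₂ := c₁.symm, cq₃ := c₃.symm, cp₁ := cp₂, cp₂ := cp₁, cp₃ := cp₃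
      c₁₂ := c₂₁.symm, c₂₃ := c₁₃.symm, c₃₁ := c₃₂.symm, ne_ra := rb, ne_rb := ra, ne_rd := rd
      ne₁ := n₂, ne₂ := n₁, ne₃ := n₃
      noncollinear := by rw [cross_swap]; exact (neg_neg_of_pos k.pos).ne }

end HullTri

theorem cross_nonneg_of_mem_convexHull {R : Set (ℝ × ℝ)} {p q x : ℝ × ℝ}
    (h : ∀ y ∈ R, 0 ≤ cross p q y) (hx : x ∈ convexHull ℝ R) : 0 ≤ cross p q x := by
  refine convexHull_min (t := {y | 0 ≤ cross p q y}) h ?_ hx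
  rw [convex_iff_openSegment_subset]
  intro u hu v hv z hz
  exact Blocks.cross_nonneg hz hu hv

theorem tri_subset_convexHull {a b d : ℝ × ℝ} (h : 0 < cross a b d) :
    Tri a b d ⊆ convexHull ℝ {a, b, d} := by
  rintro t ⟨h1, h2, h3⟩
  have hsum := cross_add_cross_add_cross a b d t
  have hw : ∀ i ∈ Finset.univ, 0 ≤ (![cross b d t, cross d a t, cross a b t] : Fin 3 → ℝ) i /
      cross a b d := by
    intro i _
    refine div_nonneg ?_ h.le
    fin_cases i <;> assumption
  have key := (convex_convexHull ℝ {a, b, d}).sum_mem (z := ![a, b, d]) hw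
    (by
      rw [Fin.sum_univ_three, ← add_div, ← add_div]
      exact (div_eq_one_iff_eq h.ne').2 (by simp; linarith))
    (by intro i _; apply subset_convexHull; fin_cases i <;> simp)
  convert key using 1
  rw [Fin.sum_univ_three]
  have e : ∀ u v w s : ℝ, u * cross b d t + v * cross d a t + w * cross a b t = s * cross a b d →
      s = cross b d t / cross a b d * u + cross d a t / cross a b d * v +
        cross a b t / cross a b d * w := by
    intro u v w s hs
    field_simp
    linarith
  refine Prod.ext (e _ _ _ _ ?_) (e _ _ _ _ ?_) <;> simp [cross] <;> ring

/-- The two configurations that contain a colour class of four points. -/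
def Extremal (P : Set (ℝ × ℝ)) (c : ℝ × ℝ → Fin 4) : Prop :=
  (∃ a b d e s₁ s₂ s₃ s₄ m, BlockedQuad P c a b d e s₁ s₂ s₃ s₄ m ∧
    0 < cross a b d ∧ 0 < cross b d e ∧ 0 < cross d e a ∧ 0 < cross e a b) ∨
  ∃ a b d r p₁ p₂ p₃ q₁ q₂ q₃, (0 < cross a b d ∧ 0 < cross a b r ∧ 0 < cross b d r ∧
    0 < cross d a r) ∧ (BlockedTri P c a b d r p₁ p₂ p₃ q₁ q₂ q₃ ∨
      BlockedTri P c b a d r p₂ p₁ p₃ q₂ q₁ q₃)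

namespace Extremal

variable {K : Set (ℝ × ℝ)} {c : ℝ × ℝ → Fin 4}

theorem not_fourBlocked_insert (k : Extremal K c) {t : ℝ × ℝ} (ht : t ∉ convexHull ℝ K) :
    ¬ FourBlocked (insert t K) c := by
  have out : ∀ {a b d}, 0 < cross a b d → a ∈ K → b ∈ K → d ∈ K → t ∉ Tri a b d := by
    intro a b d h ha hb hd hT
    refine ht (convexHull_mono ?_ (tri_subset_convexHull h hT))
    rintro x (rfl | rfl | rfl) <;> assumption
  rcases k with ⟨a, b, d, e, s₁, s₂, s₃, s₄, m, k, h₁, h₂, h₃, h₄⟩ |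
    ⟨a, b, d, r, p₁, p₂, p₃, q₁, q₂, q₃, ⟨h, hr₁, hr₂, hr₃⟩, k⟩
  · refine k.not_fourBlocked_insert h₁ h₂ h₃ h₄ ?_
    have hK : ∀ x, x = a ∨ x = b ∨ x = d ∨ x = e → x ∈ K := by
      intro x hx
      rw [k.eq]
      simp only [Set.mem_insert_iff]
      tauto
    by_contra! hn
    rcases le_total (cross d a t) 0 with hda | hda
    · refine out (a := d) (b := e) (d := a) h₃ (hK _ (by tauto)) (hK _ (by tauto))
        (hK _ (by tauto)) ⟨hn.2.2.1, hn.2.2.2, ?_⟩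
      rw [cross_swap]
      linarith
    · exact out h₁ (hK _ (by tauto)) (hK _ (by tauto)) (hK _ (by tauto)) ⟨hn.1, hn.2.1, hda⟩
  · have hside : ∀ p q, 0 ≤ cross p q a → 0 ≤ cross p q b → 0 ≤ cross p q d → 0 ≤ cross p q r := by
      intro p q ha hb hd
      have := cross_mul_cross p q a b d r
      have : 0 ≤ cross p q r * cross a b d := by rw [this]; positivity
      exact nonneg_of_mul_nonneg_left this h
    have hK : a ∈ K ∧ b ∈ K ∧ d ∈ K := by
      rcases k with k | k <;> rw [k.eq] <;> simp
    have key : ∀ {p q}, 0 ≤ cross p q a → 0 ≤ cross p q b → 0 ≤ cross p q d →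
        (cross p q a ≤ 0 ∨ cross p q b ≤ 0 ∨ cross p q d ≤ 0) → cross p q t < 0 →
        ¬ FourBlocked (insert t K) c := by
      intro p q ha hb hd h0 ht
      rcases k with k | k
      · exact k.not_fourBlocked_insert hside ha hb hd h0 ht
      · exact k.not_fourBlocked_insert (fun p q ha hb => hside p q hb ha) hb ha hd (by tauto) ht
    have hn := out h hK.1 hK.2.1 hK.2.2
    have e₁ : cross b d a = cross a b d := (cross_rotate ..).symm
    have e₂ : cross d a b = cross a b d := by rw [cross_rotate]
    by_cases n₁ : 0 ≤ cross a b t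
    · by_cases n₂ : 0 ≤ cross b d t
      · refine key (p := d) (q := a) (cross_self_right ..).ge (by linarith) (cross_self_mid ..).ge
          (Or.inl (cross_self_right ..).le) (not_le.1 fun n₃ => hn ⟨n₁, n₂, n₃⟩)
      · exact key (p := b) (q := d) (by linarith) (cross_self_mid ..).ge (cross_self_right ..).ge
          (Or.inr (Or.inl (cross_self_mid ..).le)) (not_le.1 n₂)
    · exact key (p := a) (q := b) (cross_self_mid ..).ge (cross_self_right ..).ge h.le
        (Or.inl (cross_self_mid ..).le) (not_le.1 n₁)

theorem ncard_le (k : Extremal K c) : K.ncard ≤ 12 := by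
  have ins : ∀ (x : ℝ × ℝ) (A : Set (ℝ × ℝ)) (m : ℕ), A.ncard ≤ m → (insert x A).ncard ≤ m + 1 :=
    fun x A m h => (Set.ncard_insert_le x A).trans (Nat.succ_le_succ h)
  rcases k with ⟨a, b, d, e, s₁, s₂, s₃, s₄, m, k, -⟩ |
    ⟨a, b, d, r, p₁, p₂, p₃, q₁, q₂, q₃, -, k | k⟩ <;> rw [k.eq]
  · refine le_trans ?_ (show 9 ≤ 12 by norm_num)
    repeat refine ins _ _ _ ?_
    rw [Set.ncard_singleton]
  all_goals
    refine le_trans ?_ (show 10 ≤ 12 by norm_num)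
    repeat refine ins _ _ _ ?_
    rw [Set.ncard_singleton]

/-- A point of its own colour is the centre of a quadrilateral configuration. -/
theorem exists_blocks_of_unique (k : Extremal K c) {r : ℝ × ℝ} (hr : r ∈ K)
    (hu : ∀ x ∈ K, c x = c r → x = r) {p : ℝ × ℝ} (hp : p ∈ K) (hpr : p ≠ r) :
    ∃ v ∈ K, Blocks r p v := by
  rcases k with ⟨a, b, d, e, s₁, s₂, s₃, s₄, m, k, -⟩ |
    ⟨a, b, d, r', p₁, p₂, p₃, q₁, q₂, q₃, -, k⟩
  · have hK : ∀ x, x ∈ K ↔ x = a ∨ x = b ∨ x = d ∨ x = e ∨ x = s₁ ∨ x = s₂ ∨ x = s₃ ∨ x = s₄ ∨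
        x = m := by
      intro x; rw [k.eq]; simp
    have ma := (hK a).2 (by simp)
    have mb := (hK b).2 (by simp)
    have md := (hK d).2 (by simp)
    have me := (hK e).2 (by simp)
    have m₁ := (hK s₁).2 (by simp)
    have m₂ := (hK s₂).2 (by simp)
    have m₃ := (hK s₃).2 (by simp)
    have m₄ := (hK s₄).2 (by simp)
    rcases (hK r).1 hr with rfl | rfl | rfl | rfl | rfl | rfl | rfl | rfl | rfl
    · exact absurd (hu b mb k.cb).symm k.ne_ab
    · exact absurd (hu a ma k.cb.symm) k.ne_ab
    · exact absurd (hu a ma k.cd.symm) k.ne_ad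
    · exact absurd (hu a ma k.ce.symm).symm k.ne_ea
    · exact absurd (hu s₃ m₃ k.c₃).symm k.ne₁₃
    · exact absurd (hu s₄ m₄ k.c₄).symm k.ne₂₄
    · exact absurd (hu s₁ m₁ k.c₃.symm) k.ne₁₃
    · exact absurd (hu s₂ m₂ k.c₄.symm) k.ne₂₄
    · rcases (hK p).1 hp with rfl | rfl | rfl | rfl | rfl | rfl | rfl | rfl | rfl
      exacts [⟨d, md, k.had⟩, ⟨e, me, k.hbe⟩, ⟨a, ma, k.had.symm⟩, ⟨b, mb, k.hbe.symm⟩,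
        ⟨s₃, m₃, k.hs₁₃⟩, ⟨s₄, m₄, k.hs₂₄⟩, ⟨s₁, m₁, k.hs₁₃.symm⟩, ⟨s₂, m₂, k.hs₂₄.symm⟩,
        absurd rfl hpr]
  · exfalso
    have main : ∀ {a b d p₁ p₂ p₃ q₁ q₂ q₃}, ¬ BlockedTri K c a b d r' p₁ p₂ p₃ q₁ q₂ q₃ := by
      intro a b d p₁ p₂ p₃ q₁ q₂ q₃ k
      have hK : ∀ x, x ∈ K ↔ x = a ∨ x = b ∨ x = d ∨ x = r' ∨ x = p₁ ∨ x = p₂ ∨ x = p₃ ∨ x = q₁ ∨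
          x = q₂ ∨ x = q₃ := by
        intro x; rw [k.eq]; simp
      have ma := (hK a).2 (by simp)
      have mr := (hK r').2 (by simp)
      have m₁ := (hK p₁).2 (by simp)
      have m₂ := (hK p₂).2 (by simp)
      have m₃ := (hK p₃).2 (by simp)
      have n₁ := (hK q₁).2 (by simp)
      have n₂ := (hK q₂).2 (by simp)
      have n₃ := (hK q₃).2 (by simp)
      rcases (hK r).1 hr with rfl | rfl | rfl | rfl | rfl | rfl | rfl | rfl | rfl | rfl
      · exact k.ne_ra (hu _ mr k.ca.symm)
      · exact k.ne_rb (hu _ mr k.cb.symm)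
      · exact k.ne_rd (hu _ mr k.cd.symm)
      · exact k.ne_ra (hu _ ma k.ca).symm
      · exact k.ne₁ (hu _ n₁ k.cq₁).symm
      · exact k.ne₂ (hu _ n₂ k.cq₂).symm
      · exact k.ne₃ (hu _ n₃ k.cq₃).symm
      · exact k.ne₁ (hu _ m₁ k.cq₁.symm)
      · exact k.ne₂ (hu _ m₂ k.cq₂.symm)
      · exact k.ne₃ (hu _ m₃ k.cq₃.symm)
    rcases k with k | k <;> exact main k

end Extremal

/-- Four points in general position are the vertices of a convex quadrilateral, or one of them lies
inside the triangle of the others. -/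
theorem exists_quad_or_tri {w x y z : ℝ × ℝ} (hwxy : cross w x y ≠ 0) (hwxz : cross w x z ≠ 0)
    (hxyz : cross x y z ≠ 0) (hywz : cross y w z ≠ 0) :
    ∃ a b d e : ℝ × ℝ, ({w, x, y, z} : Set (ℝ × ℝ)) = {a, b, d, e} ∧
      ((0 < cross e a b ∧ 0 < cross a b d ∧ 0 < cross b d e ∧ 0 < cross d e a) ∨
        0 < cross a b d ∧ 0 < cross a b e ∧ 0 < cross b d e ∧ 0 < cross d a e) := by
  wlog h : 0 < cross w x y generalizing w x
  · obtain ⟨a, b, d, e, hs, h'⟩ := this (w := x) (x := w) (by rwa [cross_swap, neg_ne_zero])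
      (by rwa [cross_swap, neg_ne_zero]) (by rwa [cross_swap, neg_ne_zero])
      (by rwa [cross_swap, neg_ne_zero])
      (by rw [cross_swap]; exact neg_pos.2 (lt_of_le_of_ne (not_lt.1 h) hwxy))
    exact ⟨a, b, d, e, by rw [Set.insert_comm, hs], h'⟩
  have hsum := cross_add_cross_add_cross w x y z
  rcases hwxz.lt_or_gt with h₁ | h₁ <;> rcases hxyz.lt_or_gt with h₂ | h₂ <;>
    rcases hywz.lt_or_gt with h₃ | h₃
  · linarith
  · refine ⟨y, w, z, x, by ext; simp; tauto, Or.inr ?_⟩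
    simp only [cross] at *
    refine ⟨?_, ?_, ?_, ?_⟩ <;> linarith
  · refine ⟨x, y, z, w, by ext; simp; tauto, Or.inr ?_⟩
    simp only [cross] at *
    refine ⟨?_, ?_, ?_, ?_⟩ <;> linarith
  · refine ⟨w, z, x, y, by ext; simp; tauto, Or.inl ?_⟩
    simp only [cross] at *
    refine ⟨?_, ?_, ?_, ?_⟩ <;> linarith
  · refine ⟨w, x, z, y, by ext; simp; tauto, Or.inr ?_⟩
    simp only [cross] at *
    refine ⟨?_, ?_, ?_, ?_⟩ <;> linarith
  · refine ⟨x, z, y, w, by ext; simp; tauto, Or.inl ?_⟩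
    simp only [cross] at *
    refine ⟨?_, ?_, ?_, ?_⟩ <;> linarith
  · refine ⟨y, z, w, x, by ext; simp; tauto, Or.inl ?_⟩
    simp only [cross] at *
    refine ⟨?_, ?_, ?_, ?_⟩ <;> linarith
  · exact ⟨w, x, y, z, rfl, Or.inr ⟨h, h₁, h₂, h₃⟩⟩

theorem mem_convexHull_extreme {P : Set (ℝ × ℝ)} (hP : P.Finite) :
    P ⊆ convexHull ℝ {t ∈ P | t ∉ convexHull ℝ (P \ {t})} := by
  have hext : (convexHull ℝ P).extremePoints ℝ ⊆ {t ∈ P | t ∉ convexHull ℝ (P \ {t})} := by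
    intro t ht
    refine ⟨extremePoints_convexHull_subset ht, fun hn => ?_⟩
    rw [(convex_convexHull ℝ P).mem_extremePoints_iff_mem_sdiff_convexHull_sdiff] at ht
    exact ht.2 (convexHull_mono (Set.sdiff_subset_sdiff_left (subset_convexHull ℝ P)) hn)
  have hcl := closure_convexHull_extremePoints (hP.isCompact_convexHull (𝕜 := ℝ))
    (convex_convexHull ℝ P)
  rw [((hP.subset extremePoints_convexHull_subset).isClosed_convexHull (𝕜 := ℝ)).closure_eq] at hcl
  exact (subset_convexHull ℝ P).trans (hcl ▸ convexHull_mono hext)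

namespace FourBlocked

variable {P : Set (ℝ × ℝ)} {c : ℝ × ℝ → Fin 4}

theorem diff_extreme (h : FourBlocked P c) {t : ℝ × ℝ} (ht : t ∉ convexHull ℝ (P \ {t})) :
    FourBlocked (P \ {t}) c := by
  refine h.restrict Set.sdiff_subset fun u hu v hv _ z hz hb => ⟨hz, ?_⟩
  rintro rfl
  exact ht ((convex_convexHull ℝ _).openSegment_subset (subset_convexHull ℝ _ hu)
    (subset_convexHull ℝ _ hv) hb)

theorem extremal_of_quad (h : FourBlocked P c) {a b d e : ℝ × ℝ} {i : Fin 4}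
    (hR : P ∩ c ⁻¹' {i} = {a, b, d, e}) (hP : P ⊆ convexHull ℝ {a, b, d, e})
    (pa : 0 < cross e a b) (pb : 0 < cross a b d) (pd : 0 < cross b d e) (pe : 0 < cross d e a) :
    Extremal P c := by
  have hm : ∀ x, x ∈ P ∧ c x = i ↔ x = a ∨ x = b ∨ x = d ∨ x = e := by
    intro x
    simpa using Set.ext_iff.1 hR x
  obtain ⟨ma, ca⟩ := (hm a).2 (by simp)
  obtain ⟨mb, cb⟩ := (hm b).2 (by simp)
  obtain ⟨md, cd⟩ := (hm d).2 (by simp)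
  obtain ⟨me, ce⟩ := (hm e).2 (by simp)
  have side : ∀ p q, 0 ≤ cross p q a → 0 ≤ cross p q b → 0 ≤ cross p q d → 0 ≤ cross p q e →
      ∀ x ∈ P, 0 ≤ cross p q x := by
    intro p q ha hb hd he x hx
    refine cross_nonneg_of_mem_convexHull ?_ (hP hx)
    rintro y (rfl | rfl | rfl | rfl) <;> assumption
  have hab := (ne_of_cross_ne_zero pb.ne').1
  have hbd := (ne_of_cross_ne_zero pd.ne').1
  have hde := (ne_of_cross_ne_zero pe.ne').1
  have hea := (ne_of_cross_ne_zero pa.ne').1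
  obtain ⟨s₁, m₁, hs₁⟩ := h.exists_blocker ma mb hab (ca.trans cb.symm)
  obtain ⟨s₂, m₂, hs₂⟩ := h.exists_blocker mb md hbd (cb.trans cd.symm)
  obtain ⟨s₃, m₃, hs₃⟩ := h.exists_blocker md me hde (cd.trans ce.symm)
  obtain ⟨s₄, m₄, hs₄⟩ := h.exists_blocker me ma hea (ce.trans ca.symm)
  have k : HullQuad P c a b d e s₁ s₂ s₃ s₄ :=
    { blocked := h
      ma, mb, md, me, pa, pb, pd, pe, m₁, m₂, m₃, m₄, hs₁, hs₂, hs₃, hs₄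
      cb := cb.trans ca.symm
      cd := cd.trans ca.symm
      ce := ce.trans ca.symm
      only := fun x hx hc => (hm x).1 ⟨hx, hc.trans ca⟩
      nonneg := fun x hx =>
        ⟨side a b (cross_self_mid ..).ge (cross_self_right ..).ge pb.le
            (by rw [← cross_rotate]; exact pa.le) x hx,
          side b d (by rw [← cross_rotate]; exact pb.le) (cross_self_mid ..).ge
            (cross_self_right ..).ge pd.le x hx,
          side d e pe.le (by rw [← cross_rotate]; exact pd.le) (cross_self_mid ..).ge
            (cross_self_right ..).ge x hx,
          side e a (cross_self_right ..).ge pa.le (by rw [← cross_rotate]; exact pe.le)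
            (cross_self_mid ..).ge x hx⟩ }
  obtain ⟨m, hk⟩ := k.exists_blockedQuad
  exact Or.inl ⟨a, b, d, e, s₁, s₂, s₃, s₄, m, hk, pb, pd, pe, pa⟩

theorem extremal_of_tri (h : FourBlocked P c) {a b d r : ℝ × ℝ} {i : Fin 4}
    (hR : P ∩ c ⁻¹' {i} = {a, b, d, r}) (hP : P ⊆ convexHull ℝ {a, b, d, r})
    (pos : 0 < cross a b d) (rd : 0 < cross a b r) (ra : 0 < cross b d r) (rb : 0 < cross d a r)
    (ih : ∀ j, 4 ≤ ((P \ {a, b, d}) ∩ c ⁻¹' {j}).ncard → FourBlocked (P \ {a, b, d}) c →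
      Extremal (P \ {a, b, d}) c) : Extremal P c := by
  have hm : ∀ x, x ∈ P ∧ c x = i ↔ x = a ∨ x = b ∨ x = d ∨ x = r := by
    intro x
    simpa using Set.ext_iff.1 hR x
  obtain ⟨ma, ca⟩ := (hm a).2 (by simp)
  obtain ⟨mb, cb⟩ := (hm b).2 (by simp)
  obtain ⟨md, cd⟩ := (hm d).2 (by simp)
  obtain ⟨mr, cr⟩ := (hm r).2 (by simp)
  have side : ∀ p q, 0 ≤ cross p q a → 0 ≤ cross p q b → 0 ≤ cross p q d → 0 ≤ cross p q r →
      ∀ x ∈ P, 0 ≤ cross p q x := by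
    intro p q ha hb hd hr x hx
    refine cross_nonneg_of_mem_convexHull ?_ (hP hx)
    rintro y (rfl | rfl | rfl | rfl) <;> assumption
  have k : HullTri P c a b d r :=
    { blocked := h
      ma, mb, md, mr, pos, rd, ra, rb
      ca := ca.trans cr.symm
      cb := cb.trans cr.symm
      cd := cd.trans cr.symm
      only := fun x hx hc => (hm x).1 ⟨hx, hc.trans cr⟩
      subset := fun x hx =>
        ⟨side a b (cross_self_mid ..).ge (cross_self_right ..).ge pos.le rd.le x hx,
          side b d (by rw [← cross_rotate]; exact pos.le) (cross_self_mid ..).ge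
            (cross_self_right ..).ge ra.le x hx,
          side d a (cross_self_right ..).ge (by rw [cross_rotate]; exact pos.le)
            (cross_self_mid ..).ge rb.le x hx⟩ }
  have hcl : ∀ j, ((P \ {a, b, d}) ∩ c ⁻¹' {j}).ncard ≤ 3 := by
    intro j
    by_contra! hj
    obtain ⟨hra, hrb, hrd⟩ := k.ne_r
    obtain ⟨p, mp, hp⟩ := h.exists_blocker mr ma hra k.ca.symm
    have hcp := h.colour_ne mp mr ma hra hp
    obtain ⟨v, hv, hb⟩ := (ih j hj k.restrict).exists_blocks_of_unique
      ⟨mr, by simp [hra, hrb, hrd]⟩ (fun x => k.unique) (k.mem_of_colour_ne mp hcp)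
      (fun e => hcp (by rw [e]))
    exact k.not_centre_blocks hp mp hv hb
  obtain ⟨p₁, p₂, p₃, q₁, q₂, q₃, hk⟩ := k.exists_blockedTri hcl
  exact Or.inr ⟨a, b, d, r, p₁, p₂, p₃, q₁, q₂, q₃, ⟨pos, rd, ra, rb⟩, hk⟩

theorem extremal_of_four_le (h : FourBlocked P c) (i : Fin 4)
    (h4 : 4 ≤ (P ∩ c ⁻¹' {i}).ncard) : Extremal P c := by
  induction hn : P.ncard using Nat.strong_induction_on generalizing P i with
  | _ n ih =>
  subst hn
  have hlt : ∀ t ∈ P, t ∉ convexHull ℝ (P \ {t}) → ((P ∩ c ⁻¹' {i}) \ {t}).ncard < 4 := by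
    intro t ht hx
    by_contra! hge
    have hd := h.diff_extreme hx
    have hE := ih _ (Set.ncard_sdiff_singleton_lt_of_mem ht h.finite) hd i
      (by rwa [← Set.inter_sdiff_right_comm]) rfl
    refine hE.not_fourBlocked_insert hx ?_
    rwa [Set.insert_sdiff_singleton, Set.insert_eq_of_mem ht]
  have hhull := mem_convexHull_extreme h.finite
  have hsub : {t ∈ P | t ∉ convexHull ℝ (P \ {t})} ⊆ P ∩ c ⁻¹' {i} := by
    rintro t ⟨ht, hx⟩
    by_contra hn
    have := hlt t ht hx
    rw [Set.sdiff_singleton_eq_self hn] at this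
    omega
  replace hR : (P ∩ c ⁻¹' {i}).ncard = 4 := by
    obtain ⟨x, hx, -⟩ := Set.nonempty_of_ncard_ne_zero (show (P ∩ c ⁻¹' {i}).ncard ≠ 0 by omega)
    obtain ⟨t, ht⟩ := convexHull_nonempty_iff.1 ⟨x, hhull hx⟩
    have := hlt t ht.1 ht.2
    rw [Set.ncard_sdiff_singleton_of_mem (hsub ht)] at this
    omega
  replace hhull := hhull.trans (convexHull_mono hsub)
  obtain ⟨w, x, y, z, hwx, hwy, hwz, hxy, hxz, hyz, hset⟩ := Set.ncard_eq_four.1 hR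
  have hm : ∀ u ∈ ({w, x, y, z} : Set (ℝ × ℝ)), u ∈ P ∧ c u = i := by
    intro u hu
    rwa [← hset] at hu
  obtain ⟨mw, cw⟩ := hm w (by simp)
  obtain ⟨mx, cx⟩ := hm x (by simp)
  obtain ⟨my, cy⟩ := hm y (by simp)
  obtain ⟨mz, cz⟩ := hm z (by simp)
  obtain ⟨a, b, d, e, he, hq⟩ := exists_quad_or_tri
    (h.cross_ne_zero mw mx my hwx hwy hxy (cw.trans cx.symm) (cw.trans cy.symm))
    (h.cross_ne_zero mw mx mz hwx hwz hxz (cw.trans cx.symm) (cw.trans cz.symm))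
    (h.cross_ne_zero mx my mz hxy hxz hyz (cx.trans cy.symm) (cx.trans cz.symm))
    (h.cross_ne_zero my mw mz hwy.symm hyz hwz (cy.trans cw.symm) (cy.trans cz.symm))
  rw [he] at hset
  rw [hset] at hhull
  rcases hq with ⟨pa, pb, pd, pe⟩ | ⟨pos, rd, ra, rb⟩
  · exact h.extremal_of_quad hset hhull pa pb pd pe
  · refine h.extremal_of_tri hset hhull pos rd ra rb fun j hj hb => ih _ ?_ hb j hj rfl
    have ha : a ∈ P ∩ c ⁻¹' {i} := by simp [hset]
    exact Set.ncard_lt_ncard (Set.sdiff_ssubset_left_iff.2 ⟨a, ha.1, by simp⟩) h.finite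

theorem ncard_le (h : FourBlocked P c) : P.ncard ≤ 12 := by
  by_cases h4 : ∃ i, 4 ≤ (P ∩ c ⁻¹' {i}).ncard
  · obtain ⟨i, hi⟩ := h4
    exact (h.extremal_of_four_le i hi).ncard_le
  · push Not at h4
    rw [ncard_eq_sum h.finite c]
    exact (Finset.sum_le_card_nsmul _ _ 3 fun i _ => Nat.le_of_lt_succ (h4 i)).trans (by simp)

end FourBlocked

/-- Every 4-blocked set has at most 12 points, and there is a 4-blocked set
(namely a `{3,3,3,3}`-blocked set) with exactly 12 points. -/
theorem four_blocked_max_12 :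
    (∀ P : Set (ℝ × ℝ), KBlocked 4 P → P.ncard ≤ 12) ∧
    (∃ P : Set (ℝ × ℝ), IsNBlocked ({3, 3, 3, 3} : Multiset ℕ) P ∧ P.ncard = 12) := by
  refine ⟨?_, exists_threefold_blocked⟩
  rintro P ⟨hP, c, hc⟩
  exact FourBlocked.ncard_le ⟨hP, hc⟩
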